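/- Let f be a strictly non-real meromorphic function in the complex plane such that, for every m = 0, 1, …, 10, all zeros of f^{(m)} are real. Then f is given by one of the following forms, where a, b, c, d are complex numbers and μ is an integer: (i) f(z) = (az+b)^μ; (ii) f(z) = (az+b)/(cz+d); (iii) f(z) = e^{az+b} − c. -/

import Mathlib

open Complex Filter Topology MeasureTheory
open scoped Classical

noncomputable section

/-- `mtilde f` is the function `z ↦ conj (f (conj z))`, denoted `f̃` in the paper. -/
def mtilde (f : ℂ → ℂ) : ℂ → ℂ := fun z => (starRingEnd ℂ) (f ((starRingEnd ℂ) z))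

/-- Equality of meromorphic functions: near every point of `ℂ`, the two functions agree on a
punctured neighbourhood (so the set where they disagree is closed and discrete). -/
def MeroEq (h₁ h₂ : ℂ → ℂ) : Prop := ∀ z : ℂ, ∀ᶠ w in 𝓝[≠] z, h₁ w = h₂ w

/-- `f` is strictly non-real: `f̃` is not a constant multiple of `f`. -/
def StrictlyNonReal (f : ℂ → ℂ) : Prop := ¬ ∃ c : ℂ, MeroEq (mtilde f) (fun z => c * f z)

/-- A rational function, as a meromorphic function on `ℂ`. -/
def IsRatFn (h : ℂ → ℂ) : Prop :=
  ∃ p q : Polynomial ℂ, q ≠ 0 ∧ MeroEq h (fun z => p.eval z / q.eval z)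

/-- The order of vanishing (negative at a pole) of a function at a point, when the function is
meromorphic there; junk value `0` otherwise. -/
def meroOrder (h : ℂ → ℂ) (z : ℂ) : WithTop ℤ :=
  if hh : MeromorphicAt h z then meromorphicOrderAt h z else 0

/-- The positive part of the logarithm. -/
def logPlus (x : ℝ) : ℝ := max (Real.log x) 0

/-- The Nevanlinna proximity function `m(r, h)`. -/
def proximity (h : ℂ → ℂ) (r : ℝ) : ℝ :=
  (2 * Real.pi)⁻¹ * ∫ θ in (0:ℝ)..(2 * Real.pi),
    logPlus ‖h ((r : ℂ) * Complex.exp (θ * Complex.I))‖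

/-- The multiplicity of a pole of `h` at `z` (0 if not a pole). -/
def poleMult (h : ℂ → ℂ) (z : ℂ) : ℕ := (-((meroOrder h z).untopD 0)).toNat

/-- The number of poles, counted with multiplicity, in the closed disc of radius `t`. -/
def poleCount (h : ℂ → ℂ) (t : ℝ) : ℝ := ∑ᶠ z ∈ Metric.closedBall (0:ℂ) t, (poleMult h z : ℝ)

/-- The integrated counting function `N(r, h)` of the poles of `h` (with multiplicity). -/
def NCount (h : ℂ → ℂ) (r : ℝ) : ℝ := ∫ t in (1:ℝ)..r, poleCount h t / t

/-- The Nevanlinna characteristic `T(r, h) = m(r, h) + N(r, h)`. -/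
def TChar (h : ℂ → ℂ) (r : ℝ) : ℝ := proximity h r + NCount h r

/-- The number of points of `S` in the closed disc of radius `t`. -/
def distinctCount (S : Set ℂ) (t : ℝ) : ℝ := (S ∩ Metric.closedBall (0:ℂ) t).ncard

/-- The integrated counting function `N̄(r, h)` of the distinct poles of `h`. -/
def NbarPoles (h : ℂ → ℂ) (r : ℝ) : ℝ :=
  ∫ t in (1:ℝ)..r, distinctCount {z | meroOrder h z < 0} t / t

/-- The integrated counting function `N̄(r, 1/h)` of the distinct zeros of `h`. -/
def NbarZeros (h : ℂ → ℂ) (r : ℝ) : ℝ :=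
  ∫ t in (1:ℝ)..r, distinctCount {z | 0 < meroOrder h z} t / t

/-- `h` has finite (Nevanlinna) order: `T(r, h) ≤ r ^ C` for all large `r`. -/
def FiniteOrder (h : ℂ → ℂ) : Prop := ∃ C : ℝ, ∀ᶠ r in atTop, TChar h r ≤ r ^ C

/-- `h` has finite lower order: `T(r, h) ≤ r ^ C` for arbitrarily large `r`. -/
def FiniteLowerOrder (h : ℂ → ℂ) : Prop := ∃ C : ℝ, ∃ᶠ r in atTop, TChar h r ≤ r ^ C

/-- The Setup of Section 3 of the paper: `M ≥ 4` and `f` is a strictly non-real meromorphic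
function in the plane such that `f, f', …, f^(M+3)` all have finitely many non-real zeros. -/
def Setup (M : ℕ) (f : ℂ → ℂ) : Prop :=
  4 ≤ M ∧ (∀ z, MeromorphicAt f z) ∧ StrictlyNonReal f ∧
    ∀ m, m ≤ M + 3 → {z : ℂ | 0 < meroOrder (iteratedDeriv m f) z ∧ z.im ≠ 0}.Finite

/-- The function `F_m(z) = z - f^(m)(z) / f^(m+1)(z)`. -/
def Fm (f : ℂ → ℂ) (m : ℕ) : ℂ → ℂ :=
  fun z => z - iteratedDeriv m f z / iteratedDeriv (m + 1) f z

/-- `Km` is the meromorphic function with finitely many zeros and poles satisfying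
`F_m' = K_m G_m'`, where `G_m` is the analogue of `F_m` for `g = f̃`. -/
def IsKm (f : ℂ → ℂ) (m : ℕ) (Km : ℂ → ℂ) : Prop :=
  (∀ z, MeromorphicAt Km z) ∧ {z | 0 < meroOrder Km z}.Finite ∧
    {z | meroOrder Km z < 0}.Finite ∧
    MeroEq (deriv (Fm f m)) (fun z => Km z * deriv (Fm (mtilde f) m) z)

end

/-- A zero-free holomorphic function on a disc has a holomorphic logarithm. -/
lemma exists_log_ball {F : ℂ → ℂ} {c : ℂ} {r : ℝ} (hr : 0 < r)
    (hF : DifferentiableOn ℂ F (Metric.ball c r)) (h0 : ∀ z ∈ Metric.ball c r, F z ≠ 0) :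
    ∃ h : ℂ → ℂ, DifferentiableOn ℂ h (Metric.ball c r) ∧
      (∀ z ∈ Metric.ball c r, F z = cexp (h z)) ∧
      (∀ z ∈ Metric.ball c r, HasDerivAt h (deriv F z / F z) z) := by
  have hd : DifferentiableOn ℂ (fun z => deriv F z / F z) (Metric.ball c r) :=
    (hF.deriv Metric.isOpen_ball).div hF h0
  obtain ⟨h, hc, hh⟩ := hd.isExactOn_ball.with_val_at c (Complex.log (F c))
  have hcm : c ∈ Metric.ball c r := Metric.mem_ball_self hr
  refine ⟨h, fun z hz => (hh z hz).differentiableAt.differentiableWithinAt, ?_, hh⟩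
  have hder : ∀ z ∈ Metric.ball c r, HasDerivAt (fun z => F z * cexp (-h z)) 0 z := by
    intro z hz
    have h1 : HasDerivAt F (deriv F z) z :=
      (hF.differentiableAt (Metric.isOpen_ball.mem_nhds hz)).hasDerivAt
    have hz0 := h0 z hz
    exact (h1.fun_mul (hh z hz).fun_neg.cexp).congr_deriv (by field_simp; ring)
  intro z hz
  have key : F z * cexp (-h z) = F c * cexp (-h c) := by
    have := (convex_ball c r).is_const_of_fderivWithin_eq_zero (𝕜 := ℂ)
      (f := fun z => F z * cexp (-h z))
      (fun w hw => (hder w hw).differentiableAt.differentiableWithinAt)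
      (fun w hw => by
        rw [fderivWithin_of_isOpen Metric.isOpen_ball hw]
        have := (hder w hw).hasFDerivAt.fderiv
        rw [this]; ext; simp) hz hcm
    exact this
  rw [hc, Complex.exp_neg (Complex.log _), Complex.exp_log (h0 c hcm),
    mul_inv_cancel₀ (h0 c hcm), Complex.exp_neg] at key
  have := Complex.exp_ne_zero (h z)
  field_simp at key
  exact key

/-- Harnack package for functions with positive real part. -/
lemma harnack_re {P : ℂ → ℂ} {c : ℂ} {r : ℝ} (hr : 0 < r)
    (hP : DifferentiableOn ℂ P (Metric.ball c r)) (h0 : ∀ z ∈ Metric.ball c r, 0 < (P z).re) :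
    (∀ z ∈ Metric.ball c r, (P z).re * (r - dist z c) ≤ (P c).re * (r + dist z c)) ∧
    (∀ z ∈ Metric.ball c r, (P c).re * (r - dist z c) ≤ (P z).re * (r + dist z c)) ∧
    ‖deriv P c‖ ≤ 2 / r * (P c).re := by
  have hcm : c ∈ Metric.ball c r := Metric.mem_ball_self hr
  set p := P c with hp
  set a := p.re with ha
  have hapos : 0 < a := h0 c hcm
  have hne : ∀ z ∈ Metric.ball c r, P z + (starRingEnd ℂ) p ≠ 0 := by
    intro z hz h
    have := congrArg Complex.re h
    simp at this
    have := h0 z hz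
    linarith
  set q : ℂ → ℂ := fun z => (P z - p) / (P z + (starRingEnd ℂ) p) with hq
  have hqd : DifferentiableOn ℂ q (Metric.ball c r) :=
    (hP.sub_const _).div (hP.add_const _) hne
  have hqc : q c = 0 := by simp [hq, hp]
  have hmaps : Set.MapsTo q (Metric.ball c r) (Metric.closedBall (q c) 1) := by
    intro z hz
    rw [hqc, mem_closedBall_zero_iff, hq]
    simp only [norm_div]
    rw [div_le_one (norm_pos_iff.2 (hne z hz))]
    rw [← sq_le_sq₀ (by positivity) (by positivity)]
    have := h0 z hz
    simp only [Complex.sq_norm, normSq_apply, sub_re, sub_im, add_re, add_im, conj_re, conj_im]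
    nlinarith [mul_pos this hapos]
  have hS : ∀ z ∈ Metric.ball c r, ‖P z - p‖ * r ≤ ‖P z + (starRingEnd ℂ) p‖ * dist z c := by
    intro z hz
    have := Complex.dist_le_div_mul_dist_of_mapsTo_ball hqd hmaps hz
    rw [hqc, dist_zero_right, hq] at this
    simp only [norm_div] at this
    rw [div_le_iff₀ (norm_pos_iff.2 (hne z hz))] at this
    calc _ ≤ (1 / r * dist z c * ‖P z + (starRingEnd ℂ) p‖) * r := by gcongr
      _ = _ := by field_simp
  have hS2 : ∀ z ∈ Metric.ball c r, |(P z).re - a| * r ≤ ((P z).re + a) * dist z c := by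
    intro z hz
    have h1 := hS z hz
    have hpos := h0 z hz
    have hd : dist z c < r := hz
    have hd0 : 0 ≤ dist z c := dist_nonneg
    have h2 : (‖P z - p‖ * r)^2 ≤ (‖P z + (starRingEnd ℂ) p‖ * dist z c)^2 := by gcongr
    rw [mul_pow, mul_pow] at h2
    simp only [Complex.sq_norm, normSq_apply, sub_re, sub_im, add_re, add_im, conj_re, conj_im] at h2
    apply abs_le_of_sq_le_sq' _ (by positivity) |>.2 |> le_trans (le_of_eq rfl) 
    rw [mul_pow, mul_pow, sq_abs]
    have : dist z c ^2 ≤ r^2 := by gcongr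
    nlinarith [mul_nonneg (sub_nonneg.2 this) (sq_nonneg ((P z).im - p.im))]
  refine ⟨fun z hz => ?_, fun z hz => ?_, ?_⟩
  · have := hS2 z hz
    have h3 := mul_le_mul_of_nonneg_right (le_abs_self ((P z).re - a)) hr.le
    nlinarith
  · have := hS2 z hz
    have h3 := mul_le_mul_of_nonneg_right (neg_le_abs ((P z).re - a)) hr.le
    nlinarith
  · have h1 := Complex.norm_deriv_le_div_of_mapsTo_ball hqd hmaps hr
    have hPc : HasDerivAt P (deriv P c) c :=
      (hP.differentiableAt (Metric.isOpen_ball.mem_nhds hcm)).hasDerivAt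
    have h2 : HasDerivAt q _ c := (hPc.sub_const p).div (hPc.add_const ((starRingEnd ℂ) p)) (hne c hcm)
    rw [h2.deriv] at h1
    have e : P c + (starRingEnd ℂ) p = ((2 * a : ℝ) : ℂ) := by
      rw [← hp, Complex.add_conj]
    rw [e, ← hp, sub_self, zero_mul, sub_zero, mul_div_assoc, norm_mul] at h1
    have h2a : ((2 * a : ℝ) : ℂ) ≠ 0 := by exact_mod_cast (by positivity : (2*a) ≠ 0)
    rw [sq, div_mul_cancel_left₀ h2a, norm_inv, Complex.norm_real, Real.norm_eq_abs,
      abs_of_pos (by positivity)] at h1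
    rw [← div_eq_mul_inv, div_le_iff₀ (by positivity)] at h1
    calc _ ≤ _ := h1
      _ = _ := by ring

/-- Harnack package for zero-free bounded functions. -/
lemma harnack_log {F : ℂ → ℂ} {c : ℂ} {r M : ℝ} (hr : 0 < r)
    (hF : DifferentiableOn ℂ F (Metric.ball c r)) (h0 : ∀ z ∈ Metric.ball c r, F z ≠ 0)
    (hM : ∀ z ∈ Metric.ball c r, Real.log ‖F z‖ ≤ M) :
    (∀ z ∈ Metric.ball c r, (M - Real.log ‖F z‖) * (r - dist z c) ≤
      (M - Real.log ‖F c‖) * (r + dist z c)) ∧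
    (∀ z ∈ Metric.ball c r, (M - Real.log ‖F c‖) * (r - dist z c) ≤
      (M - Real.log ‖F z‖) * (r + dist z c)) ∧
    ‖deriv F c / F c‖ ≤ 2 / r * (M - Real.log ‖F c‖) := by
  obtain ⟨h, hd, he, hder⟩ := exists_log_ball hr hF h0
  have hcm : c ∈ Metric.ball c r := Metric.mem_ball_self hr
  have hre : ∀ z ∈ Metric.ball c r, Real.log ‖F z‖ = (h z).re := by
    intro z hz
    rw [he z hz, Complex.norm_exp, Real.log_exp]
  have key : ∀ ε > 0,
    (∀ z ∈ Metric.ball c r, (M + ε - Real.log ‖F z‖) * (r - dist z c) ≤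
      (M + ε - Real.log ‖F c‖) * (r + dist z c)) ∧
    (∀ z ∈ Metric.ball c r, (M + ε - Real.log ‖F c‖) * (r - dist z c) ≤
      (M + ε - Real.log ‖F z‖) * (r + dist z c)) ∧
    ‖deriv F c / F c‖ ≤ 2 / r * (M + ε - Real.log ‖F c‖) := by
    intro ε hε
    have hP : DifferentiableOn ℂ (fun z => ((M + ε : ℝ) : ℂ) - h z) (Metric.ball c r) :=
      hd.const_sub _
    obtain ⟨h1, h2, h3⟩ := harnack_re hr hP (fun z hz => by
      simp only [sub_re, ofReal_re]
      have := hM z hz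
      rw [hre z hz] at this
      linarith)
    simp only [sub_re, ofReal_re] at h1 h2 h3
    have h4 : deriv (fun z => ((M + ε : ℝ) : ℂ) - h z) c = -(deriv F c / F c) :=
      ((hder c hcm).const_sub _).deriv
    rw [h4, norm_neg] at h3
    refine ⟨fun z hz => ?_, fun z hz => ?_, ?_⟩
    · rw [hre z hz, hre c hcm]; exact h1 z hz
    · rw [hre z hz, hre c hcm]; exact h2 z hz
    · rw [hre c hcm]; exact h3
  have lim : ∀ A B s t: ℝ, (∀ ε > 0, (A + ε) * s ≤ (B + ε) * t) → A * s ≤ B * t := by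
    intro A B s t H
    have h1 : Tendsto (fun ε : ℝ => (A + ε) * s) (𝓝[>] 0) (𝓝 ((A + 0) * s)) :=
      (Continuous.tendsto (by fun_prop) 0).mono_left nhdsWithin_le_nhds
    have h2 : Tendsto (fun ε : ℝ => (B + ε) * t) (𝓝[>] 0) (𝓝 ((B + 0) * t)) :=
      (Continuous.tendsto (by fun_prop) 0).mono_left nhdsWithin_le_nhds
    have := le_of_tendsto_of_tendsto h1 h2 (by filter_upwards [self_mem_nhdsWithin] with ε hε using H ε hε)
    simpa using this
  refine ⟨fun z hz => ?_, fun z hz => ?_, ?_⟩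
  · apply lim
    intro ε hε
    have := (key ε hε).1 z hz
    simpa only [sub_add_eq_add_sub] using this
  · apply lim
    intro ε hε
    have := (key ε hε).2.1 z hz
    simpa only [sub_add_eq_add_sub] using this
  · apply le_of_forall_pos_le_add
    intro ε hε
    have := (key (ε * r / 2) (by positivity)).2.2
    calc _ ≤ _ := this
      _ = _ := by field_simp; ring

/-- Hopf type lemma. -/
lemma hopf_bound {V : ℂ → ℂ} {R δ G : ℝ} {z0 ζ1 : ℂ} (hδ : 0 < δ)
    (hV : DifferentiableOn ℂ V (Metric.ball 0 R))
    (hG : ∀ w ∈ Metric.ball (0:ℂ) R, ‖V w‖ = δ → ‖deriv V w‖ ≤ G) (hG0 : 0 ≤ G)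
    (hζ : ζ1 ∈ Metric.ball (0:ℂ) (R/4)) (hVζ : ‖V ζ1‖ ≤ δ) (hz0 : z0 ∈ Metric.ball (0:ℂ) (R/4)) :
    Real.log (‖V z0‖ / δ) ≤ 2 * (G / δ) * dist ζ1 z0 := by
  by_cases hle : ‖V z0‖ ≤ δ
  · have : Real.log (‖V z0‖ / δ) ≤ 0 :=
      Real.log_nonpos (by positivity) ((div_le_one hδ).2 hle)
    exact this.trans (by positivity)
  push Not at hle
  set d := dist ζ1 z0 with hd
  have hR : 0 < R := by
    have := (Metric.mem_ball.1 hz0); have h2 : 0 ≤ dist z0 0 := dist_nonneg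
    linarith
  have hsub : Metric.closedBall z0 d ⊆ Metric.ball (0:ℂ) R := by
    intro w hw
    rw [Metric.mem_closedBall] at hw
    rw [Metric.mem_ball] at *
    have h1 := dist_triangle w z0 0
    have h2 := dist_triangle_right ζ1 z0 0
    linarith
  have hcont : ContinuousOn V (Metric.closedBall z0 d) := hV.continuousOn.mono hsub
  have hScomp : IsCompact {w ∈ Metric.closedBall z0 d | ‖V w‖ ≤ δ} := by
    have : {w ∈ Metric.closedBall z0 d | ‖V w‖ ≤ δ} =
      Metric.closedBall z0 d ∩ (fun w => ‖V w‖) ⁻¹' (Set.Iic δ) := by ext; simp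
    rw [this]
    exact (isCompact_closedBall z0 d).of_isClosed_subset
      (hcont.norm.preimage_isClosed_of_isClosed Metric.isClosed_closedBall isClosed_Iic)
      Set.inter_subset_left
  obtain ⟨w, hwS, hwmin⟩ := hScomp.exists_isMinOn ⟨ζ1, by simp [hd], hVζ⟩
    (f := fun w => dist w z0) (by fun_prop)
  obtain ⟨hwd, hwδ⟩ := hwS
  rw [Metric.mem_closedBall] at hwd
  set ρ := dist w z0 with hρ
  have hρ0 : 0 < ρ := by
    rw [hρ, dist_pos]; rintro rfl; linarith
  have hin : ∀ z ∈ Metric.ball z0 ρ, δ < ‖V z‖ := by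
    intro z hz
    by_contra hcon
    push Not at hcon
    have hz' : dist z z0 < ρ := hz
    have : dist w z0 ≤ dist z z0 := hwmin ⟨Metric.mem_closedBall.2 (hz'.le.trans hwd), hcon⟩
    linarith
  have hballsub : Metric.ball z0 ρ ⊆ Metric.ball (0:ℂ) R :=
    (Metric.ball_subset_closedBall.trans (Metric.closedBall_subset_closedBall hwd)).trans hsub
  have hwR : w ∈ Metric.ball (0:ℂ) R := hsub (Metric.mem_closedBall.2 hwd)
  have hne : ∀ z ∈ Metric.ball z0 ρ, V z ≠ 0 := fun z hz h => by
    have := hin z hz; rw [h, norm_zero] at this; linarith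
  have hHar := (harnack_log (F := fun z => (V z)⁻¹) (M := - Real.log δ) hρ0
    ((hV.mono hballsub).inv hne) (fun z hz => inv_ne_zero (hne z hz)) (fun z hz => by
      rw [norm_inv, Real.log_inv]
      have := Real.log_le_log hδ (hin z hz).le
      linarith)).2.1
  -- points on the segment
  have hVw : HasDerivAt V (deriv V w) w :=
    (hV.differentiableAt (Metric.isOpen_ball.mem_nhds hwR)).hasDerivAt
  have hseg : HasDerivAt (fun t : ℝ => z0 + (t:ℂ) * (w - z0)) (w - z0) 1 := by
    have : HasDerivAt (fun t : ℝ => (t:ℂ)) 1 1 := Complex.ofRealCLM.hasDerivAt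
    simpa using (this.mul_const (w - z0)).const_add z0
  have hcomp : HasDerivAt (fun t : ℝ => V (z0 + (t:ℂ) * (w - z0))) (deriv V w * (w - z0)) 1 := by
    have e : w = z0 + ((1:ℝ):ℂ) * (w - z0) := by simp
    have hVw' : HasDerivAt V (deriv V w) (z0 + ((1:ℝ):ℂ) * (w - z0)) := by rwa [← e]
    exact hVw'.comp (1:ℝ) hseg
  have hslope : Tendsto (fun t : ℝ => ‖slope (fun t : ℝ => V (z0 + (t:ℂ) * (w - z0))) 1 t‖)
      (𝓝[<] 1) (𝓝 ‖deriv V w * (w - z0)‖) :=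
    (hasDerivAt_iff_tendsto_slope.1 hcomp).norm.mono_left
      (nhdsWithin_mono _ (fun x hx => ne_of_lt hx))
  have hpt : ∀ t ∈ Set.Ioo (0:ℝ) 1, z0 + (t:ℂ) * (w - z0) ∈ Metric.ball z0 ρ ∧
      dist (z0 + (t:ℂ) * (w - z0)) z0 = t * ρ := by
    intro t ht
    have : dist (z0 + (t:ℂ) * (w - z0)) z0 = t * ρ := by
      rw [dist_eq_norm, add_sub_cancel_left, norm_mul, hρ, dist_eq_norm, Complex.norm_real,
        Real.norm_eq_abs, abs_of_pos ht.1]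
    refine ⟨?_, this⟩
    rw [Metric.mem_ball, this]
    nlinarith [ht.2]
  have hev : ∀ᶠ t in 𝓝[<] (1:ℝ), t ∈ Set.Ioo (0:ℝ) 1 := Ioo_mem_nhdsLT (by norm_num)
  have hwle : ‖V w‖ = δ := by
    refine le_antisymm hwδ ?_
    have : Tendsto (fun t : ℝ => ‖V (z0 + (t:ℂ) * (w - z0))‖) (𝓝[<] 1) (𝓝 ‖V w‖) := by
      have := (hcomp.continuousAt.tendsto.norm).mono_left (nhdsWithin_le_nhds (s := Set.Iio 1))
      simpa using this
    exact ge_of_tendsto this (hev.mono fun t ht => (hin _ (hpt t ht).1).le)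
  have hmain : Real.log (‖V z0‖ / δ) ≤ 2 / δ * ‖deriv V w * (w - z0)‖ := by
    refine ge_of_tendsto (hslope.const_mul (2/δ)) (hev.mono fun t ht => ?_)
    have hz := (hpt t ht).1
    have hh := hHar _ hz
    rw [(hpt t ht).2, norm_inv, norm_inv, Real.log_inv, Real.log_inv] at hh
    have hVz := hin _ hz
    have hl : Real.log ‖V (z0 + (t:ℂ) * (w - z0))‖ - Real.log δ ≤
        ‖V (z0 + (t:ℂ) * (w - z0)) - V w‖ / δ := by
      rw [← Real.log_div (by linarith) hδ.ne']
      have h1 := Real.log_le_sub_one_of_pos (x := ‖V (z0 + (t:ℂ) * (w - z0))‖ / δ)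
        (div_pos (hδ.trans hVz) hδ)
      refine h1.trans ?_
      rw [le_div_iff₀ hδ, sub_mul, div_mul_cancel₀ _ hδ.ne', one_mul]
      have := norm_sub_norm_le (V (z0 + (t:ℂ) * (w - z0))) (V w)
      rw [hwle] at this
      exact this
    rw [slope_def_module]
    simp only [ofReal_one, one_mul, add_sub_cancel]
    rw [norm_smul, norm_inv, Real.norm_eq_abs, abs_sub_comm,
      abs_of_pos (by linarith [ht.2]), Real.log_div (by linarith) hδ.ne']
    have h1t : 0 < 1 - t := by linarith [ht.2]
    set X := Real.log ‖V z0‖ - Real.log δ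
    set Y := ‖V (z0 + (t:ℂ) * (w - z0)) - V w‖ / δ with hY
    have hY0 : 0 ≤ Y := by positivity
    have h2 : X * (1 - t) ≤ Y * 2 := by
      have h3 : X * (ρ - t * ρ) ≤ Y * (ρ + t * ρ) := by
        calc _ = (-Real.log δ - -Real.log ‖V z0‖) * (ρ - t * ρ) := by ring
          _ ≤ _ := hh
          _ = (Real.log ‖V (z0 + (t:ℂ) * (w - z0))‖ - Real.log δ) * (ρ + t * ρ) := by ring
          _ ≤ _ := mul_le_mul_of_nonneg_right hl (by nlinarith [ht.1])
      have h4 : ρ * (X * (1 - t)) ≤ ρ * (Y * 2) := by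
        have : Y * (ρ + t * ρ) ≤ Y * (ρ + ρ) := by
          apply mul_le_mul_of_nonneg_left _ hY0; nlinarith [ht.2]
        nlinarith
      exact le_of_mul_le_mul_left h4 hρ0
    calc X = X * (1 - t) / (1 - t) := by field_simp
      _ ≤ Y * 2 / (1 - t) := by gcongr
      _ = _ := by rw [hY]; field_simp
  refine hmain.trans ?_
  rw [norm_mul, ← dist_eq_norm w z0]
  have := hG w hwR hwle
  calc 2 / δ * (‖deriv V w‖ * dist w z0) ≤ 2 / δ * (G * d) := by gcongr
    _ = _ := by ring

/-- Hurwitz. -/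
lemma hurwitz_zero {ι : Type*} {l : Filter ι} [l.NeBot] {F : ι → ℂ → ℂ} {g : ℂ → ℂ} {U : Set ℂ}
    (hU : IsOpen U) (hUc : IsPreconnected U) (hlim : TendstoLocallyUniformlyOn F g l U)
    (hF : ∀ z ∈ U, ∃ r > 0, Metric.ball z r ⊆ U ∧
      ∀ᶠ n in l, DifferentiableOn ℂ (F n) (Metric.ball z r) ∧ ∀ w ∈ Metric.ball z r, F n w ≠ 0)
    (hg : DifferentiableOn ℂ g U) :
    (∀ z ∈ U, g z ≠ 0) ∨ (∀ z ∈ U, g z = 0) := by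
  by_contra hcon
  push Not at hcon
  obtain ⟨⟨z0, hz0, hgz0⟩, z1, hz1, hgz1⟩ := hcon
  have hgan : AnalyticOnNhd ℂ g U := hg.analyticOnNhd hU
  have hev : ∀ᶠ z in 𝓝[≠] z0, g z ≠ 0 := by
    by_contra hnot
    have : ∃ᶠ z in 𝓝[≠] z0, g z = 0 := by
      rw [Filter.not_eventually] at hnot; exact hnot.mono fun z hz => not_not.1 hz
    exact hgz1 (hgan.eqOn_zero_of_preconnected_of_frequently_eq_zero hUc hz0 this hz1)
  obtain ⟨r, hr, hrU, hFr⟩ := hF z0 hz0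
  obtain ⟨s, hs, hsub⟩ := Metric.eventually_nhds_iff_ball.1 (eventually_nhdsWithin_iff.1 hev)
  set ρ := min r s / 2 with hρ
  have hρ0 : 0 < ρ := by positivity
  have hρr : ρ < r := by have := min_le_left r s; rw [hρ]; linarith [lt_min hr hs]
  have hρs : ρ < s := by have := min_le_right r s; rw [hρ]; linarith [lt_min hr hs]
  have hcb : Metric.closedBall z0 ρ ⊆ Metric.ball z0 r := Metric.closedBall_subset_ball hρr
  have hunif : TendstoUniformlyOn F g l (Metric.closedBall z0 ρ) :=
    (tendstoLocallyUniformlyOn_iff_tendstoUniformlyOn_of_compact (isCompact_closedBall _ _)).1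
      (hlim.mono (hcb.trans hrU))
  have hsph : Metric.sphere z0 ρ ⊆ Metric.closedBall z0 ρ := Metric.sphere_subset_closedBall
  obtain ⟨x, hx, hxmin⟩ := (isCompact_sphere z0 ρ).exists_isMinOn
    (NormedSpace.sphere_nonempty.2 hρ0.le)
    (f := fun z => ‖g z‖) ((hg.continuousOn.mono ((hsph.trans hcb).trans hrU)).norm)
  have hgx : 0 < ‖g x‖ := norm_pos_iff.2 (hsub x (by
    rw [Metric.mem_ball]; rw [Metric.mem_sphere] at hx; linarith) (by
    rintro rfl; rw [Metric.mem_sphere, dist_self] at hx; linarith))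
  obtain ⟨n, ⟨hdn, hnz⟩, hn⟩ := (hFr.and (Metric.tendstoUniformlyOn_iff.1 hunif (‖g x‖/2)
    (by positivity))).exists
  have hdc : DiffContOnCl ℂ (fun z => (F n z)⁻¹) (Metric.ball z0 ρ) := by
    apply DifferentiableOn.diffContOnCl
    rw [closure_ball _ hρ0.ne']
    exact (hdn.mono hcb).inv fun z hz => hnz z (hcb hz)
  have hb := Complex.norm_le_of_forall_mem_frontier_norm_le Metric.isBounded_ball hdc
    (C := (‖g x‖/2)⁻¹) (fun z hz => by
      rw [frontier_ball _ hρ0.ne'] at hz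
      rw [norm_inv]
      apply inv_anti₀ (by positivity)
      have h1 := hn z (hsph hz)
      have h2 : ‖g x‖ ≤ ‖g z‖ := hxmin hz
      rw [dist_eq_norm] at h1
      have h3 := norm_sub_norm_le (g z) (F n z)
      linarith) (subset_closure (Metric.mem_ball_self hρ0))
  have h1 := hn z0 (Metric.mem_closedBall_self hρ0.le)
  rw [hgz0, dist_zero_left] at h1
  rw [norm_inv] at hb
  have h2 := hnz z0 (Metric.mem_ball_self hr)
  have h3 := (inv_le_inv₀ (norm_pos_iff.2 h2) (by positivity)).1 hb
  linarith

/-- Montel along an ultrafilter. -/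
lemma montel_ultra {ι : Type*} (l : Ultrafilter ι) {F : ι → ℂ → ℂ} {U : Set ℂ}
    (hF : ∀ z ∈ U, ∃ r > 0, ∃ M : ℝ, Metric.ball z r ⊆ U ∧
      ∀ᶠ n in (l : Filter ι), DifferentiableOn ℂ (F n) (Metric.ball z r) ∧
        ∀ w ∈ Metric.ball z r, ‖F n w‖ ≤ M) :
    ∃ g : ℂ → ℂ, DifferentiableOn ℂ g U ∧ TendstoLocallyUniformlyOn F g l U := by
  have hpt : ∀ z ∈ U, ∃ x, Tendsto (fun n => F n z) l (𝓝 x) := by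
    intro z hz
    obtain ⟨r, hr, M, -, hev⟩ := hF z hz
    have hle : ((l.map (fun n => F n z) : Ultrafilter ℂ) : Filter ℂ) ≤
        𝓟 (Metric.closedBall (0:ℂ) M) := by
      rw [le_principal_iff]
      change ∀ᶠ n in (l : Filter ι), F n z ∈ Metric.closedBall (0:ℂ) M
      filter_upwards [hev] with n hn
      simpa using hn.2 z (Metric.mem_ball_self hr)
    obtain ⟨x, -, hx⟩ := (isCompact_closedBall (0:ℂ) M).ultrafilter_le_nhds _ hle
    exact ⟨x, hx⟩
  choose! g hg using hpt
  have hloc : TendstoLocallyUniformlyOn F g l U := by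
    rw [Metric.tendstoLocallyUniformlyOn_iff]
    intro ε hε z hz
    obtain ⟨r, hr, M, hrU, hev⟩ := hF z hz
    obtain ⟨n0, hn0⟩ := hev.exists
    have hM0 : 0 ≤ M := (norm_nonneg _).trans (hn0.2 z (Metric.mem_ball_self hr))
    have hlip : ∀ᶠ n in (l : Filter ι), ∀ w ∈ Metric.ball z r,
        dist (F n w) (F n z) ≤ (2 * M) / r * dist w z := by
      filter_upwards [hev] with n hn w hw
      refine Complex.dist_le_div_mul_dist_of_mapsTo_ball hn.1 ?_ hw
      intro y hy
      rw [Metric.mem_closedBall, dist_eq_norm]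
      have h1 := norm_sub_le (F n y) (F n z)
      have h2 := hn.2 y hy
      have h3 := hn.2 z (Metric.mem_ball_self hr)
      linarith
    have hglip : ∀ w ∈ Metric.ball z r, dist (g w) (g z) ≤ (2 * M) / r * dist w z := by
      intro w hw
      exact le_of_tendsto ((hg w (hrU hw)).dist (hg z hz)) (hlip.mono fun n hn => hn w hw)
    set s := min r (ε / 3 / ((2 * M) / r + 1)) with hs
    have hs0 : 0 < s := by positivity
    refine ⟨Metric.ball z s, mem_nhdsWithin_of_mem_nhds (Metric.ball_mem_nhds z hs0), ?_⟩
    filter_upwards [hlip, Metric.tendsto_nhds.1 (hg z hz) (ε/3) (by positivity)] with n h1 h2 w hw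
    have hwr : w ∈ Metric.ball z r := Metric.ball_subset_ball (min_le_left _ _) hw
    have hsm : (2 * M) / r * dist w z < ε / 3 := by
      have h3 : dist w z < ε / 3 / ((2 * M) / r + 1) := lt_of_lt_of_le hw (min_le_right _ _)
      rw [lt_div_iff₀ (by positivity)] at h3
      nlinarith [dist_nonneg (x := w) (y := z)]
    have h4 := h1 w hwr
    have h5 := hglip w hwr
    have h6 := dist_triangle (g w) (g z) (F n w)
    have h7 := dist_triangle (g z) (F n z) (F n w)
    rw [dist_comm (g z) (F n z), dist_comm (F n z) (F n w)] at h7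
    linarith
  refine ⟨g, fun z hz => ?_, hloc⟩
  obtain ⟨r, hr, M, hrU, hev⟩ := hF z hz
  have := (hloc.mono hrU).differentiableOn (hev.mono fun n hn => hn.1) Metric.isOpen_ball
  exact (this.differentiableAt (Metric.ball_mem_nhds z hr)).differentiableWithinAt

lemma exp_of_zero_free {U : ℂ → ℂ} {C : ℝ} (hU : Differentiable ℂ U) (h0 : ∀ z, U z ≠ 0)
    (hC : ∀ z, ‖U z‖ ≤ Real.exp (C * (‖z‖ + 1))) :
    ∃ a b : ℂ, ∀ z, U z = cexp (a * z + b) := by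
  have hC' : ∀ z, Real.log ‖U z‖ ≤ C * (‖z‖ + 1) := fun z => by
    rw [Real.log_le_iff_le_exp (norm_pos_iff.2 (h0 z))]; exact hC z
  have hCpos : 0 ≤ C := by
    by_contra hneg
    push Not at hneg
    have hb : ∀ z, ‖U z‖ ≤ 1 := fun z => (hC z).trans (by
      rw [Real.exp_le_one_iff]; exact mul_nonpos_of_nonpos_of_nonneg hneg.le (by positivity))
    obtain ⟨c, hc⟩ := hU.exists_const_forall_eq_of_bounded
      (isBounded_iff_forall_norm_le.2 ⟨1, by rintro _ ⟨z, rfl⟩; exact hb z⟩)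
    have hc0 : c ≠ 0 := by rw [← hc 0]; exact h0 0
    have h1 : Tendsto (fun x : ℝ => C * (‖(x:ℂ)‖ + 1)) atTop atBot := by
      have : Tendsto (fun x : ℝ => ‖(x:ℂ)‖ + 1) atTop atTop := by
        simp only [Complex.norm_real, Real.norm_eq_abs]
        exact tendsto_atTop_add_const_right _ _ tendsto_abs_atTop_atTop
      exact this.const_mul_atTop_of_neg hneg
    obtain ⟨x, hx⟩ := (h1.eventually (eventually_lt_atBot (Real.log ‖c‖))).exists
    have := hC' x
    rw [hc] at this
    linarith
  have hbound : ∀ z, ‖deriv U z / U z‖ ≤ 2 * C := by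
    intro z
    have hl : ∀ r > 0, ‖deriv U z / U z‖ ≤
        2 / r * (C * (‖z‖ + r + 1) - Real.log ‖U z‖) := by
      intro r hr
      refine (harnack_log hr hU.differentiableOn (fun w _ => h0 w) (fun w hw => ?_)).2.2
      refine (hC' w).trans ?_
      have : ‖w‖ ≤ ‖z‖ + r := by
        have h1 : ‖w - z‖ < r := by rw [← dist_eq_norm]; exact hw
        have := norm_sub_norm_le w z
        linarith
      gcongr
    have hlim : Tendsto (fun r : ℝ => 2 / r * (C * (‖z‖ + r + 1) - Real.log ‖U z‖)) atTop
        (𝓝 (0 * (2 * (C * (‖z‖ + 1) - Real.log ‖U z‖)) + 2 * C)) := by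
      refine Tendsto.congr' ?_ ((tendsto_inv_atTop_zero.mul_const
        (2 * (C * (‖z‖ + 1) - Real.log ‖U z‖))).add_const (2 * C))
      filter_upwards [eventually_gt_atTop 0] with r hr
      field_simp
      ring
    rw [zero_mul, zero_add] at hlim
    exact ge_of_tendsto hlim ((eventually_gt_atTop 0).mono hl)
  have hUd : Differentiable ℂ (deriv U) := hU.deriv
  obtain ⟨a, ha⟩ := (hUd.div hU h0).exists_const_forall_eq_of_bounded
      (isBounded_iff_forall_norm_le.2 ⟨2 * C, by rintro _ ⟨z, rfl⟩; exact hbound z⟩)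
  have hder : ∀ z, HasDerivAt (fun z => U z * cexp (-(a * z))) 0 z := by
    intro z
    have h1 := (hU z).hasDerivAt
    have h2 : HasDerivAt (fun z => -(a * z)) (-a) z := by
      simpa using ((hasDerivAt_id z).const_mul a).fun_neg
    refine (h1.fun_mul h2.cexp).congr_deriv ?_
    have : deriv U z = a * U z := by
      have := ha z
      simp only [Pi.div_apply] at this
      rw [← this]; field_simp [h0 z]
    rw [this]; ring
  refine ⟨a, Complex.log (U 0), fun z => ?_⟩
  have := is_const_of_deriv_eq_zero (fun z => (hder z).differentiableAt)
    (fun z => (hder z).deriv) z 0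
  simp only [mul_zero, neg_zero, Complex.exp_zero, mul_one] at this
  rw [Complex.exp_add, Complex.exp_log (h0 0), ← this, Complex.exp_neg]
  have := Complex.exp_ne_zero (a * z)
  field_simp

lemma exp_add_lin_zero (k : ℂ) : ∃ w : ℂ, cexp w + w + k = 0 := by
  by_contra hcon
  push Not at hcon
  have hd : ∀ z, HasDerivAt (fun w => cexp w + w + k) (cexp z + 1) z := fun z =>
    ((Complex.hasDerivAt_exp z).fun_add (hasDerivAt_id z)).add_const k
  obtain ⟨a, b, hab⟩ := exp_of_zero_free (U := fun w => cexp w + w + k) (C := 2 + ‖k‖)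
    (fun z => (hd z).differentiableAt) hcon (fun z => by
      have h1 : ‖cexp z‖ ≤ Real.exp ‖z‖ := Complex.norm_exp_le_exp_norm z
      have h2 : ‖z‖ ≤ Real.exp ‖z‖ := by linarith [Real.add_one_le_exp ‖z‖]
      have h3 : (2 + ‖k‖) ≤ Real.exp (1 + ‖k‖) := by linarith [Real.add_one_le_exp (1 + ‖k‖)]
      have h4 : (1:ℝ) ≤ Real.exp ‖z‖ := Real.one_le_exp (norm_nonneg _)
      calc ‖cexp z + z + k‖ ≤ ‖cexp z‖ + ‖z‖ + ‖k‖ := norm_add₃_le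
        _ ≤ Real.exp ‖z‖ + Real.exp ‖z‖ + Real.exp ‖z‖ * ‖k‖ := by
            gcongr; nlinarith [norm_nonneg k]
        _ = Real.exp ‖z‖ * (2 + ‖k‖) := by ring
        _ ≤ Real.exp ‖z‖ * Real.exp (1 + ‖k‖) := by gcongr
        _ = Real.exp (‖z‖ + (1 + ‖k‖)) := by rw [← Real.exp_add]
        _ ≤ _ := by
            apply Real.exp_le_exp.2
            nlinarith [norm_nonneg k, norm_nonneg z, mul_nonneg (norm_nonneg k) (norm_nonneg z)])
  have hd2 : ∀ z, cexp z + 1 = a * (cexp z + z + k) := by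
    intro z
    have h1 : HasDerivAt (fun w => cexp (a * w + b)) (cexp (a * z + b) * a) z := by
      have : HasDerivAt (fun w => a * w + b) a z := by
        simpa using ((hasDerivAt_id z).const_mul a).add_const b
      exact this.cexp
    have h2 : (fun w => cexp w + w + k) = fun w => cexp (a * w + b) := funext hab
    have h3 := hd z
    rw [h2] at h3
    rw [h3.unique h1, ← hab z, mul_comm]
  have h1 := hd2 (Real.pi * I)
  rw [Complex.exp_pi_mul_I] at h1
  have ha : a = 0 := by
    have h2 := hcon (Real.pi * I)
    rw [Complex.exp_pi_mul_I] at h2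
    have : a * (-1 + Real.pi * I + k) = 0 := by rw [← h1]; ring
    exact (mul_eq_zero.1 this).resolve_right h2
  have h2 := hd2 0
  rw [ha] at h2
  norm_num at h2

/-- The basic class of functions. -/
structure WCls (v v1 : ℂ → ℂ) (S : Set ℂ) : Prop where
  dv : DifferentiableOn ℂ v S
  dv1 : DifferentiableOn ℂ v1 S
  h1 : ∀ z ∈ S, deriv v z ≠ 1
  rel : ∀ z ∈ S, v1 z * (1 - deriv v z) = v z
  h2 : ∀ z ∈ S, deriv v1 z ≠ 1
  h0 : ∀ z ∈ S, v z = 0 → ‖deriv v z‖ ≤ 1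

/-- affine rescaling -/
noncomputable def rsc (c a : ℂ) (v : ℂ → ℂ) : ℂ → ℂ := fun ζ => v (c + a * ζ) / a

lemma deriv_rsc {c a : ℂ} (ha : a ≠ 0) (v : ℂ → ℂ) (ζ : ℂ) :
    deriv (rsc c a v) ζ = deriv v (c + a * ζ) := by
  unfold rsc
  rw [deriv_div_const]
  have : deriv (fun ζ => v (c + a * ζ)) ζ = a • deriv (fun x => v (c + x)) (a * ζ) :=
    deriv_comp_mul_left a (fun x => v (c + x)) ζ
  rw [this, deriv_comp_const_add, smul_eq_mul]
  field_simp

lemma diffOn_rsc {c a : ℂ} {v : ℂ → ℂ} {S T : Set ℂ} (hv : DifferentiableOn ℂ v S)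
    (hT : ∀ ζ ∈ T, c + a * ζ ∈ S) : DifferentiableOn ℂ (rsc c a v) T := by
  unfold rsc
  apply DifferentiableOn.div_const
  exact hv.comp (by fun_prop) hT

lemma WCls.rsc {c a : ℂ} (ha : a ≠ 0) {v v1 : ℂ → ℂ} {S T : Set ℂ} (h : WCls v v1 S)
    (hT : ∀ ζ ∈ T, c + a * ζ ∈ S) : WCls (rsc c a v) (rsc c a v1) T where
  dv := diffOn_rsc h.dv hT
  dv1 := diffOn_rsc h.dv1 hT
  h1 := fun ζ hζ => by rw [deriv_rsc ha]; exact h.h1 _ (hT ζ hζ)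
  h2 := fun ζ hζ => by rw [deriv_rsc ha]; exact h.h2 _ (hT ζ hζ)
  rel := fun ζ hζ => by
    rw [deriv_rsc ha]; simp only [_root_.rsc]; rw [← h.rel _ (hT ζ hζ)]; ring
  h0 := fun ζ hζ hz => by
    rw [deriv_rsc ha]
    apply h.h0 _ (hT ζ hζ)
    simpa [_root_.rsc, ha] using hz

lemma WCls.mono {v v1 : ℂ → ℂ} {S T : Set ℂ} (h : WCls v v1 S) (hT : T ⊆ S) : WCls v v1 T where
  dv := h.dv.mono hT
  dv1 := h.dv1.mono hT
  h1 := fun ζ hζ => h.h1 _ (hT hζ)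
  h2 := fun ζ hζ => h.h2 _ (hT hζ)
  rel := fun ζ hζ => h.rel _ (hT hζ)
  h0 := fun ζ hζ hz => h.h0 _ (hT hζ) hz

/-- Locally uniform convergence of derivatives, local hypotheses. -/
lemma tlu_deriv {ι : Type*} {l : Filter ι} [l.NeBot] {F : ι → ℂ → ℂ} {g : ℂ → ℂ} {U : Set ℂ}
    (hlim : TendstoLocallyUniformlyOn F g l U)
    (hF : ∀ z ∈ U, ∃ r > 0, Metric.ball z r ⊆ U ∧
      ∀ᶠ n in l, DifferentiableOn ℂ (F n) (Metric.ball z r)) :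
    TendstoLocallyUniformlyOn (fun n => deriv (F n)) (deriv g) l U := by
  rw [Metric.tendstoLocallyUniformlyOn_iff]
  intro ε hε z hz
  obtain ⟨r, hr, hrU, hev⟩ := hF z hz
  have h1 := (hlim.mono hrU).deriv hev Metric.isOpen_ball
  obtain ⟨t, ht, h2⟩ := Metric.tendstoLocallyUniformlyOn_iff.1 h1 ε hε z (Metric.mem_ball_self hr)
  rw [Metric.isOpen_ball.nhdsWithin_eq (Metric.mem_ball_self hr)] at ht
  exact ⟨t, mem_nhdsWithin_of_mem_nhds ht, h2⟩

lemma star_step1 (τ : ℝ) (hτ : 0 < τ) : ∃ C : ℝ, ∀ v : ℂ → ℂ,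
    DifferentiableOn ℂ v (Metric.ball 0 1) → ‖v 0‖ ≤ 1 →
    (∀ z : ℂ, ‖z‖ ≤ 1/2 → ‖v z‖ ≤ τ * (1/2 - ‖z‖) → ‖deriv v z‖ < 5) → ‖deriv v 0‖ ≤ C := by
  set δ := τ / 8 with hδ
  have hδ0 : 0 < δ := by positivity
  refine ⟨max (32 * (δ * Real.exp (2 * (5 / δ) * (1/8)))) (32 * |Real.log δ|), ?_⟩
  intro v hv hv0 hE
  have hsub : Metric.ball (0:ℂ) (1/4) ⊆ Metric.ball 0 1 := Metric.ball_subset_ball (by norm_num)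
  by_cases hex : ∃ ζ1 ∈ Metric.ball (0:ℂ) (1/16), ‖v ζ1‖ ≤ δ
  · obtain ⟨ζ1, hζ1, hvζ⟩ := hex
    refine le_max_of_le_left ?_
    have hb : ∀ z ∈ Metric.ball (0:ℂ) (1/16), ‖v z‖ ≤ δ * Real.exp (2 * (5 / δ) * (1/8)) := by
      intro z hz
      have h1 := hopf_bound (V := v) (R := 1/4) (δ := δ) (G := 5) (z0 := z) (ζ1 := ζ1) hδ0
        (hv.mono hsub) (fun w hw hwδ => by
          rw [mem_ball_zero_iff] at hw
          refine (hE w (by linarith) ?_).le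
          rw [hwδ, hδ]; nlinarith) (by norm_num)
          (by convert hζ1 using 1; norm_num) hvζ (by convert hz using 1; norm_num)
      by_cases hvz : v z = 0
      · rw [hvz, norm_zero]; positivity
      have hpos : 0 < ‖v z‖ / δ := by positivity
      have hd : dist ζ1 z ≤ 1/8 := by
        rw [Metric.mem_ball] at hz hζ1
        have := dist_triangle_right ζ1 z 0
        linarith
      have h2 : Real.log (‖v z‖ / δ) ≤ 2 * (5 / δ) * (1/8) := h1.trans (by gcongr)
      rw [Real.log_le_iff_le_exp hpos, div_le_iff₀ hδ0] at h2
      linarith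
    have h3 := Complex.norm_deriv_le_of_forall_mem_sphere_norm_le (c := (0:ℂ)) (R := 1/32)
      (f := v) (C := δ * Real.exp (2 * (5 / δ) * (1/8))) (by norm_num) ?_ ?_
    · refine h3.trans (le_of_eq ?_); ring
    · apply DifferentiableOn.diffContOnCl
      rw [closure_ball _ (by norm_num)]
      exact hv.mono (Metric.closedBall_subset_ball (by norm_num))
    · intro z hz
      apply hb
      rw [Metric.mem_sphere] at hz
      rw [Metric.mem_ball, hz]; norm_num
  · push Not at hex
    refine le_max_of_le_right ?_
    have hne : ∀ z ∈ Metric.ball (0:ℂ) (1/16), v z ≠ 0 := fun z hz h => by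
      have := hex z hz; rw [h, norm_zero] at this; linarith
    have hd : DifferentiableOn ℂ v (Metric.ball 0 (1/16)) :=
      hv.mono (Metric.ball_subset_ball (by norm_num))
    have h1 := (harnack_log (F := fun z => (v z)⁻¹) (c := 0) (r := 1/16) (M := -Real.log δ)
      (by norm_num) (hd.inv hne) (fun z hz => inv_ne_zero (hne z hz)) (fun z hz => by
        rw [norm_inv, Real.log_inv]
        have := Real.log_le_log hδ0 (hex z hz).le
        linarith)).2.2
    have h0m : (0:ℂ) ∈ Metric.ball (0:ℂ) (1/16) := Metric.mem_ball_self (by norm_num)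
    have hdv : HasDerivAt v (deriv v 0) 0 :=
      (hd.differentiableAt (Metric.isOpen_ball.mem_nhds h0m)).hasDerivAt
    rw [(hdv.fun_inv (hne 0 h0m)).deriv] at h1
    have e : ‖-deriv v 0 / v 0 ^ 2 / (v 0)⁻¹‖ = ‖deriv v 0‖ / ‖v 0‖ := by
      have := norm_ne_zero_iff.2 (hne 0 h0m)
      rw [norm_div, norm_div, norm_inv, norm_neg, norm_pow]; field_simp
    rw [e, div_le_iff₀ (norm_pos_iff.2 (hne 0 h0m)), norm_inv, Real.log_inv] at h1
    have hl : Real.log ‖v 0‖ ≤ 0 := Real.log_nonpos (norm_nonneg _) hv0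
    have hn : 0 ≤ ‖v 0‖ := norm_nonneg _
    have h2 : -Real.log δ - -Real.log ‖v 0‖ ≤ |Real.log δ| := by
      linarith [neg_le_abs (Real.log δ)]
    calc _ ≤ _ := h1
      _ ≤ 2 / (1/16) * |Real.log δ| * ‖v 0‖ := by gcongr
      _ ≤ 2 / (1/16) * |Real.log δ| * 1 := by gcongr
      _ = _ := by ring

lemma star_zalcman
    (hneg : ∀ C : ℝ, ∃ v v1 : ℂ → ℂ, WCls v v1 (Metric.ball 0 1) ∧ ‖v 0‖ ≤ 1 ∧ C < ‖deriv v 0‖)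
    (n : ℕ) : ∃ V V1 : ℂ → ℂ, WCls V V1 (Metric.ball 0 (n+1)) ∧ ‖V 0‖ ≤ 1 ∧ 5 ≤ ‖deriv V 0‖ ∧
      ∀ ζ ∈ Metric.ball (0:ℂ) (n+1), ‖V ζ‖ < 1/2 → ‖deriv V ζ‖ < 5 := by
  have hn0 : (0:ℝ) < n + 1 := by positivity
  set τ : ℝ := 1 / (2 * (n + 1)) with hτ
  have hτ0 : 0 < τ := by positivity
  obtain ⟨C, hC⟩ := star_step1 τ hτ0
  obtain ⟨v, v1, hW, hv0, hvC⟩ := hneg C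
  have hex : ∃ z : ℂ, ‖z‖ ≤ 1/2 ∧ ‖v z‖ ≤ τ * (1/2 - ‖z‖) ∧ 5 ≤ ‖deriv v z‖ := by
    by_contra hcon
    push Not at hcon
    exact absurd (hC v hW.dv hv0 hcon) (not_le.2 hvC)
  have hsub : Metric.closedBall (0:ℂ) (1/2) ⊆ Metric.ball 0 1 :=
    Metric.closedBall_subset_ball (by norm_num)
  have hdv : DifferentiableOn ℂ (deriv v) (Metric.ball 0 1) := hW.dv.deriv Metric.isOpen_ball
  set Z : Set ℂ := (Metric.closedBall (0:ℂ) (1/2) ∩ (fun z => ‖v z‖ - τ * (1/2 - ‖z‖)) ⁻¹' Set.Iic 0)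
    ∩ (Metric.closedBall (0:ℂ) (1/2) ∩ (fun z => ‖deriv v z‖) ⁻¹' Set.Ici 5) with hZ
  have hZc : IsCompact Z := by
    apply (isCompact_closedBall (0:ℂ) (1/2)).of_isClosed_subset _
      (Set.inter_subset_left.trans Set.inter_subset_left)
    apply IsClosed.inter
    · apply ContinuousOn.preimage_isClosed_of_isClosed _ Metric.isClosed_closedBall isClosed_Iic
      exact ((hW.dv.continuousOn.mono hsub).norm).sub (by fun_prop)
    · exact ((hdv.continuousOn.mono hsub).norm).preimage_isClosed_of_isClosed
        Metric.isClosed_closedBall isClosed_Ici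
  have hmemZ : ∀ z, z ∈ Z ↔ ‖z‖ ≤ 1/2 ∧ ‖v z‖ ≤ τ * (1/2 - ‖z‖) ∧ 5 ≤ ‖deriv v z‖ := by
    intro z; simp [hZ]; tauto
  have hpos : ∀ z, ‖z‖ ≤ 1/2 → 5 ≤ ‖deriv v z‖ → 0 < ‖v z‖ := by
    intro z hz h5
    rw [norm_pos_iff]
    intro h
    have := hW.h0 z (hsub (by simpa using hz)) h
    linarith
  have hlt : ∀ z ∈ Z, ‖z‖ < 1/2 := by
    intro z hz
    obtain ⟨h1, h2, h3⟩ := (hmemZ z).1 hz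
    have := hpos z h1 h3
    by_contra hge
    push Not at hge
    have : τ * (1/2 - ‖z‖) ≤ 0 := mul_nonpos_of_nonneg_of_nonpos hτ0.le (by linarith)
    linarith
  obtain ⟨zs, hzs, hmin⟩ := hZc.exists_isMinOn (by
      obtain ⟨z, hz⟩ := hex; exact ⟨z, (hmemZ z).2 hz⟩)
    (f := fun z => ‖v z‖ / (1/2 - ‖z‖)) (by
      apply ContinuousOn.div
      · exact (hW.dv.continuousOn.mono ((Set.inter_subset_left.trans Set.inter_subset_left).trans hsub)).norm
      · fun_prop
      · intro z hz; have := hlt z hz; linarith)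
  obtain ⟨h1, h2, h3⟩ := (hmemZ zs).1 hzs
  have hzlt := hlt zs hzs
  have hgap : 0 < 1/2 - ‖zs‖ := by linarith
  set ρ := ‖v zs‖ with hρ
  have hρ0 : 0 < ρ := hpos zs h1 h3
  set t := ρ / (1/2 - ‖zs‖) with ht
  have ht0 : 0 < t := by positivity
  have htτ : t ≤ τ := by rw [ht, div_le_iff₀ hgap]; exact h2
  have hρt : ρ = t * (1/2 - ‖zs‖) := by rw [ht, div_mul_cancel₀ _ hgap.ne']
  have htn : t * (n + 1) ≤ 1/2 := by
    calc t * (n+1) ≤ τ * (n+1) := by gcongr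
      _ = 1/2 := by rw [hτ]; field_simp
  have hρc : ((ρ:ℝ):ℂ) ≠ 0 := by exact_mod_cast hρ0.ne'
  have hz : ∀ ζ ∈ Metric.ball (0:ℂ) (n+1), (1/2 - ‖zs‖) / 2 < 1/2 - ‖zs + (ρ:ℂ) * ζ‖ := by
    intro ζ hζ
    rw [mem_ball_zero_iff] at hζ
    have h4 : ‖zs + (ρ:ℂ) * ζ‖ ≤ ‖zs‖ + ρ * ‖ζ‖ := by
      refine (norm_add_le _ _).trans ?_
      rw [norm_mul, Complex.norm_real, Real.norm_eq_abs, abs_of_pos hρ0]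
    have h5 : ρ * ‖ζ‖ < (1/2 - ‖zs‖) / 2 := by
      rw [hρt]
      have : t * ‖ζ‖ < 1/2 := by
        calc t * ‖ζ‖ < t * (n+1) := by gcongr
          _ ≤ _ := htn
      nlinarith
    linarith
  refine ⟨rsc zs ρ v, rsc zs ρ v1, hW.rsc hρc ?_, ?_, ?_, ?_⟩
  · intro ζ hζ
    have := hz ζ hζ
    rw [mem_ball_zero_iff]; linarith
  · simp [rsc, ← hρ, abs_of_pos hρ0, hρ0.ne']
  · rw [deriv_rsc hρc]; simpa using h3
  · intro ζ hζ hV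
    rw [deriv_rsc hρc]
    have hzz := hz ζ hζ
    set z := zs + (ρ:ℂ) * ζ with hzdef
    simp only [rsc, norm_div, Complex.norm_real, Real.norm_eq_abs, abs_of_pos hρ0] at hV
    rw [← hzdef, div_lt_iff₀ hρ0] at hV
    by_contra h5
    push Not at h5
    have hgz : 0 < 1/2 - ‖z‖ := by linarith
    have hvt : ‖v z‖ < t * (1/2 - ‖z‖) := by
      rw [hρt] at hV
      nlinarith
    have hzZ : z ∈ Z := (hmemZ z).2 ⟨by linarith, hvt.le.trans (by gcongr), h5⟩
    have hm : t ≤ ‖v z‖ / (1/2 - ‖z‖) := hmin hzZ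
    rw [le_div_iff₀ hgz] at hm
    linarith

lemma zalcman_growth {V V1 : ℂ → ℂ} {n : ℕ} (hn : 4 ≤ n) (hW : WCls V V1 (Metric.ball 0 (n+1)))
    (hV0 : ‖V 0‖ ≤ 1) (hV5 : 5 ≤ ‖deriv V 0‖)
    (hV : ∀ ζ ∈ Metric.ball (0:ℂ) (n+1), ‖V ζ‖ < 1/2 → ‖deriv V ζ‖ < 5) :
    ∀ z ∈ Metric.ball (0:ℂ) ((n+1)/4), ‖V z‖ ≤ Real.exp (40 * (‖z‖ + 1)) := by
  have hn' : (4:ℝ) ≤ n := by exact_mod_cast hn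
  have hsub : Metric.ball (0:ℂ) 1 ⊆ Metric.ball 0 (n+1) := Metric.ball_subset_ball (by linarith)
  have hex : ∃ ζ1 ∈ Metric.ball (0:ℂ) 1, ‖V ζ1‖ ≤ 1/4 := by
    by_contra hex
    push Not at hex
    have hne : ∀ z ∈ Metric.ball (0:ℂ) 1, V z ≠ 0 := fun z hz h => by
      have := hex z hz; rw [h, norm_zero] at this; norm_num at this
    have hd := hW.dv.mono hsub
    have h1 := (harnack_log (F := fun z => (V z)⁻¹) (c := 0) (r := 1) (M := Real.log 4)
      (by norm_num) (hd.inv hne) (fun z hz => inv_ne_zero (hne z hz)) (fun z hz => by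
        have := hex z hz
        apply Real.log_le_log (norm_pos_iff.2 (inv_ne_zero (hne z hz)))
        rw [norm_inv, inv_le_comm₀ (norm_pos_iff.2 (hne z hz)) (by norm_num)]
        linarith)).2.2
    have h0m : (0:ℂ) ∈ Metric.ball (0:ℂ) 1 := Metric.mem_ball_self (by norm_num)
    have hdv : HasDerivAt V (deriv V 0) 0 :=
      (hd.differentiableAt (Metric.isOpen_ball.mem_nhds h0m)).hasDerivAt
    rw [(hdv.fun_inv (hne 0 h0m)).deriv] at h1
    have e : ‖-deriv V 0 / V 0 ^ 2 / (V 0)⁻¹‖ = ‖deriv V 0‖ / ‖V 0‖ := by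
      have := norm_ne_zero_iff.2 (hne 0 h0m)
      rw [norm_div, norm_div, norm_inv, norm_neg, norm_pow]; field_simp
    rw [e, div_le_iff₀ (norm_pos_iff.2 (hne 0 h0m)), norm_inv, Real.log_inv] at h1
    have hl : Real.log ‖V 0‖ ≤ 0 := Real.log_nonpos (norm_nonneg _) hV0
    have hn : 0 ≤ ‖V 0‖ := norm_nonneg _
    have hl4 : Real.log 4 < 2 := by
      have : Real.log 4 = 2 * Real.log 2 := by
        rw [show (4:ℝ) = 2 ^ 2 by norm_num, Real.log_pow]; norm_num
      have := Real.log_two_lt_d9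
      linarith
    nlinarith
  obtain ⟨ζ1, hζ1, hVζ⟩ := hex
  intro z hz
  by_cases hvz : V z = 0
  · rw [hvz, norm_zero]; positivity
  have h1 := hopf_bound (V := V) (R := n+1) (δ := 1/4) (G := 5) (z0 := z) (ζ1 := ζ1) (by norm_num)
        hW.dv (fun w hw hwδ => (hV w hw (by rw [hwδ]; norm_num)).le) (by norm_num)
        (Metric.ball_subset_ball (by linarith) hζ1) hVζ hz
  rw [Real.log_le_iff_le_exp (by positivity), div_le_iff₀ (by norm_num)] at h1
  have hd : dist ζ1 z ≤ ‖z‖ + 1 := by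
    rw [mem_ball_zero_iff] at hζ1
    rw [dist_eq_norm]
    have := norm_sub_le ζ1 z
    linarith
  have h2 : Real.exp (2 * (5 / (1/4)) * dist ζ1 z) ≤ Real.exp (40 * (‖z‖ + 1)) := by
    apply Real.exp_le_exp.2; norm_num; linarith
  have : 0 ≤ Real.exp (2 * (5 / (1/4)) * dist ζ1 z) := by positivity
  linarith

lemma star_contra (V V1 : ℕ → ℂ → ℂ) (hW : ∀ n : ℕ, WCls (V n) (V1 n) (Metric.ball 0 (n+1)))
    (hV0 : ∀ n, ‖V n 0‖ ≤ 1) (hV5 : ∀ n, 5 ≤ ‖deriv (V n) 0‖)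
    (hV : ∀ n : ℕ, ∀ ζ ∈ Metric.ball (0:ℂ) ((n:ℝ)+1), ‖V n ζ‖ < 1/2 → ‖deriv (V n) ζ‖ < 5) : False := by
  set l : Ultrafilter ℕ := hyperfilter ℕ with hl
  have hl_at : (l : Filter ℕ) ≤ atTop := by rw [hl]; exact Nat.hyperfilter_le_atTop
  have hcl : ∀ z : ℂ, ∀ᶠ n : ℕ in (l : Filter ℕ), Metric.ball z 1 ⊆ Metric.ball (0:ℂ) ((n+1)/4) ∧ 4 ≤ n := by
    intro z
    apply hl_at
    have h1 : ∀ᶠ n : ℕ in atTop, 4 * (‖z‖ + 1) ≤ (n:ℝ) :=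
      tendsto_natCast_atTop_atTop.eventually (eventually_ge_atTop _)
    filter_upwards [h1, eventually_ge_atTop 4] with n hn h4
    refine ⟨fun w hw => ?_, h4⟩
    rw [mem_ball_zero_iff]
    have h2 : ‖w - z‖ < 1 := by rw [← dist_eq_norm]; exact hw
    have := norm_sub_norm_le w z
    linarith
  have hbig : ∀ n : ℕ, Metric.ball (0:ℂ) ((n+1)/4) ⊆ Metric.ball (0:ℂ) (n+1) := fun n =>
    Metric.ball_subset_ball (by have : (0:ℝ) ≤ n := by positivity
                                linarith)
  have hWloc : ∀ z : ℂ, ∀ᶠ n : ℕ in (l : Filter ℕ), WCls (V n) (V1 n) (Metric.ball z 1) := fun z =>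
    (hcl z).mono fun n hn => (hW n).mono (hn.1.trans (hbig n))
  have hgrow : ∀ z : ℂ, ∀ᶠ n : ℕ in (l : Filter ℕ), ∀ w ∈ Metric.ball z 1, ‖V n w‖ ≤ Real.exp (40 * (‖w‖ + 1)) :=
    fun z => (hcl z).mono fun n hn w hw =>
      zalcman_growth hn.2 (hW n) (hV0 n) (hV5 n) (hV n) w (hn.1 hw)
  obtain ⟨W, hWd, hlim⟩ := montel_ultra l (F := V) (U := Set.univ) (fun z _ =>
    ⟨1, one_pos, Real.exp (40 * (‖z‖ + 1 + 1)), Set.subset_univ _, by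
      filter_upwards [hWloc z, hgrow z] with n h1 h2
      refine ⟨h1.dv, fun w hw => (h2 w hw).trans ?_⟩
      apply Real.exp_le_exp.2
      have h3 : ‖w - z‖ < 1 := by rw [← dist_eq_norm]; exact hw
      have := norm_sub_norm_le w z
      linarith⟩)
  have hWD : Differentiable ℂ W := fun z => hWd.differentiableAt univ_mem
  have hlim' := tlu_deriv hlim (fun z _ => ⟨1, one_pos, Set.subset_univ _,
    (hWloc z).mono fun n h => h.dv⟩)
  have hWb : ∀ z, ‖W z‖ ≤ Real.exp (40 * (‖z‖ + 1)) := fun z =>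
    le_of_tendsto (hlim.tendsto_at (Set.mem_univ z)).norm
      ((hgrow z).mono fun n hn => hn z (Metric.mem_ball_self one_pos))
  have hW5 : 5 ≤ ‖deriv W 0‖ :=
    ge_of_tendsto (hlim'.tendsto_at (Set.mem_univ 0)).norm (Eventually.of_forall hV5)
  have hWdD : Differentiable ℂ (deriv W) := hWD.deriv
  have hone : TendstoLocallyUniformlyOn (fun (_:ℕ) (_:ℂ) => (1:ℂ)) (fun _ => 1) l Set.univ := by
    rw [Metric.tendstoLocallyUniformlyOn_iff]
    intro ε hε z _
    exact ⟨Set.univ, univ_mem, Eventually.of_forall fun n y _ => by simpa using hε⟩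
  have hlimU : TendstoLocallyUniformlyOn (fun n z => 1 - deriv (V n) z) (fun z => 1 - deriv W z) l
      Set.univ := hone.sub hlim'
  have hUne : ∀ z, 1 - deriv W z ≠ 0 := by
    have := hurwitz_zero isOpen_univ isPreconnected_univ hlimU (fun z _ => ⟨1, one_pos,
      Set.subset_univ _, (hWloc z).mono fun n h => ⟨(h.dv.deriv Metric.isOpen_ball).const_sub 1,
        fun w hw h1 => h.h1 w hw (sub_eq_zero.1 h1).symm⟩⟩)
      ((hWdD.const_sub 1).differentiableOn)
    rcases this with h | h
    · exact fun z => h z (Set.mem_univ z)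
    · exfalso
      have := h 0 (Set.mem_univ 0)
      rw [← sub_eq_zero.1 this, norm_one] at hW5
      norm_num at hW5
  obtain ⟨a, b, hab⟩ := exp_of_zero_free (U := fun z => 1 - deriv W z) (C := 81)
    (hWdD.const_sub 1) hUne (fun z => by
      have h1 : ‖deriv W z‖ ≤ Real.exp (40 * (‖z‖ + 2)) := by
        have := Complex.norm_deriv_le_of_forall_mem_sphere_norm_le (c := z) (R := 1) (f := W)
          (C := Real.exp (40 * (‖z‖ + 2))) one_pos hWD.diffContOnCl (fun w hw => by
            refine (hWb w).trans (Real.exp_le_exp.2 ?_)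
            rw [Metric.mem_sphere, dist_eq_norm] at hw
            have := norm_sub_norm_le w z
            linarith)
        simpa using this
      have h2 : (1:ℝ) ≤ Real.exp (40 * (‖z‖ + 2)) := Real.one_le_exp (by positivity)
      have h3 : (2:ℝ) ≤ Real.exp 1 := by linarith [Real.add_one_le_exp (1:ℝ)]
      calc ‖1 - deriv W z‖ ≤ ‖(1:ℂ)‖ + ‖deriv W z‖ := norm_sub_le _ _
        _ ≤ Real.exp (40 * (‖z‖ + 2)) * Real.exp 1 := by rw [norm_one]; nlinarith
        _ = Real.exp (40 * (‖z‖ + 2) + 1) := by rw [Real.exp_add]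
        _ ≤ _ := by apply Real.exp_le_exp.2; linarith [norm_nonneg z])
  have hWder : ∀ z, deriv W z = 1 - cexp (a * z + b) := fun z => by rw [← hab z]; ring
  by_cases ha : a = 0
  · -- linear case
    set s := 1 - cexp b with hs
    have hWs : ∀ z, deriv W z = s := fun z => by rw [hWder z, ha, zero_mul, zero_add]
    have hs5 : 5 ≤ ‖s‖ := by rw [← hWs 0]; exact hW5
    have hs0 : s ≠ 0 := fun h => by rw [h, norm_zero] at hs5; norm_num at hs5
    have hlin : ∀ z, W z = s * z + W 0 := by
      intro z
      have hd : ∀ z, HasDerivAt (fun z => W z - s * z) 0 z := fun z => by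
        have h1 := (hWD z).hasDerivAt
        rw [hWs z] at h1
        refine (h1.fun_sub ((hasDerivAt_id z).const_mul s)).congr_deriv (by simp)
      have := is_const_of_deriv_eq_zero (fun z => (hd z).differentiableAt)
        (fun z => (hd z).deriv) z 0
      simp only [mul_zero, sub_zero] at this
      rw [← this]; ring
    set ζ0 := -W 0 / s with hζ0
    have hWζ : W ζ0 = 0 := by rw [hlin, hζ0]; field_simp; ring
    obtain ⟨t, ht, hev⟩ := Metric.tendstoLocallyUniformlyOn_iff.1 hlim' 1 one_pos ζ0 (Set.mem_univ _)
    rw [nhdsWithin_univ] at ht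
    obtain ⟨r, hr, hrt⟩ := Metric.mem_nhds_iff.1 ht
    set r' := min r 1 with hr'
    have hr'0 : 0 < r' := lt_min hr one_pos
    have hz := hurwitz_zero (U := Metric.ball ζ0 r') Metric.isOpen_ball
      (convex_ball _ _).isPreconnected (hlim.mono (Set.subset_univ _)) (fun z hz => by
        obtain ⟨s', hs'0, hs'⟩ := Metric.isOpen_iff.1 Metric.isOpen_ball z hz
        refine ⟨s', hs'0, hs', ?_⟩
        filter_upwards [hev, hWloc ζ0] with n h1 h2
        refine ⟨h2.dv.mono (hs'.trans (Metric.ball_subset_ball (min_le_right _ _))),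
          fun w hw hw0 => ?_⟩
        have hwb := hs' hw
        have h3 := h2.h0 w (Metric.ball_subset_ball (min_le_right _ _) hwb) hw0
        have h4 := h1 w (hrt (Metric.ball_subset_ball (min_le_left _ _) hwb))
        rw [hWs w, dist_eq_norm] at h4
        have := norm_sub_norm_le s (deriv (V n) w)
        linarith) hWD.differentiableOn
    rcases hz with h | h
    · exact h ζ0 (Metric.mem_ball_self hr'0) hWζ
    · have h1 := h (ζ0 + (r'/2 : ℝ)) (by
        rw [Metric.mem_ball, dist_eq_norm, add_sub_cancel_left, Complex.norm_real, Real.norm_eq_abs,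
          abs_of_pos (by positivity)]; linarith)
      rw [hlin, mul_add, add_right_comm, ← hlin, hWζ, zero_add, mul_eq_zero] at h1
      rcases h1 with h1 | h1
      · exact hs0 h1
      · have : r'/2 = 0 := by exact_mod_cast h1
        linarith
  · -- exponential case
    obtain ⟨c, hc⟩ : ∃ c, ∀ z, W z = z - cexp (a * z + b) / a + c := by
      refine ⟨W 0 + cexp b / a, fun z => ?_⟩
      have hd : ∀ z, HasDerivAt (fun z => W z - (z - cexp (a * z + b) / a)) 0 z := fun z => by
        have h1 := (hWD z).hasDerivAt
        rw [hWder z] at h1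
        have h2 : HasDerivAt (fun w => a * w + b) a z := by
          simpa using ((hasDerivAt_id z).const_mul a).add_const b
        refine (h1.fun_sub ((hasDerivAt_id z).fun_sub (h2.cexp.div_const a))).congr_deriv ?_
        field_simp; ring
      have := is_const_of_deriv_eq_zero (fun z => (hd z).differentiableAt)
        (fun z => (hd z).deriv) z 0
      simp only [mul_zero, zero_add, zero_sub, sub_neg_eq_add] at this
      rw [← this]; ring
    have hq := hlim.div₀ hlimU hWD.continuous.continuousOn
      (hWdD.const_sub 1).continuous.continuousOn (fun z _ => hUne z)
    have hq1 : TendstoLocallyUniformlyOn V1 (fun z => (z + c) * cexp (-(a * z + b)) - 1 / a) l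
        Set.univ := by
      rw [Metric.tendstoLocallyUniformlyOn_iff] at hq ⊢
      intro ε hε z hz
      obtain ⟨t, ht, hev⟩ := hq ε hε z hz
      rw [nhdsWithin_univ] at ht
      refine ⟨t ∩ Metric.ball z 1, mem_nhdsWithin_of_mem_nhds
        (inter_mem ht (Metric.ball_mem_nhds z one_pos)), ?_⟩
      filter_upwards [hev, hWloc z] with n h1 h2 y hy
      have h3 := h1 y hy.1
      simp only [Pi.div_apply] at h3
      convert h3 using 2
      · rw [hab, hc, Complex.exp_neg]
        have := Complex.exp_ne_zero (a * y + b)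
        field_simp
        ring
      · rw [eq_div_iff (fun h => h2.h1 y hy.2 (sub_eq_zero.1 h).symm)]
        exact h2.rel y hy.2
    have hq1' := tlu_deriv hq1 (fun z _ => ⟨1, one_pos, Set.subset_univ _,
      (hWloc z).mono fun n h => h.dv1⟩)
    have hq2 : TendstoLocallyUniformlyOn (fun n z => 1 - deriv (V1 n) z)
      (fun z => 1 - deriv (fun z => (z + c) * cexp (-(a * z + b)) - 1 / a) z) l Set.univ :=
      hone.sub hq1'
    have hdd : ∀ z, HasDerivAt (fun z => (z + c) * cexp (-(a * z + b)) - 1 / a)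
        (cexp (-(a * z + b)) * (1 - a * (z + c))) z := fun z => by
      have h2 : HasDerivAt (fun w => -(a * w + b)) (-a) z := by
        simpa using (((hasDerivAt_id z).const_mul a).add_const b).fun_neg
      refine ((((hasDerivAt_id z).add_const c).fun_mul h2.cexp).sub_const (1/a)).congr_deriv ?_
      simp only [id]; ring
    have hfun : (fun z => 1 - deriv (fun z => (z + c) * cexp (-(a * z + b)) - 1 / a) z) =
        fun z => 1 - (cexp (-(a * z + b)) * (1 - a * (z + c))) := by
      ext z; rw [(hdd z).deriv]
    rw [hfun] at hq2
    have hz := hurwitz_zero isOpen_univ isPreconnected_univ hq2 (fun z _ => ⟨1, one_pos,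
      Set.subset_univ _, (hWloc z).mono fun n h => ⟨(h.dv1.deriv Metric.isOpen_ball).const_sub 1,
        fun w hw h1 => h.h2 w hw (sub_eq_zero.1 h1).symm⟩⟩)
      (Differentiable.differentiableOn (by fun_prop))
    have hiff : ∀ w : ℂ, 1 - (cexp (-(a * ((w - b)/a) + b)) * (1 - a * ((w - b)/a + c))) = 0 ↔
        cexp w + w + (a * c - 1 - b) = 0 := by
      intro w
      have e : a * ((w - b)/a) + b = w := by field_simp; ring
      have e2 : a * ((w - b)/a + c) = w - b + a * c := by field_simp
      rw [e, e2, Complex.exp_neg]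
      have := Complex.exp_ne_zero w
      constructor
      · intro h; field_simp at h; linear_combination h
      · intro h; field_simp; linear_combination h
    rcases hz with h | h
    · obtain ⟨w, hw⟩ := exp_add_lin_zero (a * c - 1 - b)
      exact h _ (Set.mem_univ _) ((hiff w).2 hw)
    · have h1 := (hiff 0).1 (h _ (Set.mem_univ _))
      have h2 := (hiff (2 * Real.pi * I)).1 (h _ (Set.mem_univ _))
      rw [Complex.exp_zero] at h1
      rw [Complex.exp_two_pi_mul_I] at h2
      have h3 : (2 * Real.pi * I : ℂ) = 0 := by linear_combination h2 - h1
      exact Complex.two_pi_I_ne_zero h3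

lemma star_bound : ∃ C : ℝ, ∀ v v1 : ℂ → ℂ, WCls v v1 (Metric.ball 0 1) → ‖v 0‖ ≤ 1 →
    ‖deriv v 0‖ ≤ C := by
  by_contra hcon
  push Not at hcon
  choose V V1 h1 h2 h3 h4 using star_zalcman hcon
  exact star_contra V V1 h1 h2 h3 h4

lemma star_bound_half : ∃ C : ℝ, 1 ≤ C ∧ ∀ v v1 : ℂ → ℂ, WCls v v1 (Metric.ball 0 1) →
    ∀ z ∈ Metric.ball (0:ℂ) (1/2), ‖v z‖ ≤ 1/2 → ‖deriv v z‖ ≤ C := by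
  obtain ⟨C, hC⟩ := star_bound
  refine ⟨max C 1, le_max_right _ _, fun v v1 hW z hz hv => ?_⟩
  have ha : ((1/2 : ℂ)) ≠ 0 := by norm_num
  have h1 := hC (rsc z (1/2) v) (rsc z (1/2) v1) (hW.rsc ha (fun ζ hζ => by
    rw [mem_ball_zero_iff] at *
    have h2 : ‖(1/2:ℂ) * ζ‖ = 1/2 * ‖ζ‖ := by rw [norm_mul]; norm_num
    have := norm_add_le z ((1/2:ℂ) * ζ)
    linarith)) (by
      simp only [rsc, mul_zero, add_zero, norm_div]
      norm_num
      linarith)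
  rw [deriv_rsc ha] at h1
  simp only [mul_zero, add_zero] at h1
  exact h1.trans (le_max_left _ _)

lemma dichotomy : ∃ c : ℝ, 0 < c ∧ c ≤ 1/2 ∧ ∀ v v1 : ℂ → ℂ, WCls v v1 (Metric.ball 0 1) →
    (∀ z ∈ Metric.ball (0:ℂ) c, ‖v z‖ ≤ 1/2) ∨ (∀ z ∈ Metric.ball (0:ℂ) c, 1/4 ≤ ‖v z‖) := by
  obtain ⟨C, hC1, hC⟩ := star_bound_half
  have hC0 : 0 < C := by linarith
  refine ⟨1 / (9 * C), by positivity, ?_, fun v v1 hW => ?_⟩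
  · rw [div_le_div_iff₀ (by positivity) (by norm_num)]; linarith
  set c := 1 / (9 * C) with hc
  have hc0 : 0 < c := by positivity
  have hc2 : c ≤ 1/2 := by
    rw [hc, div_le_div_iff₀ (by positivity) (by norm_num)]; linarith
  have hcC : 2 * c * C < 1/4 := by rw [hc]; field_simp; norm_num
  by_contra hcon
  push Not at hcon
  obtain ⟨⟨z, hz, hvz⟩, z1, hz1, hvz1⟩ := hcon
  have hseg : ∀ t ∈ Set.Icc (0:ℝ) 1, z1 + (t:ℂ) * (z - z1) ∈ Metric.ball (0:ℂ) c := by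
    intro t ht
    have := (convex_ball (0:ℂ) c).add_smul_sub_mem hz1 hz ht
    simpa using this
  have hlen : ‖z - z1‖ ≤ 2 * c := by
    rw [mem_ball_zero_iff] at hz hz1
    linarith [norm_sub_le z z1]
  have hcb : Metric.ball (0:ℂ) c ⊆ Metric.ball 0 1 := Metric.ball_subset_ball (by linarith)
  have hder : ∀ t ∈ Set.Icc (0:ℝ) 1, HasDerivAt (fun t : ℝ => v (z1 + (t:ℂ) * (z - z1)))
      (deriv v (z1 + (t:ℂ) * (z - z1)) * (z - z1)) t := by
    intro t ht
    have h1 : HasDerivAt v (deriv v (z1 + (t:ℂ) * (z - z1))) (z1 + (t:ℂ) * (z - z1)) :=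
      (hW.dv.differentiableAt (Metric.isOpen_ball.mem_nhds (hcb (hseg t ht)))).hasDerivAt
    have h2 : HasDerivAt (fun t : ℝ => z1 + (t:ℂ) * (z - z1)) (z - z1) t := by
      have := ((Complex.ofRealCLM.hasDerivAt (x := t)).mul_const (z - z1)).const_add z1
      simpa using this
    exact h1.comp t h2
  have key := image_norm_le_of_norm_deriv_right_lt_deriv_boundary' (a := 0) (b := 1)
    (f := fun t : ℝ => v (z1 + (t:ℂ) * (z - z1)))
    (f' := fun t : ℝ => deriv v (z1 + (t:ℂ) * (z - z1)) * (z - z1))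
    (B := fun t => 1/4 + t/4) (B' := fun _ => 1/4)
    (fun t ht => (hder t ht).continuousAt.continuousWithinAt)
    (fun t ht => (hder t ⟨ht.1, ht.2.le⟩).hasDerivWithinAt)
    (by simp; linarith) (by fun_prop)
    (fun t ht => by
      have : HasDerivAt (fun t : ℝ => 1/4 + t/4) (1/4) t :=
        ((hasDerivAt_id t).div_const 4).const_add (1/4)
      exact this.hasDerivWithinAt)
    (fun t ht he => by
      have hm := hseg t ⟨ht.1, ht.2.le⟩
      have h1 := hC v v1 hW _ (Metric.ball_subset_ball hc2 hm) (by rw [he]; linarith [ht.2])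
      rw [norm_mul]
      calc _ ≤ C * (2 * c) := by gcongr
        _ < 1/4 := by linarith) (x := 1) (by simp)
  simp at key
  norm_num at key
  linarith

/-- logarithmic derivative of `1 - v'` -/
noncomputable def lam (v : ℂ → ℂ) (z : ℂ) : ℂ := - deriv (deriv v) z / (1 - deriv v z)

lemma growth_unit : ∃ c C : ℝ, 0 < c ∧ c ≤ 1/2 ∧ 1 ≤ C ∧ ∀ v v1 : ℂ → ℂ, WCls v v1 (Metric.ball 0 1) →
    ∀ z ∈ Metric.ball (0:ℂ) c, Real.log (1 + ‖v z‖) ≤ C * (1 + Real.log (1 + ‖v 0‖)) := by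
  obtain ⟨c, hc0, hc2, hdi⟩ := dichotomy
  refine ⟨c/2, 10, by linarith, by linarith, by norm_num, fun v v1 hW z hz => ?_⟩
  have hlog0 : 0 ≤ Real.log (1 + ‖v 0‖) := Real.log_nonneg (by linarith [norm_nonneg (v 0)])
  have hl4 : Real.log 4 < 2 := by
    have : Real.log 4 = 2 * Real.log 2 := by
      rw [show (4:ℝ) = 2 ^ 2 by norm_num, Real.log_pow]; norm_num
    have := Real.log_two_lt_d9
    linarith
  have hl40 : 0 < Real.log 4 := Real.log_pos (by norm_num)
  rcases hdi v v1 hW with h | h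
  · have h1 := h z (Metric.ball_subset_ball (by linarith) hz)
    have : Real.log (1 + ‖v z‖) ≤ Real.log 4 :=
      Real.log_le_log (by positivity) (by linarith)
    linarith
  · have hne : ∀ z ∈ Metric.ball (0:ℂ) c, v z ≠ 0 := fun z hz h0 => by
      have := h z hz; rw [h0, norm_zero] at this; norm_num at this
    have hd := hW.dv.mono (Metric.ball_subset_ball (show c ≤ 1 by linarith))
    have h1 := (harnack_log (F := fun z => (v z)⁻¹) (c := 0) (r := c) (M := Real.log 4)
      hc0 (hd.inv hne) (fun z hz => inv_ne_zero (hne z hz)) (fun z hz => by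
        have := h z hz
        apply Real.log_le_log (norm_pos_iff.2 (inv_ne_zero (hne z hz)))
        rw [norm_inv, inv_le_comm₀ (norm_pos_iff.2 (hne z hz)) (by norm_num)]
        linarith)).1 z (Metric.ball_subset_ball (by linarith) hz)
    simp only [norm_inv, Real.log_inv] at h1
    have hz' : dist z 0 < c/2 := hz
    have hzc := Metric.ball_subset_ball (show c/2 ≤ c by linarith) hz
    have hz4 := h z hzc
    have h04 := h 0 (Metric.mem_ball_self hc0)
    have h0p : 0 < ‖v 0‖ := by linarith
    have hzp : 0 < ‖v z‖ := by linarith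
    have ha : 0 ≤ Real.log 4 - -Real.log ‖v 0‖ := by
      rw [sub_neg_eq_add, ← Real.log_mul (by norm_num) h0p.ne']
      exact Real.log_nonneg (by linarith)
    have hb : 0 ≤ Real.log 4 - -Real.log ‖v z‖ := by
      rw [sub_neg_eq_add, ← Real.log_mul (by norm_num) hzp.ne']
      exact Real.log_nonneg (by linarith)
    have hle : Real.log 4 - -Real.log ‖v z‖ ≤ 3 * (Real.log 4 - -Real.log ‖v 0‖) := by
      have h2 : (Real.log 4 - -Real.log ‖v z‖) * (c/2) ≤ (Real.log 4 - -Real.log ‖v 0‖) * (c * (3/2)) := by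
        calc _ ≤ (Real.log 4 - -Real.log ‖v z‖) * (c - dist z 0) := by gcongr; linarith
          _ ≤ (Real.log 4 - -Real.log ‖v 0‖) * (c + dist z 0) := h1
          _ ≤ _ := by gcongr; linarith
      nlinarith
    have h3 : Real.log ‖v 0‖ ≤ Real.log (1 + ‖v 0‖) := Real.log_le_log h0p (by linarith)
    have h4 : Real.log (1 + ‖v z‖) ≤ Real.log 5 + Real.log ‖v z‖ := by
      rw [← Real.log_mul (by norm_num) hzp.ne']
      exact Real.log_le_log (by positivity) (by linarith)
    have h5 : Real.log 5 ≤ 4 := by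
      have := Real.log_le_sub_one_of_pos (show (0:ℝ) < 5 by norm_num)
      linarith
    linarith

noncomputable def Phi (v : ℂ → ℂ) (y : ℝ) (z : ℂ) : ℝ :=
  1 + Real.log (1 + ‖v z‖ / y) + |Real.log ‖1 - deriv v z‖|

lemma step_unit : ∃ c M : ℝ, 0 < c ∧ c ≤ 1/2 ∧ 1 ≤ M ∧ ∀ v v1 : ℂ → ℂ, WCls v v1 (Metric.ball 0 1) →
    ‖lam v 0‖ ≤ M * Phi v 1 0 ∧ ∀ z ∈ Metric.ball (0:ℂ) c, Phi v 1 z ≤ M * Phi v 1 0 := by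
  obtain ⟨c, C, hc0, hc2, hC, hg⟩ := growth_unit
  set K : ℝ := Real.log (1 + 2/c) with hK
  have hK0 : 0 ≤ K := Real.log_nonneg (by have : 0 ≤ 2/c := by positivity
                                          linarith)
  refine ⟨c/4, 4/c * (C + K + 1) + 1 + C + 4 * (C + K) + 4, by positivity, by linarith, ?_, fun v v1 hW => ?_⟩
  · have : 0 ≤ 4/c * (C + K + 1) := by positivity
    linarith
  set ℓ := Real.log (1 + ‖v 0‖) with hℓ
  have hℓ0 : 0 ≤ ℓ := Real.log_nonneg (by linarith [norm_nonneg (v 0)])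
  set M1 := (C + K) * (1 + ℓ) with hM1
  have hd := hW.dv
  have hdd := hd.deriv Metric.isOpen_ball
  have hb : ∀ z ∈ Metric.ball (0:ℂ) c, ‖v z‖ ≤ Real.exp (C * (1 + ℓ)) := fun z hz => by
    have := hg v v1 hW z hz
    rw [Real.log_le_iff_le_exp (by positivity)] at this
    linarith
  have hub : ∀ z ∈ Metric.ball (0:ℂ) (c/2), Real.log ‖1 - deriv v z‖ ≤ M1 := by
    intro z hz
    have hz0 : ‖z‖ < c/2 := by simpa using hz
    have hin : Metric.ball z (c/2) ⊆ Metric.ball 0 c := fun w hw => by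
      rw [mem_ball_zero_iff]
      rw [Metric.mem_ball, dist_eq_norm] at hw
      linarith [norm_sub_norm_le w z]
    have h1 : ‖deriv v z‖ ≤ Real.exp (C * (1 + ℓ)) / (c/2) := by
      have key : ∀ r ∈ Set.Ioo 0 (c/2), ‖deriv v z‖ * r ≤ Real.exp (C * (1 + ℓ)) := by
        intro r hr
        have hcl : Metric.closedBall z r ⊆ Metric.ball z (c/2) := Metric.closedBall_subset_ball hr.2
        have := Complex.norm_deriv_le_of_forall_mem_sphere_norm_le (c := z) (R := r) (f := v)
          (C := Real.exp (C * (1 + ℓ))) hr.1 (DifferentiableOn.diffContOnCl (by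
            rw [closure_ball _ hr.1.ne']
            exact hd.mono (hcl.trans (hin.trans (Metric.ball_subset_ball (by linarith))))))
          (fun w hw => hb w (hin (hcl (Metric.sphere_subset_closedBall hw))))
        rwa [le_div_iff₀ hr.1] at this
      rw [le_div_iff₀ (by positivity)]
      have hcw : Tendsto (fun r : ℝ => ‖deriv v z‖ * r) (𝓝[<] (c/2)) (𝓝 (‖deriv v z‖ * (c/2))) :=
        (Continuous.tendsto (by fun_prop) _).mono_left nhdsWithin_le_nhds
      refine le_of_tendsto hcw ?_
      filter_upwards [Ioo_mem_nhdsLT (show 0 < c/2 by positivity)] with r hr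
      exact key r hr
    have hzb : z ∈ Metric.ball (0:ℂ) 1 := Metric.ball_subset_ball (by linarith) hz
    have hne : 1 - deriv v z ≠ 0 := fun h => hW.h1 z hzb (sub_eq_zero.1 h).symm
    have hE : 1 ≤ Real.exp (C * (1 + ℓ)) := Real.one_le_exp (by positivity)
    have h2 : ‖1 - deriv v z‖ ≤ (1 + 2/c) * Real.exp (C * (1 + ℓ)) := by
      have := norm_sub_le 1 (deriv v z)
      rw [norm_one] at this
      have e : Real.exp (C * (1 + ℓ)) / (c/2) = 2/c * Real.exp (C * (1 + ℓ)) := by field_simp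
      linarith
    calc Real.log ‖1 - deriv v z‖ ≤ Real.log ((1 + 2/c) * Real.exp (C * (1 + ℓ))) :=
          Real.log_le_log (norm_pos_iff.2 hne) h2
      _ = K + C * (1 + ℓ) := by
          rw [Real.log_mul (by positivity) (by positivity), Real.log_exp]
      _ ≤ M1 := by rw [hM1]; nlinarith
  have hsub : Metric.ball (0:ℂ) (c/2) ⊆ Metric.ball 0 1 := Metric.ball_subset_ball (by linarith)
  have hH := harnack_log (F := fun z => 1 - deriv v z) (c := 0) (r := c/2) (M := M1) (by positivity)
    ((hdd.const_sub 1).mono hsub) (fun z hz h => hW.h1 z (hsub hz) (sub_eq_zero.1 h).symm) hub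
  set a := |Real.log ‖1 - deriv v 0‖| with ha
  have ha0 : 0 ≤ a := abs_nonneg _
  have hneg := neg_abs_le (Real.log ‖1 - deriv v 0‖)
  have hPhi0 : Phi v 1 0 = 1 + ℓ + a := by simp [Phi, hℓ, ha]
  have hM10 : 0 ≤ M1 := by positivity
  have hM1le : M1 ≤ (C + K) * Phi v 1 0 := by rw [hPhi0, hM1]; exact mul_le_mul_of_nonneg_left (by linarith) (by positivity)
  have hP1 : 1 ≤ Phi v 1 0 := by rw [hPhi0]; linarith
  have haP : a ≤ Phi v 1 0 := by rw [hPhi0]; linarith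
  constructor
  · have h3 := hH.2.2
    have e : deriv (fun z => 1 - deriv v z) 0 / (1 - deriv v 0) = lam v 0 := by
      rw [deriv_const_sub]; rfl
    rw [e] at h3
    have e2 : 2 / (c/2) = 4 / c := by field_simp; norm_num
    rw [e2] at h3
    have h5 : M1 - Real.log ‖1 - deriv v 0‖ ≤ (C + K + 1) * Phi v 1 0 := by linarith
    calc _ ≤ 4/c * (M1 - Real.log ‖1 - deriv v 0‖) := h3
      _ ≤ 4/c * ((C + K + 1) * Phi v 1 0) := by gcongr
      _ = (4/c * (C + K + 1)) * Phi v 1 0 := by ring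
      _ ≤ _ := by gcongr; linarith
  · intro z hz
    have hzc : z ∈ Metric.ball (0:ℂ) (c/2) := Metric.ball_subset_ball (by linarith) hz
    have h3 := hH.1 z hzc
    have hdz : dist z 0 < c/4 := hz
    have hA := hub z hzc
    have hB := hub 0 (Metric.mem_ball_self (by positivity))
    have h4 : M1 - Real.log ‖1 - deriv v z‖ ≤ 3 * (M1 - Real.log ‖1 - deriv v 0‖) := by
      have h2 : (M1 - Real.log ‖1 - deriv v z‖) * (c/4) ≤ (M1 - Real.log ‖1 - deriv v 0‖) * (3 * c / 4) := by
        calc _ ≤ (M1 - Real.log ‖1 - deriv v z‖) * (c/2 - dist z 0) := by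
                gcongr <;> linarith
          _ ≤ (M1 - Real.log ‖1 - deriv v 0‖) * (c/2 + dist z 0) := h3
          _ ≤ _ := by gcongr <;> linarith
      nlinarith
    have h6 : |Real.log ‖1 - deriv v z‖| ≤ 4 * M1 + 3 * a := by
      rw [abs_le]; constructor <;> linarith
    have h7 := hg v v1 hW z (Metric.ball_subset_ball (by linarith) hz)
    have h8 : C * (1 + ℓ) ≤ C * Phi v 1 0 := by rw [hPhi0]; exact mul_le_mul_of_nonneg_left (by linarith) (by positivity)
    have h9 : 0 ≤ 4/c * (C + K + 1) * Phi v 1 0 := by positivity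
    have : Phi v 1 z = 1 + Real.log (1 + ‖v z‖) + |Real.log ‖1 - deriv v z‖| := by simp [Phi]
    rw [this]
    nlinarith

/-- upper half-plane -/
def UH : Set ℂ := {z | 0 < z.im}

lemma isOpen_UH : IsOpen UH := isOpen_lt continuous_const Complex.continuous_im

lemma ball_sub_UH {z : ℂ} (hz : z ∈ UH) : Metric.ball z z.im ⊆ UH := by
  intro w hw
  have h1 := Complex.abs_im_le_norm (w - z)
  rw [Metric.mem_ball, dist_eq_norm] at hw
  rw [Complex.sub_im] at h1
  have := neg_abs_le (w.im - z.im)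
  show 0 < w.im
  linarith

def SlowF (Φ : ℂ → ℝ) : Prop := (∀ z, 0 < z.im → 0 ≤ Φ z) ∧ ∃ δ M : ℝ, 0 < δ ∧ δ ≤ 1/2 ∧ 1 ≤ M ∧ ∀ z z' : ℂ, 0 < z.im →
  ‖z' - z‖ ≤ δ * z.im → Φ z' ≤ M * Φ z

lemma im_seg {z w : ℂ} {t : ℝ} (ht : t ∈ Set.Icc (0:ℝ) 1) :
    min z.im w.im ≤ (z + (t:ℂ) * (w - z)).im := by
  simp
  have h1 := min_le_left z.im w.im
  have h2 := min_le_right z.im w.im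
  rcases le_total z.im w.im with h | h
  · left; have := mul_nonneg ht.1 (sub_nonneg.2 h); linarith
  · right; nlinarith [ht.1, ht.2]

lemma SlowF.chain {Φ : ℂ → ℝ} (h : SlowF Φ) (K : ℝ) : ∃ M : ℝ, 1 ≤ M ∧ ∀ z w : ℂ, 0 < z.im →
    0 < w.im → ‖w - z‖ ≤ K * min z.im w.im → Φ w ≤ M * Φ z := by
  obtain ⟨h0, δ, M, hδ, hδ2, hM, hs⟩ := h
  obtain ⟨n, hn⟩ := exists_nat_ge (K / δ)
  have hn1 : K ≤ δ * (n + 1) := by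
    rw [div_le_iff₀ hδ] at hn; nlinarith
  refine ⟨M ^ (n+1), one_le_pow₀ hM, fun z w hz hw hzw => ?_⟩
  have hmin : 0 < min z.im w.im := lt_min hz hw
  have hN : (0:ℝ) < n + 1 := by positivity
  set p : ℕ → ℂ := fun k => z + ((k / (n+1) : ℝ):ℂ) * (w - z) with hp
  have hpim : ∀ k ≤ n + 1, min z.im w.im ≤ (p k).im := fun k hk => im_seg ⟨by positivity, by
    rw [div_le_one hN]; exact_mod_cast hk⟩
  have hstep : ∀ k ≤ n + 1, Φ (p k) ≤ M ^ k * Φ z := by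
    intro k
    induction k with
    | zero => intro _; simp [hp]
    | succ k ih =>
      intro hk
      have h1 := ih (by omega)
      have h2 := hpim k (by omega)
      have h3 := hs (p k) (p (k+1)) (by linarith) (by
        have e : p (k+1) - p k = ((1/(n+1) : ℝ):ℂ) * (w - z) := by
          simp only [hp]; push_cast; ring
        rw [e, norm_mul, Complex.norm_real, Real.norm_eq_abs, abs_of_pos (by positivity)]
        calc 1 / ((n:ℝ)+1) * ‖w - z‖ ≤ 1 / ((n:ℝ)+1) * (K * min z.im w.im) := by gcongr
          _ ≤ 1 / ((n:ℝ)+1) * (δ * (n+1) * min z.im w.im) := by gcongr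
          _ = δ * min z.im w.im := by field_simp
          _ ≤ δ * (p k).im := by gcongr)
      calc _ ≤ M * Φ (p k) := h3
        _ ≤ M * (M ^ k * Φ z) := by gcongr
        _ = _ := by ring
  have := hstep (n+1) le_rfl
  have e : p (n+1) = w := by
    simp only [hp]; push_cast
    have : ((n:ℂ)+1) ≠ 0 := by exact_mod_cast hN.ne'
    rw [div_self this]; ring
  rwa [e] at this

lemma norm_vert (x a b : ℝ) : ‖(⟨x, a⟩ - ⟨x, b⟩ : ℂ)‖ = |a - b| := by
  have e : (⟨x, a⟩ - ⟨x, b⟩ : ℂ) = ((a - b : ℝ) : ℂ) * I := by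
    apply Complex.ext <;> simp
  rw [e, norm_mul, Complex.norm_I, Complex.norm_real, Real.norm_eq_abs, mul_one]

lemma SlowF.poly {Φ : ℂ → ℝ} (h : SlowF Φ) : ∃ (C : ℝ) (A : ℕ), 0 ≤ C ∧ ∀ z : ℂ, 0 < z.im →
    Φ z ≤ C * (1 + ‖z‖) ^ (2 * A) / z.im ^ A := by
  obtain ⟨M, hM, hc⟩ := h.chain 1
  have h0 := h.1
  obtain ⟨A, hA⟩ : ∃ A : ℕ, M ≤ 2 ^ A := pow_unbounded_of_one_lt M (by norm_num : (1:ℝ) < 2) |>.imp fun _ h => h.le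
  have hM0 : 0 < M := by linarith
  have hup : ∀ (n : ℕ) (x y : ℝ), 0 < y → Φ ⟨x, y⟩ ≤ M ^ n * Φ ⟨x, 2 ^ n * y⟩ := by
    intro n
    induction n with
    | zero => intro x y hy; simp
    | succ n ih =>
      intro x y hy
      have h1 := ih x y hy
      have h2 : Φ ⟨x, 2 ^ n * y⟩ ≤ M * Φ ⟨x, 2 ^ (n+1) * y⟩ := by
        apply hc
        · show 0 < 2 ^ (n+1) * y; positivity
        · show 0 < 2 ^ n * y; positivity
        · have e : (2:ℝ) ^ n * y - 2 ^ (n+1) * y = -(2^n * y) := by ring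
          rw [norm_vert, e, abs_neg, abs_of_pos (by positivity), one_mul, pow_succ]
          rw [le_min_iff]; constructor
          · show 2 ^ n * y ≤ 2 ^ n * 2 * y
            have : 0 < 2 ^ n * y := by positivity
            linarith
          · exact le_rfl
      calc _ ≤ M ^ n * Φ ⟨x, 2 ^ n * y⟩ := h1
        _ ≤ M ^ n * (M * Φ ⟨x, 2 ^ (n+1) * y⟩) := by gcongr
        _ = _ := by ring
  have hdown : ∀ (n : ℕ) (x y : ℝ), 0 < y → Φ ⟨x, 2 ^ n * y⟩ ≤ M ^ n * Φ ⟨x, y⟩ := by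
    intro n
    induction n with
    | zero => intro x y hy; simp
    | succ n ih =>
      intro x y hy
      have h1 := ih x y hy
      have h2 : Φ ⟨x, 2 ^ (n+1) * y⟩ ≤ M * Φ ⟨x, 2 ^ n * y⟩ := by
        apply hc
        · show 0 < 2 ^ n * y; positivity
        · show 0 < 2 ^ (n+1) * y; positivity
        · have e : (2:ℝ) ^ (n+1) * y - 2 ^ n * y = 2^n * y := by ring
          rw [norm_vert, e, abs_of_pos (by positivity), one_mul, pow_succ]
          rw [le_min_iff]; constructor
          · exact le_rfl
          · show 2 ^ n * y ≤ 2 ^ n * 2 * y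
            have : 0 < 2 ^ n * y := by positivity
            linarith
      calc _ ≤ M * Φ ⟨x, 2 ^ n * y⟩ := h2
        _ ≤ M * (M ^ n * Φ ⟨x, y⟩) := by gcongr
        _ = _ := by ring
  have hpow : ∀ n : ℕ, M ^ n ≤ (2 ^ n) ^ A := fun n => by
    calc M ^ n ≤ (2 ^ A) ^ n := by gcongr
      _ = _ := by rw [← pow_mul, ← pow_mul, mul_comm]
  refine ⟨8 ^ A * M ^ 2 * Φ I, A, by have := h0 I (by simp); positivity, fun z hz => ?_⟩
  set R := 1 + ‖z‖ with hR
  have hR1 : 1 ≤ R := by linarith [norm_nonneg z]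
  have hyR : z.im ≤ R := by linarith [(le_abs_self z.im).trans (Complex.abs_im_le_norm z)]
  have hxR : |z.re| ≤ R := by linarith [Complex.abs_re_le_norm z]
  obtain ⟨n, hn1, hn2⟩ := exists_nat_pow_near (show 1 ≤ R / z.im by rwa [one_le_div hz])
    (show (1:ℝ) < 2 by norm_num)
  rw [le_div_iff₀ hz] at hn1
  rw [div_lt_iff₀ hz] at hn2
  set Y := 2 ^ (n+1) * z.im with hY
  have hY2 : Y ≤ 2 * R := by rw [hY, pow_succ]; linarith
  have hY0 : 0 < Y := by linarith
  have e1 : Φ z ≤ M ^ (n+1) * Φ ⟨z.re, Y⟩ := hup (n+1) z.re z.im hz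
  have e2 : Φ ⟨z.re, Y⟩ ≤ M * Φ ⟨0, Y⟩ := by
    apply hc _ _ hY0 hY0
    have e : (⟨z.re, Y⟩ - ⟨0, Y⟩ : ℂ) = (z.re : ℂ) := by apply Complex.ext <;> simp
    rw [e, Complex.norm_real, Real.norm_eq_abs]
    simp; linarith
  obtain ⟨k, hk1, hk2⟩ := exists_nat_pow_near (show 1 ≤ Y by linarith)
    (show (1:ℝ) < 2 by norm_num)
  rw [pow_succ] at hk2
  have e3 : Φ ⟨0, Y⟩ ≤ M * Φ ⟨0, 2 ^ k * 1⟩ := by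
    have h2k : (0:ℝ) < 2 ^ k := by positivity
    apply hc _ _ (by simp) hY0
    rw [norm_vert, abs_of_nonneg (by linarith), one_mul, le_min_iff]
    constructor
    · show Y - 2 ^ k * 1 ≤ 2 ^ k * 1; linarith
    · show Y - 2 ^ k * 1 ≤ Y; linarith
  have e4 : Φ ⟨0, 2 ^ k * 1⟩ ≤ M ^ k * Φ I := hdown k 0 1 one_pos
  have hΦI := h0 I (by simp)
  have hn3 : M ^ (n+1) ≤ (2 * R / z.im) ^ A := (hpow _).trans (by
    gcongr
    rw [le_div_iff₀ hz]; exact hY2)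
  have hk3 : M ^ k ≤ (2 * R) ^ A := (hpow _).trans (by gcongr; linarith)
  calc Φ z ≤ M ^ (n+1) * (M * (M * (M ^ k * Φ I))) := by
        refine e1.trans ?_
        gcongr
        refine e2.trans ?_
        gcongr
        refine e3.trans ?_
        gcongr
    _ ≤ (2 * R / z.im) ^ A * (M * (M * ((2 * R) ^ A * Φ I))) := by gcongr
    _ = 4 ^ A * M ^ 2 * Φ I * R ^ (2 * A) / z.im ^ A := by
        rw [div_pow, mul_pow, pow_mul, show (4:ℝ) = 2 * 2 by norm_num, mul_pow]
        rw [show (R ^ 2) ^ A = R ^ A * R ^ A by rw [← mul_pow, sq]]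
        field_simp
    _ ≤ _ := by gcongr; norm_num

lemma WCls.rscUH {v v1 : ℂ → ℂ} (h : WCls v v1 UH) {z : ℂ} (hz : 0 < z.im) :
    WCls (_root_.rsc z z.im v) (_root_.rsc z z.im v1) (Metric.ball 0 1) := by
  apply h.rsc (by exact_mod_cast hz.ne')
  intro ζ hζ
  apply ball_sub_UH hz
  rw [mem_ball_zero_iff] at hζ
  rw [Metric.mem_ball, dist_eq_norm, add_sub_cancel_left, norm_mul, Complex.norm_real, Real.norm_eq_abs, abs_of_pos hz]
  nlinarith

lemma lam_rsc {c a : ℂ} (ha : a ≠ 0) (v : ℂ → ℂ) (ζ : ℂ) :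
    lam (rsc c a v) ζ = a * lam v (c + a * ζ) := by
  unfold lam
  rw [deriv_rsc ha]
  have e : deriv (rsc c a v) = fun ζ => a * rsc c a (deriv v) ζ := by
    ext w; rw [deriv_rsc ha]; unfold rsc; field_simp
  rw [e, deriv_const_mul_field, deriv_rsc ha]
  ring

lemma slow_one {v v1 : ℂ → ℂ} (h : WCls v v1 UH) :
    SlowF (fun z => 1 + Real.log (1 + ‖v z‖ / z.im)) := by
  obtain ⟨c, C, hc0, hc2, hC, hg⟩ := growth_unit
  refine ⟨fun z hz => ?_, c/2, C + 3, by positivity, by linarith, by linarith, fun z z' hz hzz => ?_⟩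
  · have : 0 ≤ Real.log (1 + ‖v z‖ / z.im) := Real.log_nonneg (by
      have : 0 ≤ ‖v z‖ / z.im := by positivity
      linarith)
    linarith
  have hzc : ((z.im : ℝ):ℂ) ≠ 0 := by exact_mod_cast hz.ne'
  have h1 := hg _ _ (h.rscUH hz) ((z' - z) / z.im) (by
    rw [mem_ball_zero_iff, norm_div, Complex.norm_real, Real.norm_eq_abs, abs_of_pos hz,
      div_lt_iff₀ hz]
    nlinarith)
  have e : z + (z.im : ℂ) * ((z' - z) / z.im) = z' := by field_simp; ring
  simp only [rsc, e, norm_div, Complex.norm_real, Real.norm_eq_abs, abs_of_pos hz, mul_zero, add_zero] at h1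
  have him : z.im / 2 ≤ z'.im := by
    have h3 := Complex.abs_im_le_norm (z' - z)
    rw [Complex.sub_im] at h3
    have := neg_abs_le (z'.im - z.im)
    nlinarith
  have h4 : Real.log (1 + ‖v z'‖ / z'.im) ≤ 1 + Real.log (1 + ‖v z'‖ / z.im) := by
    have h5 : 1 + ‖v z'‖ / z'.im ≤ 2 * (1 + ‖v z'‖ / z.im) := by
      have : ‖v z'‖ / z'.im ≤ ‖v z'‖ / (z.im / 2) := by gcongr
      have e2 : ‖v z'‖ / (z.im / 2) = 2 * (‖v z'‖ / z.im) := by field_simp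
      linarith
    have hp : 0 < z'.im := by linarith
    calc _ ≤ Real.log (2 * (1 + ‖v z'‖ / z.im)) := Real.log_le_log (by positivity) h5
      _ = Real.log 2 + Real.log (1 + ‖v z'‖ / z.im) := Real.log_mul (by norm_num) (by positivity)
      _ ≤ _ := by linarith [Real.log_two_lt_d9]
  have h6 : 0 ≤ Real.log (1 + ‖v z‖ / z.im) := Real.log_nonneg (by
      have : 0 ≤ ‖v z‖ / z.im := by positivity
      linarith)
  show 1 + Real.log (1 + ‖v z'‖ / z'.im) ≤ (C + 3) * (1 + Real.log (1 + ‖v z‖ / z.im))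
  linarith

lemma Phi_rsc {v : ℂ → ℂ} {z : ℂ} {a : ℝ} (ha : 0 < a) (ζ : ℂ) :
    Phi (rsc z a v) 1 ζ = Phi v a (z + a * ζ) := by
  unfold Phi
  rw [deriv_rsc (by exact_mod_cast ha.ne')]
  simp [rsc, abs_of_pos ha]

lemma slow_two {v v1 : ℂ → ℂ} (h : WCls v v1 UH) :
    SlowF (fun z => Phi v z.im z) ∧ ∃ M : ℝ, 1 ≤ M ∧ ∀ z : ℂ, 0 < z.im →
      ‖lam v z‖ ≤ M * Phi v z.im z / z.im := by
  obtain ⟨c, C, hc0, hc2, hC, hg⟩ := step_unit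
  refine ⟨⟨fun z hz => ?_, c/2, C + 1, by positivity, by linarith, by linarith, fun z z' hz hzz => ?_⟩,
    C, hC, fun z hz => ?_⟩
  · have : 0 ≤ Real.log (1 + ‖v z‖ / z.im) := Real.log_nonneg (by
      have : 0 ≤ ‖v z‖ / z.im := by positivity
      linarith)
    unfold Phi
    positivity
  · have hzc : ((z.im : ℝ):ℂ) ≠ 0 := by exact_mod_cast hz.ne'
    have h1 := (hg _ _ (h.rscUH hz)).2 ((z' - z) / z.im) (by
      rw [mem_ball_zero_iff, norm_div, Complex.norm_real, Real.norm_eq_abs, abs_of_pos hz,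
        div_lt_iff₀ hz]
      nlinarith)
    have e : z + (z.im : ℂ) * ((z' - z) / z.im) = z' := by field_simp; ring
    rw [Phi_rsc hz, Phi_rsc hz, e, mul_zero, add_zero] at h1
    have him : z.im / 2 ≤ z'.im := by
      have h3 := Complex.abs_im_le_norm (z' - z)
      rw [Complex.sub_im] at h3
      have := neg_abs_le (z'.im - z.im)
      nlinarith
    have h4 : Real.log (1 + ‖v z'‖ / z'.im) ≤ 1 + Real.log (1 + ‖v z'‖ / z.im) := by
      have h5 : 1 + ‖v z'‖ / z'.im ≤ 2 * (1 + ‖v z'‖ / z.im) := by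
        have : ‖v z'‖ / z'.im ≤ ‖v z'‖ / (z.im / 2) := by gcongr
        have e2 : ‖v z'‖ / (z.im / 2) = 2 * (‖v z'‖ / z.im) := by field_simp
        linarith
      have hp : 0 < z'.im := by linarith
      calc _ ≤ Real.log (2 * (1 + ‖v z'‖ / z.im)) := Real.log_le_log (by positivity) h5
        _ = Real.log 2 + Real.log (1 + ‖v z'‖ / z.im) := Real.log_mul (by norm_num) (by positivity)
        _ ≤ _ := by linarith [Real.log_two_lt_d9]
    have h6 : 0 ≤ Real.log (1 + ‖v z‖ / z.im) := Real.log_nonneg (by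
        have : 0 ≤ ‖v z‖ / z.im := by positivity
        linarith)
    have h7 : 1 ≤ Phi v z.im z := by unfold Phi; linarith [abs_nonneg (Real.log ‖1 - deriv v z‖)]
    have h8 : Phi v z'.im z' ≤ 1 + Phi v z.im z' := by unfold Phi; linarith
    show Phi v z'.im z' ≤ (C + 1) * Phi v z.im z
    linarith
  · have h1 := (hg _ _ (h.rscUH hz)).1
    rw [lam_rsc (by exact_mod_cast hz.ne'), Phi_rsc hz, mul_zero, add_zero, norm_mul,
      Complex.norm_real, Real.norm_eq_abs, abs_of_pos hz] at h1
    rw [le_div_iff₀ hz]; linarith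

lemma lam_poly {v v1 : ℂ → ℂ} (h : WCls v v1 UH) : ∃ (C : ℝ) (A : ℕ), 0 ≤ C ∧ ∀ z : ℂ, 0 < z.im →
    ‖lam v z‖ ≤ C * (1 + ‖z‖) ^ (2 * A) / z.im ^ (A+1) := by
  obtain ⟨h1, M, hM, h2⟩ := slow_two h
  obtain ⟨C, A, hC, h3⟩ := h1.poly
  refine ⟨M * C, A, by positivity, fun z hz => ?_⟩
  calc _ ≤ M * Phi v z.im z / z.im := h2 z hz
    _ ≤ M * (C * (1 + ‖z‖) ^ (2 * A) / z.im ^ A) / z.im := by gcongr; exact h3 z hz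
    _ = _ := by rw [pow_succ]; field_simp

def Tower (v : ℕ → ℂ → ℂ) (S : Set ℂ) : Prop := ∀ m ≤ 7, WCls (v m) (v (m+1)) S

/-- relation of `lam` with reciprocals of `v` -/
lemma lam_eq {v v1 v2 : ℂ → ℂ} {S : Set ℂ} (hS : IsOpen S) (h : WCls v v1 S) (h' : WCls v1 v2 S)
    {z : ℂ} (hz : z ∈ S) (h0 : v z ≠ 0) (h1 : v1 z ≠ 0) (h2 : v2 z ≠ 0) :
    lam v z = 1 / v2 z - 2 * (1 / v1 z) + 1 / v z := by
  have hd1 : HasDerivAt v1 (deriv v1 z) z := (h.dv1.differentiableAt (hS.mem_nhds hz)).hasDerivAt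
  have hd : HasDerivAt v (deriv v z) z := (h.dv.differentiableAt (hS.mem_nhds hz)).hasDerivAt
  have hdd : HasDerivAt (deriv v) (deriv (deriv v) z) z :=
    ((h.dv.deriv hS).differentiableAt (hS.mem_nhds hz)).hasDerivAt
  have hprod := hd1.fun_mul (hdd.const_sub 1)
  have heq : (fun w => v1 w * (1 - deriv v w)) =ᶠ[𝓝 z] v := by
    filter_upwards [hS.mem_nhds hz] with w hw using h.rel w hw
  have e1 := (heq.hasDerivAt_iff.1 hprod).unique hd
  have r1 := h.rel z hz
  have r2 := h'.rel z hz
  have hu : 1 - deriv v z ≠ 0 := fun hh => h.h1 z hz (sub_eq_zero.1 hh).symm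
  unfold lam
  have a1 : deriv v z = 1 - v z / v1 z := by field_simp; linear_combination -r1
  have a2 : deriv v1 z = 1 - v1 z / v2 z := by field_simp; linear_combination -r2
  have hu' : 1 - deriv v z = v z / v1 z := by rw [a1]; ring
  have a3 : - deriv (deriv v) z = (deriv v z - deriv v1 z * (1 - deriv v z)) / v1 z := by
    field_simp; linear_combination e1
  rw [a3, hu', a1, a2]
  field_simp
  ring

lemma lam_diff {v v1 : ℂ → ℂ} {S : Set ℂ} (hS : IsOpen S) (h : WCls v v1 S) :
    DifferentiableOn ℂ (lam v) S := by
  unfold lam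
  apply DifferentiableOn.div
  · exact ((h.dv.deriv hS).deriv hS).neg
  · exact (h.dv.deriv hS).const_sub 1
  · intro z hz hh; exact h.h1 z hz (sub_eq_zero.1 hh).symm

section c2
variable {l : Ultrafilter ℕ} {c : ℝ}

def NullF (l : Ultrafilter ℕ) (c : ℝ) (V : ℕ → ℂ → ℂ) : Prop :=
  TendstoLocallyUniformlyOn V (fun _ => 0) l (Metric.ball 0 c)

lemma null_tlu_deriv {V V1 : ℕ → ℂ → ℂ} (hc0 : 0 < c) (hc1 : c ≤ 1)
    (hW : ∀ n, WCls (V n) (V1 n) (Metric.ball 0 1)) (hN : NullF l c V) :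
    TendstoLocallyUniformlyOn (fun n => deriv (V n)) (fun _ => 0) l (Metric.ball 0 c) := by
  have h := tlu_deriv (l := (l : Filter ℕ)) hN (fun z hz => by
    obtain ⟨r, hr, hrs⟩ := Metric.isOpen_iff.1 Metric.isOpen_ball z hz
    exact ⟨r, hr, hrs, Eventually.of_forall fun n =>
      (hW n).dv.mono (hrs.trans (Metric.ball_subset_ball hc1))⟩)
  simpa using h

lemma null_u {V V1 : ℕ → ℂ → ℂ} (hc0 : 0 < c) (hc1 : c ≤ 1)
    (hW : ∀ n, WCls (V n) (V1 n) (Metric.ball 0 1)) (hN : NullF l c V) :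
    TendstoLocallyUniformlyOn (fun n z => 1 - deriv (V n) z) (fun _ => 1) l (Metric.ball 0 c) := by
  have h := null_tlu_deriv hc0 hc1 hW hN
  rw [Metric.tendstoLocallyUniformlyOn_iff] at h ⊢
  intro ε hε z hz
  obtain ⟨t, ht, hev⟩ := h ε hε z hz
  refine ⟨t, ht, hev.mono fun n hn y hy => ?_⟩
  have := hn y hy
  simpa [dist_eq_norm] using this

lemma null_succ {V V1 : ℕ → ℂ → ℂ} (hc0 : 0 < c) (hc1 : c ≤ 1)
    (hW : ∀ n, WCls (V n) (V1 n) (Metric.ball 0 1)) (hN : NullF l c V) : NullF l c V1 := by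
  have hu := null_u hc0 hc1 hW hN
  have h := TendstoLocallyUniformlyOn.div₀ hN hu continuousOn_const continuousOn_const (by simp)
  unfold NullF
  rw [Metric.tendstoLocallyUniformlyOn_iff] at h ⊢
  intro ε hε z hz
  obtain ⟨t, ht, hev⟩ := h ε hε z hz
  refine ⟨t ∩ Metric.ball 0 c, inter_mem ht self_mem_nhdsWithin, hev.mono fun n hn y hy => ?_⟩
  have h1 := hn y hy.1
  have hyb : y ∈ Metric.ball (0:ℂ) 1 := Metric.ball_subset_ball hc1 hy.2
  have hne : 1 - deriv (V n) y ≠ 0 := fun hh => (hW n).h1 y hyb (sub_eq_zero.1 hh).symm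
  have : V n y / (1 - deriv (V n) y) = V1 n y := by
    rw [div_eq_iff hne, (hW n).rel y hyb]
  simpa [this] using h1

lemma null_lam {V V1 : ℕ → ℂ → ℂ} (hc0 : 0 < c) (hc1 : c ≤ 1)
    (hW : ∀ n, WCls (V n) (V1 n) (Metric.ball 0 1)) (hN : NullF l c V) :
    ∀ᶠ n in (l : Filter ℕ), ‖lam (V n) 0‖ ≤ 1 := by
  have h1 := null_tlu_deriv hc0 hc1 hW hN
  have h2 := tlu_deriv (l := (l : Filter ℕ)) h1 (fun z hz => by
    obtain ⟨r, hr, hrs⟩ := Metric.isOpen_iff.1 Metric.isOpen_ball z hz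
    exact ⟨r, hr, hrs, Eventually.of_forall fun n =>
      ((hW n).dv.deriv Metric.isOpen_ball).mono (hrs.trans (Metric.ball_subset_ball hc1))⟩)
  have h0 : (0:ℂ) ∈ Metric.ball (0:ℂ) c := Metric.mem_ball_self hc0
  have t1 := h1.tendsto_at h0
  have t2 := h2.tendsto_at h0
  have t3 : Tendsto (fun n => lam (V n) 0) l (𝓝 (-0 / (1 - 0))) := by
    unfold lam
    refine Tendsto.div ?_ (t1.const_sub 1) (by norm_num)
    simpa using t2.neg
  have t4 := t3.norm
  simp only [neg_zero, zero_div, norm_zero] at t4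
  exact (t4.eventually (gt_mem_nhds one_pos)).mono fun n hn => hn.le

lemma nonnull_bound {V V1 : ℕ → ℂ → ℂ} (hc0 : 0 < c) (hc1 : c ≤ 1)
    (hW : ∀ n, WCls (V n) (V1 n) (Metric.ball 0 1))
    (hdi : ∀ n, (∀ z ∈ Metric.ball (0:ℂ) c, ‖V n z‖ ≤ 1/2) ∨ (∀ z ∈ Metric.ball (0:ℂ) c, 1/4 ≤ ‖V n z‖))
    (hN : ¬ NullF l c V) : ∃ ρ > 0, ∀ r ∈ Set.Ioo 0 ρ, ∃ B : ℝ, 0 ≤ B ∧ ∀ᶠ n in (l : Filter ℕ),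
      ∀ z ∈ Metric.sphere (0:ℂ) r, V n z ≠ 0 ∧ ‖1 / V n z‖ ≤ B := by
  have hb : ∀ {b : ℝ} {w : ℂ}, 0 < b → b ≤ ‖w‖ → w ≠ 0 ∧ ‖1 / w‖ ≤ 1 / b := by
    intro b w hb h
    refine ⟨norm_pos_iff.1 (by linarith), ?_⟩
    rw [norm_div, norm_one]
    gcongr
  rcases Ultrafilter.eventually_or.1 (Eventually.of_forall (f := (l : Filter ℕ)) hdi) with h | h
  · obtain ⟨g, hg, hlim⟩ := montel_ultra l (F := V) (U := Metric.ball 0 c) (fun z hz => by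
      obtain ⟨r, hr, hrs⟩ := Metric.isOpen_iff.1 Metric.isOpen_ball z hz
      refine ⟨r, hr, 1/2, hrs, h.mono fun n hn => ⟨(hW n).dv.mono (hrs.trans (Metric.ball_subset_ball hc1)),
        fun w hw => hn w (hrs hw)⟩⟩)
    have h0 : (0:ℂ) ∈ Metric.ball (0:ℂ) c := Metric.mem_ball_self hc0
    have hga : AnalyticOnNhd ℂ g (Metric.ball 0 c) := hg.analyticOnNhd Metric.isOpen_ball
    rcases (hga 0 h0).eventually_eq_zero_or_eventually_ne_zero with hz | hz
    · exfalso
      have := hga.eqOn_zero_of_preconnected_of_eventuallyEq_zero (convex_ball _ _).isPreconnected h0 hz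
      exact hN (hlim.congr_right this)
    · rw [eventually_nhdsWithin_iff, Metric.eventually_nhds_iff] at hz
      obtain ⟨ε, hε, hz⟩ := hz
      refine ⟨min ε c, lt_min hε hc0, fun r hr => ?_⟩
      have hrε : r < ε := hr.2.trans_le (min_le_left _ _)
      have hrc : r < c := hr.2.trans_le (min_le_right _ _)
      have hsub : Metric.sphere (0:ℂ) r ⊆ Metric.ball 0 c := fun w hw => by
        rw [Metric.mem_ball, Metric.mem_sphere.1 hw]; exact hrc
      have hK := isCompact_sphere (0:ℂ) r
      obtain ⟨w0, hw0, hmin⟩ := hK.exists_isMinOn (NormedSpace.sphere_nonempty.2 hr.1.le)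
        ((hg.continuousOn.mono hsub).norm)
      have hm : 0 < ‖g w0‖ := norm_pos_iff.2 (hz (by rw [Metric.mem_sphere.1 hw0]; exact hrε) (by
        intro h; simp at h; rw [h] at hw0; simp at hw0; linarith [hr.1]))
      have hu := (tendstoLocallyUniformlyOn_iff_forall_isCompact Metric.isOpen_ball).1 hlim _ hsub hK
      rw [Metric.tendstoUniformlyOn_iff] at hu
      refine ⟨1 / (‖g w0‖/2), by positivity, (hu _ (half_pos hm)).mono fun n hn z hzs => hb (by positivity) ?_⟩
      have h1 := hn z hzs
      have h2 : ‖g w0‖ ≤ ‖g z‖ := hmin hzs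
      rw [dist_eq_norm] at h1
      linarith [norm_sub_norm_le (g z) (V n z)]
  · refine ⟨c, hc0, fun r hr => ⟨1/(1/4), by norm_num, h.mono fun n hn z hz => hb (by norm_num) (hn z ?_)⟩⟩
    rw [Metric.mem_ball, Metric.mem_sphere.1 hz]; exact hr.2

end c2

lemma c2_unit : ∃ C : ℝ, ∀ v : ℕ → ℂ → ℂ, Tower v (Metric.ball 0 1) →
    ∃ j : ℕ, ∀ m ≤ 7, C < ‖lam (v m) 0‖ → m + 1 = j ∨ m + 2 = j := by
  by_contra hcon
  push Not at hcon
  obtain ⟨c, hc0, hc2, hdi⟩ := dichotomy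
  have hc1 : c ≤ 1 := by linarith
  choose V hV hbad using fun n : ℕ => hcon n
  set l : Ultrafilter ℕ := hyperfilter ℕ with hl
  have hl_at : (l : Filter ℕ) ≤ atTop := by rw [hl]; exact Nat.hyperfilter_le_atTop
  set P : ℕ → Prop := fun m => m = 8 ∨ (m ≤ 7 ∧ NullF l c (fun n => V n m)) with hP
  have hex : ∃ j, P j := ⟨8, Or.inl rfl⟩
  set j := Nat.find hex with hj
  have hjP : P j := Nat.find_spec hex
  have hj8 : j ≤ 8 := Nat.find_min' hex (Or.inl rfl)
  have hW : ∀ m ≤ 7, ∀ n, WCls (V n m) (V n (m+1)) (Metric.ball 0 1) := fun m hm n => hV n m hm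
  have hnull : ∀ m, j ≤ m → m ≤ 7 → NullF l c (fun n => V n m) := by
    intro m hm
    induction m, hm using Nat.le_induction with
    | base =>
      intro h7
      rcases hjP with h | h
      · omega
      · exact h.2
    | succ m hm ih =>
      intro h7
      exact null_succ hc0 hc1 (hW m (by omega)) (ih (by omega))
  have hnn : ∀ m, m < j → ¬ NullF l c (fun n => V n m) := fun m hm hN =>
    Nat.find_min hex hm (Or.inr ⟨by omega, hN⟩)
  have hall : ∀ m ≤ 7, ¬ (m + 1 = j ∨ m + 2 = j) → ∃ B : ℝ, ∀ᶠ n in (l : Filter ℕ), ‖lam (V n m) 0‖ ≤ B := by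
    intro m hm hmj
    by_cases hjm : j ≤ m
    · exact ⟨1, null_lam hc0 hc1 (hW m hm) (hnull m hjm hm)⟩
    · have hlt : m + 2 < j := by omega
      obtain ⟨ρ0, hρ0, H0⟩ := nonnull_bound hc0 hc1 (hW m (by omega)) (fun n => hdi _ _ (hW m (by omega) n)) (hnn m (by omega))
      obtain ⟨ρ1, hρ1, H1⟩ := nonnull_bound hc0 hc1 (hW (m+1) (by omega)) (fun n => hdi _ _ (hW (m+1) (by omega) n)) (hnn (m+1) (by omega))
      obtain ⟨ρ2, hρ2, H2⟩ := nonnull_bound hc0 hc1 (hW (m+2) (by omega)) (fun n => hdi _ _ (hW (m+2) (by omega) n)) (hnn (m+2) (by omega))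
      obtain ⟨r, hr0, hr⟩ := exists_between (lt_min (lt_min hρ0 hρ1) (lt_min hρ2 one_pos))
      simp only [lt_min_iff] at hr
      obtain ⟨B0, hB0, E0⟩ := H0 r ⟨hr0, hr.1.1⟩
      obtain ⟨B1, hB1, E1⟩ := H1 r ⟨hr0, hr.1.2⟩
      obtain ⟨B2, hB2, E2⟩ := H2 r ⟨hr0, hr.2.1⟩
      refine ⟨B2 + 2 * B1 + B0, ?_⟩
      filter_upwards [E0, E1, E2] with n e0 e1 e2
      have hcl : Metric.closedBall (0:ℂ) r ⊆ Metric.ball 0 1 := Metric.closedBall_subset_ball hr.2.2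
      refine Complex.norm_le_of_forall_mem_frontier_norm_le (U := Metric.ball 0 r) Metric.isBounded_ball
        (DifferentiableOn.diffContOnCl (by
          rw [closure_ball _ hr0.ne']
          exact (lam_diff Metric.isOpen_ball (hW m hm n)).mono hcl)) (fun z hz => ?_)
        (subset_closure (Metric.mem_ball_self hr0))
      rw [frontier_ball _ hr0.ne'] at hz
      obtain ⟨a0, b0⟩ := e0 z hz
      obtain ⟨a1, b1⟩ := e1 z hz
      obtain ⟨a2, b2⟩ := e2 z hz
      rw [lam_eq Metric.isOpen_ball (hW m hm n) (hW (m+1) (by omega) n)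
        (hcl (Metric.sphere_subset_closedBall hz)) a0 a1 a2]
      calc _ ≤ ‖1 / V n (m+1+1) z - 2 * (1 / V n (m+1) z)‖ + ‖1 / V n m z‖ := norm_add_le _ _
        _ ≤ ‖1 / V n (m+1+1) z‖ + ‖2 * (1 / V n (m+1) z)‖ + ‖1 / V n m z‖ := by
            gcongr; exact norm_sub_le _ _
        _ ≤ _ := by
            rw [norm_mul 2, Complex.norm_two]
            gcongr
  choose! B hB using hall
  have hev : ∀ᶠ n in (l : Filter ℕ), ∀ m ∈ Finset.range 8, ¬ (m + 1 = j ∨ m + 2 = j) →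
      ‖lam (V n m) 0‖ ≤ B m ∧ B m ≤ n := by
    rw [eventually_all_finset]
    intro m hm
    by_cases hmj : m + 1 = j ∨ m + 2 = j
    · exact Eventually.of_forall fun n h => absurd hmj h
    · have h1 : ∀ᶠ n : ℕ in (l : Filter ℕ), B m ≤ (n:ℝ) :=
        hl_at (tendsto_natCast_atTop_atTop.eventually (eventually_ge_atTop _))
      filter_upwards [hB m (by simp at hm; omega) hmj, h1] with n a b _ using ⟨a, b⟩
  obtain ⟨n, hn⟩ := hev.exists
  obtain ⟨m, hm, hlt, h1, h2⟩ := hbad n j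
  have := hn m (by simp; omega) (by tauto)
  linarith

lemma c2_UH {v : ℕ → ℂ → ℂ} (hv : Tower v UH) : ∃ C : ℝ, ∀ z : ℂ, 0 < z.im →
    ∃ j : ℕ, ∀ m ≤ 7, C < z.im * ‖lam (v m) z‖ → m + 1 = j ∨ m + 2 = j := by
  obtain ⟨C, hC⟩ := c2_unit
  refine ⟨C, fun z hz => ?_⟩
  obtain ⟨j, hj⟩ := hC (fun m => rsc z z.im (v m)) (fun m hm => (hv m hm).rscUH hz)
  refine ⟨j, fun m hm h => hj m hm ?_⟩
  simp only [lam_rsc (show ((z.im:ℝ):ℂ) ≠ 0 by exact_mod_cast hz.ne')]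
  rw [norm_mul, Complex.norm_real, Real.norm_eq_abs, abs_of_pos hz]
  simpa using h

lemma poly_of_growth (A : ℕ) : ∀ (h : ℂ → ℂ) (C : ℝ), Differentiable ℂ h →
    (∀ z, ‖h z‖ ≤ C * (1 + ‖z‖) ^ A) → ∃ p : Polynomial ℂ, ∀ z, h z = p.eval z := by
  induction A with
  | zero =>
    intro h C hd hb
    obtain ⟨c, hc⟩ := hd.exists_const_forall_eq_of_bounded (isBounded_iff_forall_norm_le.2 ⟨C, by
      rintro _ ⟨z, rfl⟩; simpa using hb z⟩)
    exact ⟨Polynomial.C c, fun z => by simp [hc z]⟩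
  | succ A ih =>
    intro h C hd hb
    have hC : 0 ≤ C := by have := (norm_nonneg _).trans (hb 0); simpa using this
    have hs : Differentiable ℂ (dslope h 0) := by
      rw [← differentiableOn_univ]
      exact (Complex.differentiableOn_dslope univ_mem).2 hd.differentiableOn
    have hcont : ContinuousOn (dslope h 0) (Metric.closedBall 0 1) := hs.continuous.continuousOn
    obtain ⟨K, hK⟩ := (isCompact_closedBall (0:ℂ) 1).exists_bound_of_continuousOn hcont
    obtain ⟨p, hp⟩ := ih (dslope h 0) (K + 2 * (C + ‖h 0‖)) hs (fun z => by
      have h1 : 1 ≤ (1 + ‖z‖) ^ A := one_le_pow₀ (by linarith [norm_nonneg z])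
      have hK0 : 0 ≤ K := (norm_nonneg _).trans (hK 0 (by simp))
      by_cases hz : ‖z‖ ≤ 1
      · have h2 := hK z (by simpa using hz)
        have : 0 ≤ C + ‖h 0‖ := by positivity
        nlinarith
      · push Not at hz
        have hz0 : z ≠ 0 := fun h => by rw [h, norm_zero] at hz; linarith
        rw [dslope_of_ne _ hz0, slope_def_field, norm_div, sub_zero, div_le_iff₀ (by linarith)]
        have h3 : ‖h z - h 0‖ ≤ (C + ‖h 0‖) * (1 + ‖z‖) ^ (A+1) := by
          have h4 : 1 ≤ (1 + ‖z‖) ^ (A+1) := one_le_pow₀ (by linarith [norm_nonneg z])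
          have := hb z
          have h5 := norm_sub_le (h z) (h 0)
          nlinarith [norm_nonneg (h 0)]
        calc _ ≤ _ := h3
          _ = (C + ‖h 0‖) * (1 + ‖z‖) ^ A * (1 + ‖z‖) := by ring
          _ ≤ (C + ‖h 0‖) * (1 + ‖z‖) ^ A * (2 * ‖z‖) := by gcongr; linarith
          _ = (2 * (C + ‖h 0‖)) * (1 + ‖z‖) ^ A * ‖z‖ := by ring
          _ ≤ _ := by gcongr; linarith)
    refine ⟨Polynomial.C (h 0) + Polynomial.X * p, fun z => ?_⟩
    simp only [Polynomial.eval_add, Polynomial.eval_C, Polynomial.eval_mul, Polynomial.eval_X]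
    rw [← hp z]
    have := sub_smul_dslope h 0 z
    simp only [sub_zero, smul_eq_mul] at this
    rw [this]; ring

lemma poly_of_offreal {h : ℂ → ℂ} (hd : Differentiable ℂ h) {C : ℝ} {A N : ℕ} (hC : 0 ≤ C)
    (hb : ∀ z : ℂ, z.im ≠ 0 → ‖h z‖ ≤ C * (1 + ‖z‖) ^ A / |z.im| ^ (N+1)) :
    ∃ p : Polynomial ℂ, ∀ z, h z = p.eval z := by
  set N1 := N + 1 with hN1
  refine poly_of_growth A h (C * 8 ^ N1 * 4 ^ A) hd (fun z => ?_)
  set R : ℝ := 2 * (1 + ‖z‖) with hR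
  have hR2 : 2 ≤ R := by linarith [norm_nonneg z]
  have hR0 : 0 < R := by linarith
  have hmax := Complex.norm_le_of_forall_mem_frontier_norm_le (U := Metric.ball 0 R) Metric.isBounded_ball
    (f := fun w => (w ^ 2 - (R:ℂ) ^ 2) ^ N1 * h w) (C := (2 * R) ^ N1 * (C * (1 + R) ^ A))
    (Differentiable.diffContOnCl (by fun_prop)) (fun w hw => by
      rw [frontier_ball _ hR0.ne', mem_sphere_zero_iff_norm] at hw
      rw [norm_mul, norm_pow]
      have hkey : ‖w ^ 2 - (R:ℂ) ^ 2‖ = 2 * R * |w.im| := by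
        have e : (R:ℂ) ^ 2 = w * (starRingEnd ℂ) w := by
          rw [Complex.mul_conj, Complex.normSq_eq_norm_sq, hw]; push_cast; ring
        have e2 : w ^ 2 - w * (starRingEnd ℂ) w = w * ((2 * w.im : ℝ) * I) := by
          rw [← Complex.sub_conj]; ring
        rw [e, e2, norm_mul, hw, norm_mul, Complex.norm_I, Complex.norm_real, Real.norm_eq_abs, abs_mul]
        norm_num; ring
      rw [hkey]
      by_cases him : w.im = 0
      · rw [him, abs_zero, mul_zero, zero_pow (by omega), zero_mul]; positivity
      · have h1 := hb w him
        rw [hw] at h1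
        have hp : 0 < |w.im| := abs_pos.2 him
        calc _ ≤ (2 * R * |w.im|) ^ N1 * (C * (1 + R) ^ A / |w.im| ^ N1) := by gcongr
          _ = _ := by rw [mul_pow (2 * R)]; field_simp)
    (z := z) (subset_closure (by rw [mem_ball_zero_iff]; linarith [norm_nonneg z]))
  simp only [norm_mul, norm_pow] at hmax
  have hlow : R ^ 2 / 2 ≤ ‖z ^ 2 - (R:ℂ) ^ 2‖ := by
    have h1 := norm_sub_norm_le ((R:ℂ)^2) (z^2)
    rw [norm_sub_rev, norm_pow, norm_pow, Complex.norm_real, Real.norm_eq_abs, abs_of_pos hR0] at h1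
    have : ‖z‖ ^ 2 ≤ (R/2) ^ 2 := by
      apply pow_le_pow_left₀ (norm_nonneg z); linarith
    nlinarith
  have h2 : (R ^ 2 / 2) ^ N1 * ‖h z‖ ≤ (2 * R) ^ N1 * (C * (1 + R) ^ A) :=
    le_trans (by gcongr) hmax
  have h3 : (2 * R) ^ N1 ≤ (R ^ 2 / 2) ^ N1 * 8 ^ N1 := by
    rw [← mul_pow]; apply pow_le_pow_left₀ (by positivity); nlinarith
  have h4 : (1 + R) ^ A ≤ 4 ^ A * (1 + ‖z‖) ^ A := by
    rw [← mul_pow]; gcongr; linarith [norm_nonneg z]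
  have hpos : 0 < (R ^ 2 / 2) ^ N1 := by positivity
  have h5 : (R ^ 2 / 2) ^ N1 * ‖h z‖ ≤ (R ^ 2 / 2) ^ N1 * (C * 8 ^ N1 * 4 ^ A * (1 + ‖z‖) ^ A) := by
    calc _ ≤ _ := h2
      _ ≤ ((R ^ 2 / 2) ^ N1 * 8 ^ N1) * (C * (4 ^ A * (1 + ‖z‖) ^ A)) := by gcongr
      _ = _ := by ring
  exact le_of_mul_le_mul_left h5 hpos

theorem mtilde_mtilde (h : ℂ → ℂ) : mtilde (mtilde h) = h := by
  funext z; simp [mtilde]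

theorem deriv_mtilde (h : ℂ → ℂ) : deriv (mtilde h) = mtilde (deriv h) :=
  deriv_conj_conj (f := h)

theorem analyticAt_mtilde {h : ℂ → ℂ} {z : ℂ} (hh : AnalyticAt ℂ h z) :
    AnalyticAt ℂ (mtilde h) (starRingEnd ℂ z) := by
  rw [Complex.analyticAt_iff_eventually_differentiableAt] at hh ⊢
  have hc : Tendsto (starRingEnd ℂ) (𝓝 (starRingEnd ℂ z)) (𝓝 z) := by
    have := Complex.continuous_conj.tendsto (starRingEnd ℂ z)
    simpa using this
  filter_upwards [hc.eventually hh] with w hw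
  have := hw.conj_conj
  rw [Complex.conj_conj] at this
  exact this

theorem tendsto_conj_ne (z : ℂ) :
    Tendsto (starRingEnd ℂ) (𝓝[≠] (starRingEnd ℂ z)) (𝓝[≠] z) := by
  apply tendsto_nhdsWithin_of_tendsto_nhds_of_eventually_within
  · have := Complex.continuous_conj.tendsto (starRingEnd ℂ z)
    simp only [Complex.conj_conj] at this
    exact this.mono_left nhdsWithin_le_nhds
  · filter_upwards [self_mem_nhdsWithin] with w hw hw2
    apply hw
    simp only [Set.mem_singleton_iff] at hw2 ⊢
    rw [← hw2]; simp

theorem meromorphicAt_mtilde {h : ℂ → ℂ} {z : ℂ} (hh : MeromorphicAt h z) :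
    MeromorphicAt (mtilde h) (starRingEnd ℂ z) := by
  obtain ⟨n, hn⟩ := hh
  refine ⟨n, ?_⟩
  have := analyticAt_mtilde hn
  have he : (mtilde fun z_1 => (z_1 - z) ^ n • h z_1) =
      fun w => (w - (starRingEnd ℂ) z) ^ n • mtilde h w := by
    funext w; simp [mtilde]
  rwa [he] at this

theorem order_mtilde_int {h : ℂ → ℂ} {z : ℂ} {n : ℤ} (hh : MeromorphicAt h z)
    (ho : meromorphicOrderAt h z = n) : meromorphicOrderAt (mtilde h) (starRingEnd ℂ z) = n := by
  obtain ⟨g, hg, hg0, he⟩ := (meromorphicOrderAt_eq_int_iff hh).1 ho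
  refine (meromorphicOrderAt_eq_int_iff (meromorphicAt_mtilde hh)).2 ⟨mtilde g,
    analyticAt_mtilde hg, by simpa [mtilde] using hg0, ?_⟩
  filter_upwards [(tendsto_conj_ne z).eventually he] with w hw
  simp [mtilde, hw]

theorem order_mtilde {h : ℂ → ℂ} {z : ℂ} (hh : MeromorphicAt h z) :
    meromorphicOrderAt (mtilde h) (starRingEnd ℂ z) = meromorphicOrderAt h z := by
  by_cases ht : meromorphicOrderAt h z = ⊤
  · rw [ht, meromorphicOrderAt_eq_top_iff]
    rw [meromorphicOrderAt_eq_top_iff] at ht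
    filter_upwards [(tendsto_conj_ne z).eventually ht] with w hw
    simp [mtilde, hw]
  · obtain ⟨n, hn⟩ := WithTop.ne_top_iff_exists.1 ht
    rw [← hn]
    exact order_mtilde_int hh hn.symm

theorem MeroEq.symm {a b : ℂ → ℂ} (h : MeroEq a b) : MeroEq b a := fun z => by
  filter_upwards [h z] with w hw using hw.symm
theorem MeroEq.rfl' {a : ℂ → ℂ} : MeroEq a a := fun z => by
  filter_upwards with w using rfl
theorem MeroEq.trans {a b c : ℂ → ℂ} (h : MeroEq a b) (h2 : MeroEq b c) : MeroEq a c := fun z => by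
  filter_upwards [h z, h2 z] with w hw hw2 using hw.trans hw2
theorem MeroEq.deriv {a b : ℂ → ℂ} (h : MeroEq a b) : MeroEq (deriv a) (deriv b) :=
  fun z => Filter.EventuallyEq.nhdsNE_deriv (h z)
theorem MeroEq.mtilde {a b : ℂ → ℂ} (h : MeroEq a b) : MeroEq (mtilde a) (mtilde b) := by
  intro z
  have := (tendsto_conj_ne (starRingEnd ℂ z))
  rw [Complex.conj_conj] at this
  filter_upwards [this.eventually (h (starRingEnd ℂ z))] with w hw
  simp [_root_.mtilde, hw]

theorem MeroEq.mero {a b : ℂ → ℂ} (h : MeroEq a b) (ha : ∀ z, MeromorphicAt a z) (z : ℂ) :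
    MeromorphicAt b z := (ha z).congr (h z)

theorem MeroEq.eq_of_cont {a b : ℂ → ℂ} (h : MeroEq a b) {z : ℂ} (ha : ContinuousAt a z)
    (hb : ContinuousAt b z) : a z = b z :=
  ((ha.eventuallyEq_nhds_iff_eventuallyEq_nhdsNE hb).1 (h z)).self_of_nhds

theorem eq_of_nhdsNE {a b : ℂ → ℂ} {z : ℂ} (h : a =ᶠ[𝓝[≠] z] b) (ha : ContinuousAt a z)
    (hb : ContinuousAt b z) : a =ᶠ[𝓝 z] b :=
  (ha.eventuallyEq_nhds_iff_eventuallyEq_nhdsNE hb).1 h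

/-- identity theorem -/
theorem mero_identity {a b : ℂ → ℂ} (ha : ∀ z, MeromorphicAt a z) (hb : ∀ z, MeromorphicAt b z)
    {z0 : ℂ} (h : a =ᶠ[𝓝[≠] z0] b) : MeroEq a b := by
  have hm : MeromorphicOn (a - b) Set.univ := fun z _ => (ha z).sub (hb z)
  have h0 : meromorphicOrderAt (a - b) z0 = ⊤ := by
    rw [meromorphicOrderAt_eq_top_iff]
    filter_upwards [h] with w hw
    simp [hw]
  intro z
  by_contra hz
  have hz2 : meromorphicOrderAt (a - b) z ≠ ⊤ := by
    intro ht
    rw [meromorphicOrderAt_eq_top_iff] at ht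
    apply hz
    filter_upwards [ht] with w hw
    simpa [sub_eq_zero] using hw
  exact hm.meromorphicOrderAt_ne_top_of_isPreconnected isPreconnected_univ
    (Set.mem_univ z) (Set.mem_univ z0) hz2 h0

theorem nz_of_order {a : ℂ → ℂ} (ha : ∀ z, MeromorphicAt a z) {z0 : ℂ}
    (h : meromorphicOrderAt a z0 ≠ ⊤) (z : ℂ) : meromorphicOrderAt a z ≠ ⊤ :=
  MeromorphicOn.meromorphicOrderAt_ne_top_of_isPreconnected (fun z _ => ha z) isPreconnected_univ
    (Set.mem_univ z0) (Set.mem_univ z) h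

theorem ratio_deriv {h v : ℂ → ℂ} {z : ℂ} {n : ℤ} (hh : MeromorphicAt h z)
    (ho : meromorphicOrderAt h z = n) (hv : AnalyticAt ℂ v z) (hv0 : v z = 0)
    (he : ∀ᶠ w in 𝓝[≠] z, h w = v w * deriv h w) : (n : ℂ) * deriv v z = 1 := by
  obtain ⟨G, hG, hG0, hGe⟩ := (meromorphicOrderAt_eq_int_iff hh).1 ho
  have hd : ∀ᶠ w in 𝓝[≠] z, deriv h w = n * (w - z) ^ (n - 1) * G w + (w - z) ^ n * deriv G w := by
    have h1 := Filter.EventuallyEq.nhdsNE_deriv (show h =ᶠ[𝓝[≠] z] fun w => (w - z) ^ n • G w from hGe)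
    have h2 := hG.eventually_analyticAt
    filter_upwards [h1, h2.filter_mono nhdsWithin_le_nhds, self_mem_nhdsWithin] with w hw hw2 hw3
    have hne : w - z ≠ 0 := sub_ne_zero.2 hw3
    rw [hw]
    have hz : HasDerivAt (fun w => (w - z) ^ n) (n * (w - z) ^ (n - 1)) w := by
      have := (hasDerivAt_zpow n (w - z) (Or.inl hne)).comp w ((hasDerivAt_id w).sub_const z)
      simpa [Function.comp_def] using this
    exact (hz.fun_mul hw2.differentiableAt.hasDerivAt).deriv
  have hs : ∀ᶠ w in 𝓝[≠] z, G w = dslope v z w * (n * G w + (w - z) * deriv G w) := by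
    filter_upwards [hd, hGe, he, self_mem_nhdsWithin] with w h1 h2 h3 h4
    have hne : w - z ≠ 0 := sub_ne_zero.2 h4
    rw [dslope_of_ne _ h4, slope_def_field, hv0, sub_zero]
    rw [h1, h2, smul_eq_mul, zpow_sub_one₀ hne] at h3
    have hzn : (w - z) ^ n ≠ 0 := zpow_ne_zero _ hne
    field_simp at h3 ⊢
    linear_combination h3
  have hc : ContinuousAt (dslope v z) z := continuousAt_dslope_same.2 hv.differentiableAt
  have := (eq_of_nhdsNE hs hG.continuousAt (by
    have := hG.continuousAt
    have := hG.deriv.continuousAt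
    fun_prop)).self_of_nhds
  beta_reduce at this
  rw [dslope_same, sub_self, zero_mul, add_zero] at this
  have h3 : G z * ((n : ℂ) * deriv v z) = G z * 1 := by linear_combination -this
  exact mul_left_cancel₀ hG0 h3

/-- The hypotheses on the sequence of derivatives. -/
structure Hyp (F : ℕ → ℂ → ℂ) : Prop where
  mero : ∀ m z, MeromorphicAt (F m) z
  der : ∀ m, F (m + 1) = deriv (F m)
  ord : ∀ m ≤ 10, ∀ z : ℂ, z.im ≠ 0 → meromorphicOrderAt (F m) z ≤ 0

/-- conjugated sequence -/
def cj (F : ℕ → ℂ → ℂ) : ℕ → ℂ → ℂ := fun m => mtilde (F m)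

theorem Hyp.tl {F : ℕ → ℂ → ℂ} (h : Hyp F) : Hyp (cj F) where
  mero m z := by
    have := meromorphicAt_mtilde (h.mero m (starRingEnd ℂ z))
    rwa [Complex.conj_conj] at this
  der m := by
    show mtilde (F (m+1)) = _
    rw [h.der m, ← deriv_mtilde]; rfl
  ord m hm z hz := by
    have := order_mtilde (h.mero m (starRingEnd ℂ z))
    rw [Complex.conj_conj] at this
    show meromorphicOrderAt (mtilde (F m)) z ≤ 0
    rw [this]
    apply h.ord m hm
    simpa using hz

theorem cj_cj (F : ℕ → ℂ → ℂ) : cj (cj F) = F := by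
  funext m; exact mtilde_mtilde _

theorem Hyp.fin {F : ℕ → ℂ → ℂ} (h : Hyp F) {m : ℕ} (hm : m ≤ 10) (z : ℂ) :
    meromorphicOrderAt (F m) z ≠ ⊤ := by
  apply nz_of_order (h.mero m) (z0 := I)
  intro ht
  have := h.ord m hm I (by simp)
  rw [ht] at this
  simp at this

theorem Hyp.nz {F : ℕ → ℂ → ℂ} (h : Hyp F) {m : ℕ} (hm : m ≤ 10) (z : ℂ) :
    ∀ᶠ w in 𝓝[≠] z, F m w ≠ 0 :=
  (meromorphicOrderAt_ne_top_iff_eventually_ne_zero (h.mero m z)).1 (h.fin hm z)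

theorem order_deriv_nonneg {a : ℂ → ℂ} {z : ℂ} (ha : MeromorphicAt a z)
    (h : meromorphicOrderAt a z = 0) : 0 ≤ meromorphicOrderAt (deriv a) z := by
  obtain ⟨g, hg, hg0, he⟩ := (meromorphicOrderAt_eq_int_iff (n := 0) ha).1 (by simpa using h)
  have he2 : a =ᶠ[𝓝[≠] z] g := by
    filter_upwards [he] with w hw; simpa using hw
  rw [meromorphicOrderAt_congr he2.nhdsNE_deriv]
  exact hg.deriv.meromorphicOrderAt_nonneg

theorem Hyp.cases {F : ℕ → ℂ → ℂ} (h : Hyp F) {m : ℕ} (hm : m ≤ 9) {z : ℂ} (hz : z.im ≠ 0) :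
    (∃ n : ℤ, n < 0 ∧ meromorphicOrderAt (F m) z = n ∧
      meromorphicOrderAt (F (m+1)) z = ((n - 1 : ℤ) : WithTop ℤ)) ∨
    (meromorphicOrderAt (F m) z = 0 ∧ meromorphicOrderAt (F (m+1)) z = 0) := by
  obtain ⟨n, hn⟩ := WithTop.ne_top_iff_exists.1 (h.fin (show m ≤ 10 by omega) z)
  have h1 := h.ord m (by omega) z hz
  rw [← hn] at h1
  have h2 : n ≤ 0 := by exact_mod_cast h1
  rcases h2.lt_or_eq with h3 | h3
  · left
    refine ⟨n, h3, hn.symm, ?_⟩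
    rw [h.der m]
    refine meromorphicOrderAt_deriv_eq_sub_one ?_ hn.symm
    simpa using h3.ne
  · right
    have h4 : meromorphicOrderAt (F m) z = 0 := by rw [← hn, h3]; rfl
    refine ⟨h4, le_antisymm (h.ord _ (by omega) z hz) ?_⟩
    rw [h.der m]
    exact order_deriv_nonneg (h.mero m z) h4

noncomputable def vv (F : ℕ → ℂ → ℂ) (m : ℕ) : ℂ → ℂ :=
  toMeromorphicNFOn (F m / F (m+1)) Set.univ

noncomputable def uu (F : ℕ → ℂ → ℂ) (m : ℕ) : ℂ → ℂ :=
  F m * F (m+2) / (F (m+1) * F (m+1))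

theorem Hyp.uu_mero {F : ℕ → ℂ → ℂ} (h : Hyp F) (m : ℕ) (z : ℂ) : MeromorphicAt (uu F m) z :=
  ((h.mero m z).mul (h.mero (m+2) z)).div ((h.mero (m+1) z).mul (h.mero (m+1) z))

theorem Hyp.vv_mero0 {F : ℕ → ℂ → ℂ} (h : Hyp F) (m : ℕ) :
    MeromorphicOn (F m / F (m+1)) Set.univ := fun z _ => (h.mero m z).div (h.mero _ z)

theorem Hyp.vv_eq {F : ℕ → ℂ → ℂ} (h : Hyp F) (m : ℕ) (z : ℂ) :
    vv F m =ᶠ[𝓝[≠] z] F m / F (m+1) :=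
  (h.vv_mero0 m).toMeromorphicNFOn_eq_self_on_nhdsNE (Set.mem_univ z)

theorem Hyp.vv_mero {F : ℕ → ℂ → ℂ} (h : Hyp F) (m : ℕ) (z : ℂ) : MeromorphicAt (vv F m) z :=
  (h.vv_mero0 m z (Set.mem_univ z)).congr (h.vv_eq m z).symm

theorem Hyp.vv_an {F : ℕ → ℂ → ℂ} (h : Hyp F) {m : ℕ} (hm : m ≤ 9) {z : ℂ} (hz : z.im ≠ 0) :
    AnalyticAt ℂ (vv F m) z := by
  have hn := meromorphicNFOn_toMeromorphicNFOn (F m / F (m+1)) Set.univ (Set.mem_univ z)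
  refine hn.meromorphicOrderAt_nonneg_iff_analyticAt.1 ?_
  rw [meromorphicOrderAt_toMeromorphicNFOn (h.vv_mero0 m) (Set.mem_univ z),
    meromorphicOrderAt_div (h.mero m z) (h.mero _ z)]
  rcases h.cases hm hz with ⟨n, hn, h1, h2⟩ | ⟨h1, h2⟩
  · rw [h1, h2]
    have : ((n : ℤ) : WithTop ℤ) - ((n - 1 : ℤ) : WithTop ℤ) = ((1 : ℤ) : WithTop ℤ) := by
      rw [← WithTop.LinearOrderedAddCommGroup.coe_sub]; congr 1; ring
    rw [this]; exact_mod_cast (by norm_num : (0:ℤ) ≤ 1)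
  · rw [h1, h2]; simp

theorem Hyp.uu_ord {F : ℕ → ℂ → ℂ} (h : Hyp F) {m : ℕ} (hm : m ≤ 8) {z : ℂ} (hz : z.im ≠ 0) :
    meromorphicOrderAt (uu F m) z = 0 := by
  unfold uu
  rw [meromorphicOrderAt_div ((h.mero m z).mul (h.mero (m+2) z)) ((h.mero (m+1) z).mul (h.mero (m+1) z)),
    meromorphicOrderAt_mul (h.mero m z) (h.mero _ z), meromorphicOrderAt_mul (h.mero _ z) (h.mero _ z)]
  rcases h.cases (m := m) (by omega) hz with ⟨n, hn, h1, h2⟩ | ⟨h1, h2⟩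
  · rcases h.cases (m := m+1) (by omega) hz with ⟨n', hn', h3, h4⟩ | ⟨h3, h4⟩
    · have : n' = n - 1 := by rw [h2] at h3; exact_mod_cast h3.symm
      subst this
      rw [h1, h2, show m + 2 = m + 1 + 1 from rfl, h4]
      have : ((n : ℤ) : WithTop ℤ) + ((n - 1 - 1 : ℤ) : WithTop ℤ) -
        (((n - 1 : ℤ) : WithTop ℤ) + ((n - 1 : ℤ) : WithTop ℤ)) = ((0 : ℤ) : WithTop ℤ) := by
        rw [← WithTop.coe_add, ← WithTop.coe_add, ← WithTop.LinearOrderedAddCommGroup.coe_sub]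
        congr 1; ring
      exact this
    · rw [h2] at h3
      have : n - 1 = 0 := by exact_mod_cast h3
      omega
  · rcases h.cases (m := m+1) (by omega) hz with ⟨n', hn', h3, h4⟩ | ⟨h3, h4⟩
    · rw [h2] at h3
      have : n' = 0 := by exact_mod_cast h3.symm
      omega
    · rw [h1, h2, show m + 2 = m + 1 + 1 from rfl, h4]; simp

theorem Hyp.vv_deriv {F : ℕ → ℂ → ℂ} (h : Hyp F) {m : ℕ} (hm : m ≤ 8) (z : ℂ) :
    ∀ᶠ w in 𝓝[≠] z, 1 - deriv (vv F m) w = uu F m w := by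
  filter_upwards [(h.vv_eq m z).nhdsNE_deriv, h.nz (m := m+1) (by omega) z,
    (h.mero m z).eventually_analyticAt, (h.mero (m+1) z).eventually_analyticAt] with w h1 h2 h3 h4
  rw [h1]
  have h5 := h3.differentiableAt.hasDerivAt.div h4.differentiableAt.hasDerivAt h2
  rw [← h.der m, ← h.der (m+1)] at h5
  rw [h5.deriv]
  simp only [uu, Pi.mul_apply, Pi.div_apply]
  field_simp
  ring

theorem Hyp.uu_val {F : ℕ → ℂ → ℂ} (h : Hyp F) {m : ℕ} (hm : m ≤ 8) {z : ℂ} (hz : z.im ≠ 0) :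
    1 - deriv (vv F m) z ≠ 0 := by
  have ha : AnalyticAt ℂ (fun w => 1 - deriv (vv F m) w) z :=
    analyticAt_const.fun_sub (h.vv_an (by omega) hz).deriv
  refine (ha.meromorphicNFAt.meromorphicOrderAt_eq_zero_iff).1 ?_
  rw [meromorphicOrderAt_congr (h.vv_deriv hm z)]
  exact h.uu_ord hm hz

theorem Hyp.vv_rel {F : ℕ → ℂ → ℂ} (h : Hyp F) {m : ℕ} (hm : m ≤ 8) {z : ℂ} (hz : z.im ≠ 0) :
    vv F (m+1) z * (1 - deriv (vv F m) z) = vv F m z := by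
  have ha := h.vv_an (m := m) (by omega) hz
  have hb := h.vv_an (m := m+1) (by omega) hz
  have he : (fun w => vv F (m+1) w * (1 - deriv (vv F m) w)) =ᶠ[𝓝[≠] z] vv F m := by
    filter_upwards [h.vv_deriv hm z, h.vv_eq m z, h.vv_eq (m+1) z, h.nz (m := m+1) (by omega) z,
      h.nz (m := m+2) (by omega) z] with w h1 h2 h3 h4 h5
    rw [h1, h2, h3]
    simp only [uu, Pi.mul_apply, Pi.div_apply, show m + 1 + 1 = m + 2 from rfl]
    field_simp
  exact (eq_of_nhdsNE he (hb.fun_mul (analyticAt_const.fun_sub ha.deriv)).continuousAt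
    ha.continuousAt).self_of_nhds

theorem Hyp.vv_zero {F : ℕ → ℂ → ℂ} (h : Hyp F) {m : ℕ} (hm : m ≤ 9) {z : ℂ} (hz : z.im ≠ 0)
    (h0 : vv F m z = 0) : ‖deriv (vv F m) z‖ ≤ 1 := by
  obtain ⟨n, hn⟩ := WithTop.ne_top_iff_exists.1 (h.fin (show m ≤ 10 by omega) z)
  have he : ∀ᶠ w in 𝓝[≠] z, F m w = vv F m w * deriv (F m) w := by
    filter_upwards [h.vv_eq m z, h.nz (m := m+1) (by omega) z] with w h1 h2
    rw [h1, ← h.der m]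
    simp only [Pi.div_apply]
    field_simp
  have := ratio_deriv (h.mero m z) hn.symm (h.vv_an hm hz) h0 he
  have h1 := congrArg norm this
  rw [norm_mul, norm_one] at h1
  have hn0 : n ≠ 0 := by rintro rfl; simp at this
  have hn1 : (1:ℝ) ≤ ‖(n : ℂ)‖ := by
    rw [Complex.norm_intCast]; exact_mod_cast Int.one_le_abs hn0
  nlinarith [norm_nonneg (deriv (vv F m) z)]

theorem Hyp.tower {F : ℕ → ℂ → ℂ} (h : Hyp F) {m : ℕ} (hm : m ≤ 7) :
    WCls (vv F m) (vv F (m+1)) UH where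
  dv := fun z hz => (h.vv_an (by omega) (ne_of_gt hz)).differentiableAt.differentiableWithinAt
  dv1 := fun z hz => (h.vv_an (by omega) (ne_of_gt hz)).differentiableAt.differentiableWithinAt
  h1 := fun z hz e => h.uu_val (m := m) (by omega) (ne_of_gt hz) (by rw [e]; ring)
  h2 := fun z hz e => h.uu_val (m := m+1) (by omega) (ne_of_gt hz) (by rw [e]; ring)
  rel := fun z hz => h.vv_rel (by omega) (ne_of_gt hz)
  h0 := fun z hz e => h.vv_zero (by omega) (ne_of_gt hz) e

noncomputable def KK (F : ℕ → ℂ → ℂ) (m : ℕ) : ℂ → ℂ :=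
  toMeromorphicNFOn (uu F m / uu (cj F) m) Set.univ

theorem mtilde_uu (F : ℕ → ℂ → ℂ) (m : ℕ) : mtilde (uu F m) = uu (cj F) m := by
  funext z
  simp [mtilde, uu, cj]

theorem Hyp.uu_fin {F : ℕ → ℂ → ℂ} (h : Hyp F) {m : ℕ} (hm : m ≤ 8) (z : ℂ) :
    meromorphicOrderAt (uu F m) z ≠ ⊤ := by
  apply nz_of_order (h.uu_mero m) (z0 := I)
  rw [h.uu_ord hm (by simp)]; simp

theorem Hyp.uu_nz {F : ℕ → ℂ → ℂ} (h : Hyp F) {m : ℕ} (hm : m ≤ 8) (z : ℂ) :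
    ∀ᶠ w in 𝓝[≠] z, uu F m w ≠ 0 :=
  (meromorphicOrderAt_ne_top_iff_eventually_ne_zero (h.uu_mero m z)).1 (h.uu_fin hm z)

theorem Hyp.KK_mero0 {F : ℕ → ℂ → ℂ} (h : Hyp F) (m : ℕ) :
    MeromorphicOn (uu F m / uu (cj F) m) Set.univ :=
  fun z _ => (h.uu_mero m z).div (h.tl.uu_mero m z)

theorem Hyp.KK_eq {F : ℕ → ℂ → ℂ} (h : Hyp F) (m : ℕ) (z : ℂ) :
    KK F m =ᶠ[𝓝[≠] z] uu F m / uu (cj F) m :=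
  (h.KK_mero0 m).toMeromorphicNFOn_eq_self_on_nhdsNE (Set.mem_univ z)

theorem Hyp.KK_ord {F : ℕ → ℂ → ℂ} (h : Hyp F) {m : ℕ} (hm : m ≤ 8) (z : ℂ) :
    meromorphicOrderAt (KK F m) z = 0 := by
  unfold KK
  rw [meromorphicOrderAt_toMeromorphicNFOn (h.KK_mero0 m) (Set.mem_univ z),
    meromorphicOrderAt_div (h.uu_mero m z) (h.tl.uu_mero m z)]
  by_cases hz : z.im = 0
  · have h1 := order_mtilde (h.uu_mero m z)
    rw [mtilde_uu, Complex.conj_eq_iff_im.2 hz] at h1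
    rw [h1]
    obtain ⟨n, hn⟩ := WithTop.ne_top_iff_exists.1 (h.uu_fin hm z)
    rw [← hn, ← WithTop.LinearOrderedAddCommGroup.coe_sub, sub_self]; rfl
  · rw [h.uu_ord hm hz, h.tl.uu_ord hm hz]; simp

theorem Hyp.KK_ne {F : ℕ → ℂ → ℂ} (h : Hyp F) {m : ℕ} (hm : m ≤ 8) (z : ℂ) : KK F m z ≠ 0 :=
  ((meromorphicNFOn_toMeromorphicNFOn _ _ (Set.mem_univ z)).meromorphicOrderAt_eq_zero_iff).1
    (h.KK_ord hm z)

theorem Hyp.KK_an {F : ℕ → ℂ → ℂ} (h : Hyp F) {m : ℕ} (hm : m ≤ 8) (z : ℂ) :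
    AnalyticAt ℂ (KK F m) z :=
  ((meromorphicNFOn_toMeromorphicNFOn _ _ (Set.mem_univ z)).meromorphicOrderAt_nonneg_iff_analyticAt).1
    (h.KK_ord hm z).ge

theorem Hyp.KK_rel {F : ℕ → ℂ → ℂ} (h : Hyp F) {m : ℕ} (hm : m ≤ 8) {z : ℂ} (hz : z.im ≠ 0) :
    1 - deriv (vv F m) z = KK F m z * (1 - deriv (vv (cj F) m) z) := by
  have ha := h.vv_an (m := m) (by omega) hz
  have hb := h.tl.vv_an (m := m) (by omega) hz
  have he : (fun w => 1 - deriv (vv F m) w) =ᶠ[𝓝[≠] z]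
      fun w => KK F m w * (1 - deriv (vv (cj F) m) w) := by
    filter_upwards [h.vv_deriv hm z, h.tl.vv_deriv hm z, h.KK_eq m z, h.tl.uu_nz hm z]
      with w h1 h2 h3 h4
    rw [h1, h2, h3]
    simp only [Pi.div_apply]
    field_simp
  exact (eq_of_nhdsNE he (analyticAt_const.fun_sub ha.deriv).continuousAt
    ((h.KK_an hm z).fun_mul (analyticAt_const.fun_sub hb.deriv)).continuousAt).self_of_nhds

theorem Hyp.KK_conj {F : ℕ → ℂ → ℂ} (h : Hyp F) {m : ℕ} (hm : m ≤ 8) (z : ℂ) :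
    KK F m z * mtilde (KK F m) z = 1 := by
  have h1 : MeroEq (mtilde (KK F m)) (mtilde (uu F m / uu (cj F) m)) :=
    MeroEq.mtilde (h.KK_eq m)
  have h2 : mtilde (uu F m / uu (cj F) m) = uu (cj F) m / uu F m := by
    have e1 := mtilde_uu F m
    have e2 := mtilde_uu (cj F) m
    rw [cj_cj] at e2
    funext w
    have e3 := congrFun e1 w
    have e4 := congrFun e2 w
    simp only [mtilde] at e3 e4
    simp [mtilde, e3, e4]
  rw [h2] at h1
  have ha : AnalyticAt ℂ (mtilde (KK F m)) z := by
    have := analyticAt_mtilde (h.KK_an hm (starRingEnd ℂ z))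
    rwa [Complex.conj_conj] at this
  have he : MeroEq (fun w => KK F m w * mtilde (KK F m) w) (fun _ => 1) := by
    intro z
    filter_upwards [h1 z, h.KK_eq m z, h.uu_nz hm z, h.tl.uu_nz hm z] with w a1 a2 a3 a4
    rw [a1, a2]
    simp only [Pi.div_apply]
    field_simp
  exact he.eq_of_cont ((h.KK_an hm z).fun_mul ha).continuousAt continuousAt_const

/-- logarithmic derivative of `KK` -/
noncomputable def kd (F : ℕ → ℂ → ℂ) (m : ℕ) : ℂ → ℂ := fun z => deriv (KK F m) z / KK F m z

theorem Hyp.kd_diff {F : ℕ → ℂ → ℂ} (h : Hyp F) {m : ℕ} (hm : m ≤ 8) : Differentiable ℂ (kd F m) :=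
  fun z => ((h.KK_an hm z).deriv.differentiableAt).fun_div (h.KK_an hm z).differentiableAt (h.KK_ne hm z)

theorem Hyp.kd_lam {F : ℕ → ℂ → ℂ} (h : Hyp F) {m : ℕ} (hm : m ≤ 8) {z : ℂ} (hz : z.im ≠ 0) :
    kd F m z = lam (vv F m) z - lam (vv (cj F) m) z := by
  have ho : IsOpen {z : ℂ | z.im ≠ 0} := isOpen_ne_fun Complex.continuous_im continuous_const
  have he : (fun w => 1 - deriv (vv F m) w) =ᶠ[𝓝 z]
      fun w => KK F m w * (1 - deriv (vv (cj F) m) w) := by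
    filter_upwards [ho.mem_nhds hz] with w hw using h.KK_rel hm hw
  have ha := (h.vv_an (m := m) (by omega) hz).deriv.differentiableAt.hasDerivAt
  have hb := (h.tl.vv_an (m := m) (by omega) hz).deriv.differentiableAt.hasDerivAt
  have hk := (h.KK_an hm z).differentiableAt.hasDerivAt
  have h1 := (hk.fun_mul (hb.const_sub 1)).unique (he.hasDerivAt_iff.1 (ha.const_sub 1))
  have n1 := h.uu_val hm hz
  have n2 := h.tl.uu_val hm hz
  have n3 := h.KK_ne hm z
  have h2 := h.KK_rel hm hz
  unfold kd lam
  have e : -deriv (deriv (vv F m)) z / (1 - deriv (vv F m) z) =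
     -deriv (deriv (vv F m)) z / (KK F m z * (1 - deriv (vv (cj F) m) z)) := by rw [← h2]
  rw [e, ← h1]
  field_simp
  ring

theorem Hyp.kd_conj {F : ℕ → ℂ → ℂ} (h : Hyp F) {m : ℕ} (hm : m ≤ 8) (z : ℂ) :
    kd F m z = - mtilde (kd F m) z := by
  have ha : AnalyticAt ℂ (mtilde (KK F m)) z := by
    have := analyticAt_mtilde (h.KK_an hm (starRingEnd ℂ z))
    rwa [Complex.conj_conj] at this
  have h1 := (h.KK_an hm z).differentiableAt.hasDerivAt.fun_mul ha.differentiableAt.hasDerivAt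
  have h2 : (fun w => KK F m w * mtilde (KK F m) w) = fun _ => 1 := funext (h.KK_conj hm)
  rw [h2] at h1
  have h3 := h1.unique (hasDerivAt_const z (1:ℂ))
  have n1 := h.KK_ne hm z
  have n2 : mtilde (KK F m) z ≠ 0 := by
    have := h.KK_ne hm (starRingEnd ℂ z)
    simpa [mtilde] using this
  have e : mtilde (kd F m) z = deriv (mtilde (KK F m)) z / mtilde (KK F m) z := by
    rw [deriv_mtilde]; simp [mtilde, kd]
  rw [e]
  unfold kd
  field_simp
  linear_combination h3

theorem Hyp.kd_poly {F : ℕ → ℂ → ℂ} (h : Hyp F) {m : ℕ} (hm : m ≤ 7) :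
    ∃ p : Polynomial ℂ, ∀ z, kd F m z = p.eval z := by
  obtain ⟨C1, A1, hC1, h1⟩ := lam_poly (h.tower hm)
  obtain ⟨C2, A2, hC2, h2⟩ := lam_poly (h.tl.tower hm)
  have aux : ∀ A B : ℕ, A ≤ B → ∀ z : ℂ, 0 < z.im →
      (1 + ‖z‖) ^ (2*A) / z.im ^ (A+1) ≤ (1 + ‖z‖) ^ (2*B) / z.im ^ (B+1) := by
    intro A B hAB z hz
    obtain ⟨k, rfl⟩ := Nat.exists_eq_add_of_le hAB
    rw [div_le_div_iff₀ (by positivity) (by positivity)]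
    have hy : z.im ≤ (1 + ‖z‖)^2 := by
      have := (le_abs_self _).trans (Complex.abs_im_le_norm z)
      nlinarith [norm_nonneg z]
    have : z.im ^ k ≤ ((1 + ‖z‖)^2)^k := pow_le_pow_left₀ hz.le hy k
    calc (1 + ‖z‖) ^ (2*A) * z.im ^ (A + k + 1) = (1 + ‖z‖) ^ (2*A) * z.im ^ (A + 1) * z.im ^ k := by ring
      _ ≤ (1 + ‖z‖) ^ (2*A) * z.im ^ (A + 1) * ((1 + ‖z‖)^2)^k :=
        mul_le_mul_of_nonneg_left this (by positivity)
      _ = _ := by rw [← pow_mul]; ring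
  have key : ∀ z : ℂ, 0 < z.im → ‖kd F m z‖ ≤
      (C1 + C2) * ((1 + ‖z‖) ^ (2*(max A1 A2)) / z.im ^ (max A1 A2+1)) := by
    intro z hz
    rw [h.kd_lam (by omega) (ne_of_gt hz)]
    refine (norm_sub_le _ _).trans ?_
    have b1 := mul_le_mul_of_nonneg_left (aux A1 _ (le_max_left A1 A2) z hz) hC1
    have b2 := mul_le_mul_of_nonneg_left (aux A2 _ (le_max_right A1 A2) z hz) hC2
    have c1 := h1 z hz
    have c2 := h2 z hz
    rw [mul_div_assoc] at c1 c2
    linarith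
  refine poly_of_offreal (h.kd_diff (by omega)) (add_nonneg hC1 hC2) (A := 2*(max A1 A2))
    (N := max A1 A2) ?_
  intro z hz
  rw [mul_div_assoc]
  rcases lt_or_gt_of_ne hz with hz | hz
  · have := key (starRingEnd ℂ z) (by simpa using hz)
    rw [h.kd_conj (by omega), norm_neg]
    simp only [mtilde, Complex.norm_conj] at this ⊢
    rw [abs_of_neg hz]
    simpa using this
  · rw [abs_of_pos hz]
    exact key z hz

theorem poly_big {p : Polynomial ℂ} (hp : p ≠ 0) (C : ℝ) :
    ∀ᶠ y : ℝ in atTop, C < y * ‖p.eval ((y:ℂ) * I)‖ := by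
  by_cases hd : 0 < p.degree
  · have h1 : Tendsto (fun y : ℝ => ‖(y:ℂ) * I‖) atTop atTop := by
      simp only [norm_mul, Complex.norm_I, mul_one, Complex.norm_real]
      exact tendsto_norm_atTop_atTop
    have h2 := p.tendsto_norm_atTop hd h1
    filter_upwards [h2.eventually_ge_atTop 1, eventually_gt_atTop (max C 0)] with y a b
    have := le_max_left C 0
    have := le_max_right C 0
    nlinarith
  · have h1 := Polynomial.eq_C_of_degree_le_zero (not_lt.1 hd)
    have hc : p.coeff 0 ≠ 0 := by
      intro h; rw [h] at h1; simp at h1; exact hp h1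
    have : ∀ z, p.eval z = p.coeff 0 := by intro z; rw [h1]; simp
    simp only [this]
    have hpos : 0 < ‖p.coeff 0‖ := norm_pos_iff.2 hc
    filter_upwards [eventually_gt_atTop (C / ‖p.coeff 0‖)] with y hy
    rwa [div_lt_iff₀ hpos] at hy

theorem Hyp.two_const {F : ℕ → ℂ → ℂ} (h : Hyp F) :
    ∃ s ≤ 6, (∀ z, kd F s z = 0) ∧ (∀ z, kd F (s+1) z = 0) := by
  obtain ⟨C1, h1⟩ := c2_UH (v := vv F) (fun m hm => h.tower hm)
  obtain ⟨C2, h2⟩ := c2_UH (v := vv (cj F)) (fun m hm => h.tl.tower hm)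
  have hp : ∀ m : ℕ, ∃ p : Polynomial ℂ, m ≤ 7 → ∀ z, kd F m z = p.eval z := by
    intro m
    by_cases hm : m ≤ 7
    · obtain ⟨p, hp⟩ := h.kd_poly hm
      exact ⟨p, fun _ => hp⟩
    · exact ⟨0, fun h => absurd h hm⟩
  choose p hp using hp
  have hev : ∀ᶠ y : ℝ in atTop, ∀ m : Fin 8, p m ≠ 0 → C1 + C2 < y * ‖(p m).eval ((y:ℂ) * I)‖ := by
    rw [eventually_all]
    intro m
    by_cases hm : p m = 0
    · filter_upwards with y hy using absurd hm hy
    · filter_upwards [poly_big hm (C1 + C2)] with y hy _ using hy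
  obtain ⟨y, hy, hy0⟩ := (hev.and (eventually_gt_atTop 0)).exists
  have him : ((y:ℂ) * I).im = y := by simp
  obtain ⟨j, hj⟩ := h1 ((y:ℂ) * I) (by rw [him]; exact hy0)
  obtain ⟨l, hl⟩ := h2 ((y:ℂ) * I) (by rw [him]; exact hy0)
  rw [him] at hj hl
  have key : ∀ m ≤ 7, p m ≠ 0 → (m + 1 = j ∨ m + 2 = j) ∨ (m + 1 = l ∨ m + 2 = l) := by
    intro m hm hne
    have a := hy ⟨m, by omega⟩ hne
    simp only at a
    rw [← hp m hm, h.kd_lam (by omega) (by rw [him]; exact hy0.ne')] at a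
    by_contra hcon
    push Not at hcon
    have b1 : ¬ C1 < y * ‖lam (vv F m) (y * I)‖ := fun hh => by
      rcases hj m hm hh with h | h
      · exact hcon.1.1 h
      · exact hcon.1.2 h
    have b2 : ¬ C2 < y * ‖lam (vv (cj F) m) (y * I)‖ := fun hh => by
      rcases hl m hm hh with h | h
      · exact hcon.2.1 h
      · exact hcon.2.2 h
    have b3 := mul_le_mul_of_nonneg_left (norm_sub_le (lam (vv F m) (y * I)) (lam (vv (cj F) m) (y * I))) hy0.le
    linarith
  by_contra hcon
  push Not at hcon
  have aux : ∀ s ≤ 6, (s + 1 ≤ j ∧ j ≤ s + 3) ∨ (s + 1 ≤ l ∧ l ≤ s + 3) := by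
    intro s hs
    by_cases h0 : p s = 0
    · by_cases h00 : p (s+1) = 0
      · obtain ⟨z, hz⟩ := hcon s hs (fun z => by rw [hp s (by omega), h0]; simp)
        exact absurd (by rw [hp (s+1) (by omega), h00]; simp) hz
      · have := key (s+1) (by omega) h00
        omega
    · have := key s (by omega) h0
      omega
  have a0 := aux 0 (by omega)
  have a3 := aux 3 (by omega)
  have a6 := aux 6 (by omega)
  omega

theorem Hyp.KK_const {F : ℕ → ℂ → ℂ} (h : Hyp F) {m : ℕ} (hm : m ≤ 8) (hk : ∀ z, kd F m z = 0)
    (z : ℂ) : KK F m z = KK F m 0 := by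
  apply is_const_of_deriv_eq_zero (fun z => (h.KK_an hm z).differentiableAt)
  intro z
  have := hk z
  unfold kd at this
  rcases div_eq_zero_iff.1 this with h1 | h1
  · exact h1
  · exact absurd h1 (h.KK_ne hm z)

theorem UH_preconn : IsPreconnected UH := (convex_halfSpace_im_gt 0).isPreconnected

/-- equality up to a constant on the upper half plane -/
theorem UH_const {a b a' : ℂ → ℂ} (ha : ∀ z ∈ UH, HasDerivAt a (a' z) z)
    (hb : ∀ z ∈ UH, HasDerivAt b (a' z) z) : ∃ c : ℂ, ∀ z ∈ UH, a z = b z + c := by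
  have hI : I ∈ UH := by simp [UH]
  refine ⟨a I - b I, fun z hz => ?_⟩
  have hd : ∀ z ∈ UH, HasDerivAt (fun z => a z - b z) 0 z := by
    intro z hz
    simpa using (ha z hz).fun_sub (hb z hz)
  have := isOpen_UH.is_const_of_deriv_eq_zero UH_preconn (f := fun z => a z - b z)
    (fun z hz => (hd z hz).differentiableAt.differentiableWithinAt)
    (fun z hz => (hd z hz).deriv) hz hI
  linear_combination this

theorem mero_const {h : ℂ → ℂ} (hm : ∀ z, MeromorphicAt h z) (hd : MeroEq (deriv h) (fun _ => 0)) :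
    ∃ c : ℂ, MeroEq h (fun _ => c) := by
  obtain ⟨z0, h1, h2⟩ := ((hm 0).eventually_analyticAt.and (hd 0)).exists
  have hc : deriv h =ᶠ[𝓝 z0] fun _ => 0 :=
    eq_of_nhdsNE (hd z0) h1.deriv.continuousAt continuousAt_const
  obtain ⟨r, hr, hb⟩ := Metric.eventually_nhds_iff_ball.1 (hc.and h1.eventually_analyticAt)
  refine ⟨h z0, mero_identity hm (fun z => MeromorphicAt.const _ z) (z0 := z0) ?_⟩
  apply Filter.Eventually.filter_mono nhdsWithin_le_nhds
  filter_upwards [Metric.ball_mem_nhds z0 hr] with w hw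
  exact Metric.isOpen_ball.is_const_of_deriv_eq_zero (convex_ball z0 r).isPreconnected
    (fun z hz => (hb z hz).2.differentiableAt.differentiableWithinAt) (fun z hz => (hb z hz).1) hw
    (Metric.mem_ball_self hr)

/-- proportionality of meromorphic functions with the same logarithmic derivative -/
theorem mero_prop {a b : ℂ → ℂ} (ha : ∀ z, MeromorphicAt a z) (hb : ∀ z, MeromorphicAt b z)
    (hb0 : ∀ z, ∀ᶠ w in 𝓝[≠] z, b w ≠ 0)
    (he : MeroEq (fun z => deriv a z * b z) (fun z => a z * deriv b z)) :
    ∃ c : ℂ, MeroEq a (fun z => c * b z) := by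
  obtain ⟨c, hc⟩ := mero_const (h := a / b) (fun z => (ha z).div (hb z)) (by
    intro z
    filter_upwards [he z, hb0 z, (ha z).eventually_analyticAt, (hb z).eventually_analyticAt]
      with w h1 h2 h3 h4
    have := h3.differentiableAt.hasDerivAt.div h4.differentiableAt.hasDerivAt h2
    rw [this.deriv, h1]; simp)
  refine ⟨c, fun z => ?_⟩
  filter_upwards [hc z, hb0 z] with w h1 h2
  rw [← h1]; simp only [Pi.div_apply]; field_simp

/-- The form of `F s / F (s+1)`. -/
theorem Hyp.ode {F : ℕ → ℂ → ℂ} (h : Hyp F) :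
    ∃ s ≤ 6, (∃ c : ℂ, MeroEq (mtilde (F (s+1))) (fun z => c * F (s+1) z)) ∨
      ∃ n1 n0 q2 q1 q0 : ℂ, ((n1 = 1) ∨ (n1 = 0 ∧ n0 = 1)) ∧
        MeroEq (fun z => (n1 * z + n0) * F s z) (fun z => (q2 * z^2 + q1 * z + q0) * F (s+1) z) := by
  obtain ⟨s, hs, k0, k1⟩ := h.two_const
  refine ⟨s, hs, ?_⟩
  have K0 := h.KK_const (by omega) k0
  have K1 := h.KK_const (by omega) k1
  set κ0 := KK F s 0
  set κ1 := KK F (s+1) 0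
  have him : ∀ z ∈ UH, z.im ≠ 0 := fun z hz => ne_of_gt hz
  have dv : ∀ m ≤ 9, ∀ z ∈ UH, HasDerivAt (vv F m) (deriv (vv F m) z) z :=
    fun m hm z hz => (h.vv_an hm (him z hz)).differentiableAt.hasDerivAt
  have dw : ∀ m ≤ 9, ∀ z ∈ UH, HasDerivAt (vv (cj F) m) (deriv (vv (cj F) m) z) z :=
    fun m hm z hz => (h.tl.vv_an hm (him z hz)).differentiableAt.hasDerivAt
  have r0 : ∀ z ∈ UH, 1 - deriv (vv F s) z = κ0 * (1 - deriv (vv (cj F) s) z) := by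
    intro z hz; rw [h.KK_rel (by omega) (him z hz), K0]
  have r1 : ∀ z ∈ UH, 1 - deriv (vv F (s+1)) z = κ1 * (1 - deriv (vv (cj F) (s+1)) z) := by
    intro z hz; rw [h.KK_rel (by omega) (him z hz), K1]
  obtain ⟨c0, e0⟩ := UH_const (a := vv F s) (b := fun z => κ0 * vv (cj F) s z + (1 - κ0) * z)
    (dv s (by omega)) (fun z hz =>
      (((dw s (by omega) z hz).const_mul κ0).fun_add ((hasDerivAt_id z).const_mul (1 - κ0))).congr_deriv
        (by linear_combination r0 z hz))
  obtain ⟨c1, e1⟩ := UH_const (a := vv F (s+1)) (b := fun z => κ1 * vv (cj F) (s+1) z + (1 - κ1) * z)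
    (dv (s+1) (by omega)) (fun z hz =>
      (((dw (s+1) (by omega) z hz).const_mul κ1).fun_add ((hasDerivAt_id z).const_mul (1 - κ1))).congr_deriv
        (by linear_combination r1 z hz))
  have ode : ∀ z ∈ UH, ((1 - κ1) * z + c1) * deriv (vv F s) z =
      ((1 - κ1) * z + c1) - κ1 * ((1 - κ0) * z + c0) + (κ1 - 1) * vv F s z := by
    intro z hz
    have a1 := h.vv_rel (m := s) (by omega) (him z hz)
    have a2 := h.tl.vv_rel (m := s) (by omega) (him z hz)
    have a3 := r0 z hz
    have a4 := e0 z hz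
    have a5 := e1 z hz
    rw [a5] at a1
    linear_combination -a1 + κ0 * κ1 * a2 + (κ1 * vv (cj F) (s+1) z) * a3 - κ1 * a4
  have hI : I ∈ UH := by simp [UH]
  have fin : ∀ n1 n0 q2 q1 q0 : ℂ, (∀ z ∈ UH, (n1 * z + n0) * vv F s z = q2 * z^2 + q1 * z + q0) →
      MeroEq (fun z => (n1 * z + n0) * F s z) (fun z => (q2 * z^2 + q1 * z + q0) * F (s+1) z) := by
    intro n1 n0 q2 q1 q0 hq
    refine mero_identity (z0 := I) (fun z => ?_) (fun z => ?_) ?_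
    · exact MeromorphicAt.fun_mul (by fun_prop) (h.mero s z)
    · exact MeromorphicAt.fun_mul (by fun_prop) (h.mero (s+1) z)
    · filter_upwards [h.vv_eq s I, h.nz (m := s+1) (by omega) I,
        nhdsWithin_le_nhds (isOpen_UH.mem_nhds hI)] with w h1 h2 h3
      have h4 := hq w h3
      rw [h1] at h4
      rw [← h4]
      simp only [Pi.div_apply]
      field_simp
  by_cases hk : κ1 = 1
  · by_cases hc : c1 = 0
    · left
      refine mero_prop (h.tl.mero (s+1)) (h.mero (s+1)) (h.nz (by omega)) ?_
      have hm1 := h.tl.der (s+1)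
      have hm2 := h.der (s+1)
      show MeroEq (fun z => deriv (cj F (s+1)) z * F (s+1) z) (fun z => cj F (s+1) z * deriv (F (s+1)) z)
      rw [← hm1, ← hm2]
      refine mero_identity (z0 := I) (fun z => ?_) (fun z => ?_) ?_
      · exact (h.tl.mero _ z).fun_mul (h.mero _ z)
      · exact (h.tl.mero _ z).fun_mul (h.mero _ z)
      · filter_upwards [h.vv_eq (s+1) I, h.tl.vv_eq (s+1) I, h.nz (m := s+1+1) (by omega) I,
          h.tl.nz (m := s+1+1) (by omega) I,
          nhdsWithin_le_nhds (isOpen_UH.mem_nhds hI)] with w h1 h2 h3 h4 h5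
        have h6 := e1 w h5
        simp only [hk, hc, h1, h2, Pi.div_apply] at h6
        field_simp at h6
        linear_combination h6
    · right
      obtain ⟨c, hc2⟩ := UH_const (a := vv F s) (b := fun z => (-(1 - κ0)/(2*c1)) * z^2 + (1 - c0/c1) * z)
        (dv s (by omega)) (fun z hz =>
          ((((hasDerivAt_id z).fun_pow 2).const_mul (-(1 - κ0)/(2*c1))).fun_add
            ((hasDerivAt_id z).const_mul (1 - c0/c1))).congr_deriv (by
              have := ode z hz
              rw [hk] at this
              simp only [id]
              field_simp
              simp
              linear_combination -2 * this))
      refine ⟨0, 1, _, _, c, Or.inr ⟨rfl, rfl⟩, fin 0 1 (-(1 - κ0)/(2*c1)) (1 - c0/c1) c ?_⟩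
      intro z hz
      rw [hc2 z hz]; ring
  · right
    have hk2 : 1 - κ1 ≠ 0 := sub_ne_zero.2 (Ne.symm hk)
    obtain ⟨c, hc2⟩ := UH_const (a := fun z => (z + c1/(1-κ1)) * vv F s z)
        (b := fun z => ((1 - κ1*(1 - κ0)/(1-κ1))/2) * z^2 + ((c1 - κ1 * c0)/(1-κ1)) * z)
        (a' := fun z => vv F s z + (z + c1/(1-κ1)) * deriv (vv F s) z)
        (fun z hz => (((hasDerivAt_id z).add_const (c1/(1-κ1))).fun_mul (dv s (by omega) z hz)).congr_deriv
           (by simp)) (fun z hz =>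
          ((((hasDerivAt_id z).fun_pow 2).const_mul ((1 - κ1*(1 - κ0)/(1-κ1))/2)).fun_add
            ((hasDerivAt_id z).const_mul ((c1 - κ1 * c0)/(1-κ1)))).congr_deriv (by
              have := ode z hz
              simp only [id]
              field_simp
              simp
              linear_combination -2 * this))
    refine ⟨1, c1/(1-κ1), _, _, c, Or.inl rfl, fin 1 (c1/(1-κ1)) ((1 - κ1*(1 - κ0)/(1-κ1))/2)
      ((c1 - κ1 * c0)/(1-κ1)) c ?_⟩
    intro z hz
    rw [← hc2 z hz]; ring

theorem poly_lower_ray (k : Polynomial ℂ) (ζ : ℂ) {n : ℕ} (hn : k.natDegree = n) :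
    (fun r : ℝ => k.eval ((r:ℂ) * ζ) - k.leadingCoeff * ζ ^ n * (r:ℂ)^n) =o[atTop] fun r : ℝ => r ^ n := by
  have h1 : ∀ r : ℝ, k.eval ((r:ℂ) * ζ) - k.leadingCoeff * ζ ^ n * (r:ℂ)^n =
      ∑ i ∈ Finset.range n, k.coeff i * ((r:ℂ) * ζ)^i := by
    intro r
    rw [Polynomial.eval_eq_sum_range, hn, Finset.sum_range_succ, Polynomial.leadingCoeff, hn, mul_pow]
    ring
  simp only [h1]
  apply Asymptotics.IsLittleO.fun_sum
  intro i hi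
  have h2 : (fun r : ℝ => r ^ i) =o[atTop] fun r : ℝ => r ^ n :=
    Asymptotics.isLittleO_pow_pow_atTop_of_lt (Finset.mem_range.1 hi)
  have h3 := h2.const_mul_left (‖k.coeff i * ζ ^ i‖)
  refine Asymptotics.IsBigO.trans_isLittleO ?_ h3
  apply Asymptotics.IsBigO.of_bound 1
  filter_upwards with r
  simp only [norm_mul, norm_pow, mul_pow, Complex.norm_real, norm_norm]
  apply le_of_eq; ring

theorem poly_ray_ge (k : Polynomial ℂ) (ζ : ℂ) (hn : 1 ≤ k.natDegree)
    (hl : 0 < (k.leadingCoeff * ζ ^ k.natDegree).re) :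
    ∃ b > 0, ∀ᶠ r : ℝ in atTop, b * r ≤ (k.eval ((r:ℂ) * ζ)).re := by
  set ρ := (k.leadingCoeff * ζ ^ k.natDegree).re with hρ
  refine ⟨ρ/2, by positivity, ?_⟩
  have h := (poly_lower_ray k ζ rfl).def (show 0 < ρ/2 by positivity)
  filter_upwards [h, eventually_ge_atTop 1] with r hr h1
  have h2 := (Complex.abs_re_le_norm _).trans hr
  rw [Complex.sub_re] at h2
  have h3 : (k.leadingCoeff * ζ ^ k.natDegree * (r:ℂ) ^ k.natDegree).re = ρ * r ^ k.natDegree := by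
    rw [← Complex.ofReal_pow, Complex.re_mul_ofReal]
  rw [h3, Real.norm_of_nonneg (by positivity)] at h2
  have h4 := (abs_le.1 h2).1
  have h5 : r ≤ r ^ k.natDegree := le_self_pow₀ h1 (by omega)
  have hp : 0 < ρ := hl
  nlinarith

theorem poly_ray_exp (p : Polynomial ℂ) (ζ : ℂ) {b : ℝ} (hb : 0 < b) :
    (fun r : ℝ => p.eval ((r:ℂ) * ζ)) =o[atTop] fun r : ℝ => Real.exp (b * r) := by
  simp only [Polynomial.eval_eq_sum_range]
  apply Asymptotics.IsLittleO.fun_sum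
  intro i hi
  have h3 := (isLittleO_pow_exp_pos_mul_atTop i hb).const_mul_left (‖p.coeff i * ζ ^ i‖)
  refine Asymptotics.IsBigO.trans_isLittleO ?_ h3
  apply Asymptotics.IsBigO.of_bound 1
  filter_upwards with r
  simp only [norm_mul, norm_pow, mul_pow, Complex.norm_real, norm_norm]
  apply le_of_eq; ring

theorem dir_exists {l : ℂ} (hl : l ≠ 0) {n : ℕ} (hn : 2 ≤ n) :
    ∃ ζ1 ζ2 : ℂ, 0 < ζ1.im ∧ 0 < ζ2.im ∧ 0 < (l * ζ1^n).re ∧ 0 < ((-l) * ζ2^n).re := by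
  have hn0 : (n : ℂ) ≠ 0 := by exact_mod_cast (by omega : n ≠ 0)
  have hnr : (2:ℝ) ≤ n := by exact_mod_cast hn
  have aux : ∀ ψ : ℝ, 0 < ψ → ψ ≤ Real.pi / 2 → (l * cexp (ψ * I)).re ≠ 0 →
      ∃ ζ1 ζ2 : ℂ, 0 < ζ1.im ∧ 0 < ζ2.im ∧ 0 < (l * ζ1^n).re ∧ 0 < ((-l) * ζ2^n).re := by
    intro ψ h0 h1 h2
    have hpi := Real.pi_pos
    have im1 : 0 < (cexp (((ψ / n : ℝ):ℂ) * I)).im := by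
      rw [Complex.exp_ofReal_mul_I_im]
      apply Real.sin_pos_of_pos_of_lt_pi (by positivity)
      rw [div_lt_iff₀ (by positivity)]; nlinarith
    have im2 : 0 < (cexp ((((ψ + Real.pi) / n : ℝ):ℂ) * I)).im := by
      rw [Complex.exp_ofReal_mul_I_im]
      apply Real.sin_pos_of_pos_of_lt_pi (by positivity)
      rw [div_lt_iff₀ (by positivity)]; nlinarith
    have p1 : (cexp (((ψ / n : ℝ):ℂ) * I))^n = cexp (ψ * I) := by
      rw [← Complex.exp_nat_mul]; congr 1; push_cast; field_simp
    have p2 : (cexp ((((ψ + Real.pi) / n : ℝ):ℂ) * I))^n = - cexp (ψ * I) := by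
      rw [← Complex.exp_nat_mul]
      have : (n:ℂ) * ((((ψ + Real.pi) / n : ℝ):ℂ) * I) = ψ * I + Real.pi * I := by
        push_cast; field_simp
      rw [this, Complex.exp_add, Complex.exp_pi_mul_I]; ring
    rcases lt_or_gt_of_ne h2 with h3 | h3
    · refine ⟨_, _, im2, im1, ?_, ?_⟩
      · rw [p2]; simp only [mul_neg, Complex.neg_re]; linarith
      · rw [p1]; simp only [neg_mul, Complex.neg_re]; linarith
    · refine ⟨_, _, im1, im2, ?_, ?_⟩
      · rw [p1]; linarith
      · rw [p2]; simp only [neg_mul, mul_neg, neg_neg]; linarith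
  by_cases h1 : (l * cexp ((Real.pi/2 : ℝ) * I)).re = 0
  · have h2 : l.im = 0 := by
      push_cast at h1
      rw [Complex.exp_pi_div_two_mul_I] at h1
      simpa using h1
    refine aux (Real.pi/4) (by positivity) (by linarith [Real.pi_pos]) ?_
    rw [Complex.mul_re, Complex.exp_ofReal_mul_I_re, h2, zero_mul, sub_zero]
    have : l.re ≠ 0 := fun h => hl (Complex.ext h h2)
    rw [Real.cos_pi_div_four]
    positivity
  · exact aux _ (by positivity) le_rfl h1

theorem real_contra_big {v v1 : ℂ → ℂ} (h : WCls v v1 UH) {k : Polynomial ℂ}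
    (hk : 2 ≤ k.natDegree)
    (he : ∀ z ∈ UH, k.derivative.eval z * v z = 1 - cexp (k.eval z)) : False := by
  have hk0 : k.leadingCoeff ≠ 0 := by
    rw [Polynomial.leadingCoeff_ne_zero]; rintro rfl; simp at hk
  obtain ⟨ζ1, ζ2, i1, i2, r1, r2⟩ := dir_exists hk0 hk
  obtain ⟨b1, hb1, e1⟩ := poly_ray_ge k ζ1 (by omega) r1
  obtain ⟨b2, hb2, e2⟩ := poly_ray_ge (-k) ζ2 (by rw [Polynomial.natDegree_neg]; omega) (by
    rwa [Polynomial.natDegree_neg, Polynomial.leadingCoeff_neg])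
  set p := k.derivative with hp
  have hmin : 0 < min ζ1.im ζ2.im := lt_min i1 i2
  obtain ⟨M, hM1, hM⟩ := (slow_one h).chain (‖ζ1 - ζ2‖ / min ζ1.im ζ2.im)
  -- p is bounded below on the second ray
  have hpd : 0 < p.degree := by
    rw [hp]
    have := Polynomial.natDegree_derivative k
    apply Polynomial.natDegree_pos_iff_degree_pos.1
    omega
  have hray : ∀ ζ : ℂ, ζ ≠ 0 → Tendsto (fun r : ℝ => ‖(r:ℂ) * ζ‖) atTop atTop := by
    intro ζ hζ
    simp only [norm_mul, Complex.norm_real]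
    exact tendsto_norm_atTop_atTop.atTop_mul_const (norm_pos_iff.2 hζ)
  have hz2 : ζ2 ≠ 0 := by rintro rfl; simp at i2
  have hz1 : ζ1 ≠ 0 := by rintro rfl; simp at i1
  have e3 := (p.tendsto_norm_atTop hpd (hray ζ2 hz2)).eventually_ge_atTop 1
  set L := M * (1 + Real.log (1 + 2 / ζ2.im)) with hL
  have e4 := (poly_ray_exp (Polynomial.X * p) ζ1 hb1).def
    (show (0:ℝ) < 1 / (2 * (Real.exp L + 1)) by positivity)
  have e5 : ∀ᶠ r : ℝ in atTop, 3 ≤ Real.exp (b1 * r) :=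
    (Real.tendsto_exp_atTop.comp (tendsto_id.const_mul_atTop hb1)).eventually_ge_atTop 3
  obtain ⟨r, a1, a2, a3, a4, a5, hr⟩ :=
    (e1.and (e2.and (e3.and (e4.and (e5.and (eventually_ge_atTop 1)))))).exists
  have hr0 : 0 < r := by linarith
  have im : ∀ ζ : ℂ, ((r:ℂ) * ζ).im = r * ζ.im := fun ζ => by simp
  have c := hM ((r:ℂ) * ζ2) ((r:ℂ) * ζ1) (by rw [im]; positivity) (by rw [im]; positivity) (by
    rw [im, im, ← mul_sub, norm_mul, Complex.norm_real, Real.norm_of_nonneg hr0.le,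
      ← mul_min_of_nonneg _ _ hr0.le, min_comm ζ2.im]
    apply le_of_eq; field_simp)
  have f2 := he ((r:ℂ) * ζ2) (by show 0 < ((r:ℂ) * ζ2).im; rw [im]; positivity)
  have f1 := he ((r:ℂ) * ζ1) (by show 0 < ((r:ℂ) * ζ1).im; rw [im]; positivity)
  -- bound on ray 2
  have v2 : ‖v ((r:ℂ) * ζ2)‖ ≤ 2 := by
    have g1 : ‖p.eval ((r:ℂ) * ζ2) * v ((r:ℂ) * ζ2)‖ ≤ 2 := by
      rw [f2]
      refine (norm_sub_le _ _).trans ?_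
      rw [norm_one, Complex.norm_exp]
      have : (k.eval ((r:ℂ) * ζ2)).re ≤ 0 := by
        rw [Polynomial.eval_neg, Complex.neg_re] at a2
        nlinarith
      have := Real.exp_le_one_iff.2 this
      linarith
    rw [norm_mul] at g1
    nlinarith [norm_nonneg (v ((r:ℂ) * ζ2))]
  have v2' : 1 + Real.log (1 + ‖v ((r:ℂ) * ζ2)‖ / ((r:ℂ) * ζ2).im) ≤ 1 + Real.log (1 + 2 / ζ2.im) := by
    rw [im]
    have : ‖v ((r:ℂ) * ζ2)‖ / (r * ζ2.im) ≤ 2 / ζ2.im := by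
      rw [div_le_div_iff₀ (by positivity) i2]
      have : 2 * ζ2.im ≤ 2 * (r * ζ2.im) := by nlinarith
      nlinarith
    have h0 : 0 ≤ ‖v ((r:ℂ) * ζ2)‖ / (r * ζ2.im) := by positivity
    have := Real.log_le_log (by linarith) (show 1 + ‖v ((r:ℂ) * ζ2)‖ / (r * ζ2.im) ≤ 1 + 2/ζ2.im by linarith)
    linarith
  have c2 := c.trans (mul_le_mul_of_nonneg_left v2' (by linarith))
  rw [← hL, im] at c2
  -- upper bound on ray 1
  have v1b : ‖v ((r:ℂ) * ζ1)‖ ≤ Real.exp L * (r * ζ1.im) := by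
    have h0 : 0 ≤ ‖v ((r:ℂ) * ζ1)‖ / (r * ζ1.im) := by positivity
    have h1 : Real.log (1 + ‖v ((r:ℂ) * ζ1)‖ / (r * ζ1.im)) ≤ L := by linarith
    have h2 := (Real.log_le_iff_le_exp (by linarith)).1 h1
    have h3 : ‖v ((r:ℂ) * ζ1)‖ / (r * ζ1.im) ≤ Real.exp L := by linarith
    rwa [div_le_iff₀ (by positivity)] at h3
  have v1c : ‖v ((r:ℂ) * ζ1)‖ ≤ Real.exp L * ‖(r:ℂ) * ζ1‖ := by
    refine v1b.trans (mul_le_mul_of_nonneg_left ?_ (Real.exp_pos L).le)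
    rw [← im]; exact (le_abs_self _).trans (Complex.abs_im_le_norm _)
  have g2 : Real.exp (b1 * r) ≤ 1 + ‖p.eval ((r:ℂ) * ζ1)‖ * ‖v ((r:ℂ) * ζ1)‖ := by
    rw [← norm_mul, f1]
    have h1 : Real.exp (b1 * r) ≤ ‖cexp (k.eval ((r:ℂ) * ζ1))‖ := by
      rw [Complex.norm_exp]; exact Real.exp_le_exp.2 a1
    have h2 := norm_sub_norm_le (cexp (k.eval ((r:ℂ) * ζ1))) 1
    rw [norm_sub_rev, norm_one] at h2
    linarith
  rw [Polynomial.eval_mul, Polynomial.eval_X, norm_mul, Real.norm_of_nonneg (Real.exp_pos _).le] at a4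
  have g3 : ‖p.eval ((r:ℂ) * ζ1)‖ * ‖v ((r:ℂ) * ζ1)‖ ≤
      Real.exp L * (‖(r:ℂ) * ζ1‖ * ‖p.eval ((r:ℂ) * ζ1)‖) := by
    nlinarith [norm_nonneg (p.eval ((r:ℂ) * ζ1))]
  have g4 : Real.exp L * (‖(r:ℂ) * ζ1‖ * ‖p.eval ((r:ℂ) * ζ1)‖) ≤
      Real.exp L * (1 / (2 * (Real.exp L + 1)) * Real.exp (b1 * r)) :=
    mul_le_mul_of_nonneg_left a4 (Real.exp_pos L).le
  have g5 : Real.exp L * (1 / (2 * (Real.exp L + 1)) * Real.exp (b1 * r)) ≤ Real.exp (b1 * r) / 2 := by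
    have : Real.exp L * (1 / (2 * (Real.exp L + 1))) ≤ 1/2 := by
      have := Real.exp_pos L
      rw [mul_one_div, div_le_div_iff₀ (by positivity) (by norm_num)]
      linarith
    have h2 := mul_le_mul_of_nonneg_right this (Real.exp_pos (b1 * r)).le
    linarith
  linarith

theorem poly_anti (p : Polynomial ℂ) : ∃ k : Polynomial ℂ, k.derivative = p := by
  induction p using Polynomial.induction_on' with
  | add p q hp hq =>
    obtain ⟨a, ha⟩ := hp
    obtain ⟨b, hb⟩ := hq
    exact ⟨a + b, by rw [Polynomial.derivative_add, ha, hb]⟩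
  | monomial n a =>
    refine ⟨Polynomial.monomial (n+1) (a / (n+1)), ?_⟩
    rw [Polynomial.derivative_monomial]
    simp only [Nat.add_sub_cancel]
    congr 1
    push_cast
    have : (n:ℂ) + 1 ≠ 0 := by exact_mod_cast Nat.succ_ne_zero n
    field_simp

theorem Hyp.KK_exp {F : ℕ → ℂ → ℂ} (h : Hyp F) {m : ℕ} (hm : m ≤ 7) :
    ∃ k : Polynomial ℂ, (∀ z, KK F m z = cexp (k.eval z)) ∧
      ∀ z, kd F m z = k.derivative.eval z := by
  obtain ⟨p, hp⟩ := h.kd_poly hm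
  obtain ⟨k, hk⟩ := poly_anti p
  have hd : ∀ z, HasDerivAt (fun z => KK F m z * cexp (-(k.eval z))) 0 z := by
    intro z
    have h1 := (h.KK_an (m := m) (by omega) z).differentiableAt.hasDerivAt
    refine (h1.fun_mul (k.hasDerivAt z).fun_neg.cexp).congr_deriv ?_
    have h2 := hp z
    unfold kd at h2
    rw [div_eq_iff (h.KK_ne (by omega) z)] at h2
    rw [h2, hk]; ring
  have hc : ∀ z, KK F m z * cexp (-(k.eval z)) = KK F m 0 * cexp (-(k.eval 0)) := fun z =>
    is_const_of_deriv_eq_zero (fun z => (hd z).differentiableAt) (fun z => (hd z).deriv) z 0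
  set c := KK F m 0 * cexp (-(k.eval 0)) with hcd
  have hc0 : c ≠ 0 := mul_ne_zero (h.KK_ne (by omega) 0) (Complex.exp_ne_zero _)
  refine ⟨k + Polynomial.C (Complex.log c), fun z => ?_, fun z => ?_⟩
  · rw [Polynomial.eval_add, Polynomial.eval_C, Complex.exp_add, Complex.exp_log hc0, ← hc z,
      Complex.exp_neg]
    field_simp
  · rw [Polynomial.derivative_add, Polynomial.derivative_C, add_zero, hk, hp]

theorem entire_nz {a : ℂ → ℂ} (ha : Differentiable ℂ a) {z0 : ℂ} (h0 : a z0 ≠ 0) (z : ℂ) :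
    ∀ᶠ w in 𝓝[≠] z, a w ≠ 0 := by
  have han : ∀ z, AnalyticAt ℂ a z := fun z => ha.analyticAt z
  refine (meromorphicOrderAt_ne_top_iff_eventually_ne_zero (han z).meromorphicAt).1 ?_
  apply nz_of_order (fun z => (han z).meromorphicAt) (z0 := z0)
  rw [((han z0).meromorphicNFAt.meromorphicOrderAt_eq_zero_iff).2 h0]; simp

theorem MeroEq.hasDeriv {a b b' : ℂ → ℂ} (h : MeroEq a b)
    (hb : ∀ z, ∀ᶠ w in 𝓝[≠] z, HasDerivAt b (b' w) w) : MeroEq (_root_.deriv a) b' := by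
  intro z
  filter_upwards [h.deriv z, hb z] with w h1 h2
  rw [h1, h2.deriv]

theorem Hyp.real_zero {F : ℕ → ℂ → ℂ} (h : Hyp F) {m : ℕ} (hm : m ≤ 10) {G : ℂ → ℂ} {z : ℂ}
    (he : F m =ᶠ[𝓝[≠] z] G) (hG : AnalyticAt ℂ G z) (h0 : G z = 0) : z.im = 0 := by
  by_contra hz
  have h1 := h.ord m hm z hz
  rw [meromorphicOrderAt_congr he] at h1
  have h2 : 0 < meromorphicOrderAt G z := by
    rw [← tendsto_zero_iff_meromorphicOrderAt_pos hG.meromorphicAt]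
    have := hG.continuousAt.tendsto
    rw [h0] at this
    exact this.mono_left nhdsWithin_le_nhds
  exact absurd h1 (not_le.2 h2)

theorem real_case_step {F : ℕ → ℂ → ℂ} (h : Hyp F) {t : ℕ} (ht : t ≤ 7) {c : ℂ}
    (hc : MeroEq (mtilde (F (t+1))) (fun z => c * F (t+1) z)) :
    ∃ c : ℂ, MeroEq (mtilde (F t)) (fun z => c * F t z) := by
  obtain ⟨e, he⟩ := mero_const (h := fun z => mtilde (F t) z - c * F t z)
    (fun z => (h.tl.mero t z).fun_sub ((MeromorphicAt.const c z).fun_mul (h.mero t z))) (by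
      intro z
      filter_upwards [hc z, (h.mero t z).eventually_analyticAt, (h.tl.mero t z).eventually_analyticAt]
        with w h1 h2 h3
      have h4 := h3.differentiableAt.hasDerivAt.fun_sub (h2.differentiableAt.hasDerivAt.const_mul c)
      rw [← h.der t, ← h.tl.der t] at h4
      refine h4.deriv.trans ?_
      show mtilde (F (t+1)) w - _ = 0
      rw [h1]; ring)
  by_cases he0 : e = 0
  · refine ⟨c, fun z => ?_⟩
    filter_upwards [he z] with w hw
    rw [he0] at hw
    exact sub_eq_zero.1 hw
  exfalso
  have hc0 : c ≠ 0 := by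
    rintro rfl
    obtain ⟨w, h1, h2⟩ := ((h.tl.nz (m := t+1) (by omega) 0).and (hc 0)).exists
    apply h1
    show mtilde (F (t+1)) w = 0
    rw [h2]; ring
  -- relation with K
  have hK : MeroEq (fun z => c * F t z * (1 - KK F t z)) (fun z => e * KK F t z) := by
    intro z
    have hc2 : MeroEq (mtilde (F (t+2))) (fun z => c * F (t+2) z) := by
      have := hc.deriv
      rw [deriv_mtilde, ← h.der (t+1)] at this
      refine this.trans ?_
      intro z
      filter_upwards [(h.mero (t+1) z).eventually_analyticAt] with w hw
      rw [h.der (t+1)]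
      exact (hw.differentiableAt.hasDerivAt.const_mul c).deriv
    filter_upwards [he z, hc z, hc2 z, h.KK_eq t z, h.nz (m := t) (by omega) z,
      h.nz (m := t+1) (by omega) z, h.nz (m := t+2) (by omega) z, h.tl.nz (m := t) (by omega) z]
      with w a1 a2 a3 a4 a5 a6 a7 a8
    have a8' : mtilde (F t) w ≠ 0 := a8
    have a9 : mtilde (F t) w = c * F t w + e := by linear_combination a1
    rw [a9] at a8'
    rw [a4]
    simp only [uu, Pi.div_apply, Pi.mul_apply, cj]
    rw [a9, a2, a3]
    field_simp
    ring
  obtain ⟨k, hk1, hk2⟩ := h.KK_exp ht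
  have hKd : ∀ z, HasDerivAt (KK F t) (k.derivative.eval z * KK F t z) z := by
    intro z
    have h1 := (h.KK_an (m := t) (by omega) z).differentiableAt.hasDerivAt
    refine h1.congr_deriv ?_
    rw [← hk2, kd, div_mul_cancel₀ _ (h.KK_ne (by omega) z)]
  have hKdiff : Differentiable ℂ (KK F t) := fun z => (hKd z).differentiableAt
  have h1K : ∃ z0, 1 - KK F t z0 ≠ 0 := by
    by_contra hcon
    push Not at hcon
    obtain ⟨w, hw⟩ := (hK 0).exists
    beta_reduce at hw
    rw [hcon w, mul_zero] at hw
    rcases mul_eq_zero.1 hw.symm with h1 | h1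
    · exact he0 h1
    · exact h.KK_ne (by omega) w h1
  obtain ⟨z0, hz0⟩ := h1K
  have hnz := entire_nz (a := fun z => 1 - KK F t z) (by fun_prop) hz0
  have f0 : MeroEq (F t) (fun z => (e/c) * (KK F t z / (1 - KK F t z))) := by
    intro z
    filter_upwards [hK z, hnz z] with w h1 h2
    field_simp
    linear_combination h1
  have f1 : MeroEq (F (t+1)) (fun z => (e/c) * (k.derivative.eval z * KK F t z / (1 - KK F t z)^2)) := by
    rw [h.der t]
    refine f0.hasDeriv fun z => ?_
    filter_upwards [hnz z] with w hw
    refine (((hKd w).fun_div ((hKd w).const_sub 1) hw).const_mul (e/c)).congr_deriv ?_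
    field_simp
    ring
  have hv : ∀ z ∈ UH, k.derivative.eval z * vv F t z = 1 - cexp (k.eval z) := by
    intro z hz
    rw [← hk1]
    have ev : (fun z => k.derivative.eval z * vv F t z) =ᶠ[𝓝[≠] z] fun z => 1 - KK F t z := by
      filter_upwards [h.vv_eq t z, f0 z, f1 z, hnz z, h.nz (m := t+1) (by omega) z] with w b1 b2 b3 b4 b5
      rw [b1, Pi.div_apply, b2, b3]
      have hd0 : k.derivative.eval w ≠ 0 := by
        intro h0; rw [h0] at b3; apply b5; rw [b3]; simp
      have := h.KK_ne (m := t) (by omega) w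
      field_simp
    have han := h.vv_an (m := t) (by omega) (ne_of_gt hz)
    exact (eq_of_nhdsNE ev ((k.derivative.continuous.continuousAt).fun_mul han.continuousAt)
      (continuousAt_const.sub (hKdiff z).continuousAt)).self_of_nhds
  by_cases hdeg : 2 ≤ k.natDegree
  · exact real_contra_big (h.tower ht) hdeg hv
  -- degree one
  have hkder : ∃ κ : ℂ, k.derivative = Polynomial.C κ := by
    refine ⟨k.derivative.coeff 0, Polynomial.eq_C_of_natDegree_eq_zero ?_⟩
    have := k.natDegree_derivative
    omega
  obtain ⟨κ, hκ⟩ := hkder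
  simp only [hκ, Polynomial.eval_C] at hKd f1 hv
  have hκ0 : κ ≠ 0 := by
    rintro rfl
    obtain ⟨w, h1, h2⟩ := ((f1 0).and (h.nz (m := t+1) (by omega) 0)).exists
    apply h2; rw [h1]; simp
  have f2 : MeroEq (F (t+2)) (fun z => (e/c) * κ^2 * (KK F t z * (1 + KK F t z)/ (1 - KK F t z)^3)) := by
    rw [h.der (t+1)]
    refine f1.hasDeriv fun z => ?_
    filter_upwards [hnz z] with w hw
    refine ((((hKd w).const_mul κ).fun_div (((hKd w).const_sub 1).fun_pow 2) (pow_ne_zero 2 hw)).const_mul (e/c)).congr_deriv ?_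
    field_simp
    ring
  have f3 : MeroEq (F (t+3)) (fun z => (e/c) * κ^3 *
      (KK F t z * (1 + 4 * KK F t z + KK F t z ^2)/ (1 - KK F t z)^4)) := by
    rw [h.der (t+2)]
    refine f2.hasDeriv fun z => ?_
    filter_upwards [hnz z] with w hw
    refine ((((hKd w).fun_mul ((hKd w).const_add 1)).fun_div (((hKd w).const_sub 1).fun_pow 3)
      (pow_ne_zero 3 hw)).const_mul ((e/c) * κ^2)).congr_deriv ?_
    field_simp
    ring
  have hzero : ∀ z, 1 + 4 * KK F t z + KK F t z ^2 = 0 → z.im = 0 := by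
    intro z hz
    have h1 : 1 - KK F t z ≠ 0 := by
      intro h1
      have : KK F t z = 1 := by linear_combination -h1
      rw [this] at hz; norm_num at hz
    refine h.real_zero (m := t+3) (by omega) (f3 z) ?_ (by beta_reduce; rw [hz]; simp)
    have := hKdiff.analyticAt z
    have h2 : AnalyticAt ℂ (fun z => (1 - KK F t z)^4) z := (analyticAt_const.fun_sub this).fun_pow 4
    refine analyticAt_const.fun_mul (AnalyticAt.fun_div ?_ h2 (pow_ne_zero 4 h1))
    exact this.fun_mul ((analyticAt_const.fun_add (analyticAt_const.fun_mul this)).fun_add (this.fun_pow 2))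
  have hkz : ∀ z, k.eval z = κ * z + k.eval 0 := by
    intro z
    have : ∀ z, HasDerivAt (fun z => k.eval z - κ * z) 0 z := by
      intro z
      refine ((k.hasDerivAt z).fun_sub ((hasDerivAt_id z).const_mul κ)).congr_deriv ?_
      rw [hκ]; simp
    have := is_const_of_deriv_eq_zero (fun z => (this z).differentiableAt) (fun z => (this z).deriv) z 0
    simp only [mul_zero, sub_zero] at this
    linear_combination this
  set s3 : ℝ := Real.sqrt 3 with hs3
  have hsq : s3^2 = 3 := Real.sq_sqrt (by norm_num)
  have hs1 : 1 < s3 := by nlinarith [Real.sqrt_nonneg 3]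
  have hs2 : s3 < 2 := by nlinarith [Real.sqrt_nonneg 3]
  set L := Real.log (2 - s3) with hL
  have hL0 : L ≠ 0 := (Real.log_neg (by linarith) (by linarith)).ne
  have hexpL : Real.exp L = 2 - s3 := Real.exp_log (by linarith)
  have hexpL2 : Real.exp (-L) = 2 + s3 := by
    rw [Real.exp_neg, hexpL]
    symm
    refine eq_inv_of_mul_eq_one_left ?_
    nlinarith
  have hpt : ∀ x : ℂ, (cexp x = -((2:ℂ) - s3) ∨ cexp x = -((2:ℂ) + s3)) → ((x - k.eval 0)/κ).im = 0 := by
    intro x hx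
    apply hzero
    have hv : KK F t ((x - k.eval 0)/κ) = cexp x := by
      rw [hk1, hkz]; congr 1; field_simp; ring
    have hsqc : (s3:ℂ)^2 = 3 := by exact_mod_cast hsq
    rw [hv]
    rcases hx with hx | hx
    · rw [hx]; linear_combination hsqc
    · rw [hx]; linear_combination hsqc
  have eL : cexp (L:ℂ) = 2 - s3 := by rw [← Complex.ofReal_exp, hexpL]; push_cast; ring
  have eL2 : cexp (-(L:ℂ)) = 2 + s3 := by
    rw [← Complex.ofReal_neg, ← Complex.ofReal_exp, hexpL2]; push_cast; ring
  have p1 := hpt (L + Real.pi * I) (Or.inl (by rw [Complex.exp_add, Complex.exp_pi_mul_I, eL]; ring))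
  have p2 := hpt (-L + Real.pi * I) (Or.inr (by rw [Complex.exp_add, Complex.exp_pi_mul_I, eL2]; ring))
  have p3 := hpt (L - Real.pi * I) (Or.inl (by
    rw [Complex.exp_sub, Complex.exp_pi_mul_I, eL]; ring))
  have q1 : ((2 * L : ℝ) * κ⁻¹).im = 0 := by
    have : ((2 * L : ℝ) * κ⁻¹) = (L + Real.pi * I - k.eval 0)/κ - (-L + Real.pi * I - k.eval 0)/κ := by
      push_cast; field_simp; ring
    rw [this, Complex.sub_im, p1, p2, sub_zero]
  have q2 : ((2 * Real.pi : ℝ) * (I * κ⁻¹)).im = 0 := by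
    have : ((2 * Real.pi : ℝ) * (I * κ⁻¹)) =
      (L + Real.pi * I - k.eval 0)/κ - (L - Real.pi * I - k.eval 0)/κ := by
      push_cast; field_simp; ring
    rw [this, Complex.sub_im, p1, p3, sub_zero]
  rw [Complex.im_ofReal_mul] at q1 q2
  have q3 : κ⁻¹.im = 0 := by
    rcases mul_eq_zero.1 q1 with h | h
    · exact absurd h (by simpa using hL0)
    · exact h
  have q4 : κ⁻¹.re = 0 := by
    rcases mul_eq_zero.1 q2 with h | h
    · exact absurd h (by positivity)
    · simpa using h
  exact inv_ne_zero hκ0 (Complex.ext q4 q3)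

theorem real_case {F : ℕ → ℂ → ℂ} (h : Hyp F)
    (hn : ¬ ∃ c : ℂ, MeroEq (mtilde (F 0)) (fun z => c * F 0 z)) :
    ∀ t ≤ 8, ¬ ∃ c : ℂ, MeroEq (mtilde (F t)) (fun z => c * F t z) := by
  intro t
  induction t with
  | zero => exact fun _ => hn
  | succ t ih =>
    rintro ht ⟨c, hc⟩
    exact ih (by omega) (real_case_step h (by omega) hc)

theorem Hyp.not_real {F : ℕ → ℂ → ℂ} (h : Hyp F) {s : ℕ} (hs : s ≤ 8) {r : ℂ → ℂ}
    (hr : MeroEq (F (s+1)) (fun z => r z * F s z))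
    (hn : ¬ ∃ c : ℂ, MeroEq (mtilde (F s)) (fun z => c * F s z))
    (hc : ∀ z, starRingEnd ℂ (r (starRingEnd ℂ z)) = r z) : False := by
  apply hn
  refine mero_prop (h.tl.mero s) (h.mero s) (h.nz (by omega)) fun z => ?_
  filter_upwards [hr z, hr.mtilde z] with w h1 h2
  beta_reduce
  have e1 : deriv (mtilde (F s)) w = mtilde (F (s+1)) w := by
    rw [deriv_mtilde, ← h.der s]
  rw [e1, ← h.der s, h1, h2]
  have e2 : mtilde (fun z => r z * F s z) w = r w * mtilde (F s) w := by
    simp only [mtilde, map_mul, hc]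
  rw [e2]
  show _ = mtilde (F s) w * _
  ring

/-- zeros of a factor at a regular point are real -/
theorem Hyp.R_zero {F : ℕ → ℂ → ℂ} (h : Hyp F) {s k : ℕ} (hs : s ≤ 9) (hk : s + k ≤ 10) {r R : ℂ → ℂ}
    {z : ℂ} (hr : F (s+1) =ᶠ[𝓝[≠] z] (fun z => r z * F s z))
    (hR : F (s+k) =ᶠ[𝓝[≠] z] (fun z => R z * F s z))
    (hra : AnalyticAt ℂ r z) (hRa : AnalyticAt ℂ R z) (h0 : R z = 0) : z.im = 0 := by
  by_contra hz
  have hRp : 0 < meromorphicOrderAt R z := by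
    rw [← tendsto_zero_iff_meromorphicOrderAt_pos hRa.meromorphicAt]
    have := hRa.continuousAt.tendsto
    rw [h0] at this
    exact this.mono_left nhdsWithin_le_nhds
  have o1 : meromorphicOrderAt (F (s+1)) z = meromorphicOrderAt r z + meromorphicOrderAt (F s) z := by
    rw [meromorphicOrderAt_congr hr]
    exact meromorphicOrderAt_mul hra.meromorphicAt (h.mero s z)
  have o2 : meromorphicOrderAt (F (s+k)) z = meromorphicOrderAt R z + meromorphicOrderAt (F s) z := by
    rw [meromorphicOrderAt_congr hR]
    exact meromorphicOrderAt_mul hRa.meromorphicAt (h.mero s z)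
  rcases h.cases hs hz with ⟨n, hn, c1, c2⟩ | ⟨c1, c2⟩
  · have hr0 := hra.meromorphicOrderAt_nonneg
    rw [c1, c2] at o1
    have : (n : WithTop ℤ) ≤ ((n - 1 : ℤ) : WithTop ℤ) := by
      rw [o1]; exact le_add_of_nonneg_left hr0
    have := WithTop.coe_le_coe.1 this
    omega
  · rw [c1, add_zero] at o2
    have := h.ord (s+k) hk z hz
    rw [o2] at this
    exact absurd this (not_le.2 hRp)

theorem Hyp.R2 {F : ℕ → ℂ → ℂ} (h : Hyp F) {s : ℕ} {r r1 : ℂ → ℂ}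
    (hr : MeroEq (F (s+1)) (fun z => r z * F s z))
    (hd : ∀ z, ∀ᶠ w in 𝓝[≠] z, HasDerivAt r (r1 w) w) :
    MeroEq (F (s+2)) (fun z => (r z ^ 2 + r1 z) * F s z) := by
  have h2 : MeroEq (deriv (F (s+1))) (fun z => r1 z * F s z + r z * F (s+1) z) := by
    refine hr.hasDeriv fun z => ?_
    filter_upwards [hd z, (h.mero s z).eventually_analyticAt] with w a1 a2
    have := a2.differentiableAt.hasDerivAt
    rw [← h.der s] at this
    exact a1.fun_mul this
  rw [← h.der (s+1)] at h2
  refine h2.trans fun z => ?_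
  filter_upwards [hr z] with w hw
  rw [hw]; ring

theorem Hyp.R3 {F : ℕ → ℂ → ℂ} (h : Hyp F) {s : ℕ} {r r1 r2 : ℂ → ℂ}
    (hr : MeroEq (F (s+1)) (fun z => r z * F s z))
    (hd : ∀ z, ∀ᶠ w in 𝓝[≠] z, HasDerivAt r (r1 w) w)
    (hd2 : ∀ z, ∀ᶠ w in 𝓝[≠] z, HasDerivAt r1 (r2 w) w) :
    MeroEq (F (s+3)) (fun z => (r z ^ 3 + 3 * r z * r1 z + r2 z) * F s z) := by
  have h2 : MeroEq (deriv (F (s+2))) (fun z => (2 * r z * r1 z + r2 z) * F s z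
      + (r z ^2 + r1 z) * F (s+1) z) := by
    refine (h.R2 hr hd).hasDeriv fun z => ?_
    filter_upwards [hd z, hd2 z, (h.mero s z).eventually_analyticAt] with w a1 a2 a3
    have := a3.differentiableAt.hasDerivAt
    rw [← h.der s] at this
    refine (((a1.fun_pow 2).fun_add a2).fun_mul this).congr_deriv ?_
    simp
  rw [← h.der (s+2)] at h2
  refine h2.trans fun z => ?_
  filter_upwards [hr z] with w hw
  rw [hw]; ring

/-- residue = order -/
theorem Hyp.ord_at {F : ℕ → ℂ → ℂ} (h : Hyp F) {s : ℕ} (hs : s ≤ 9) {r g : ℂ → ℂ} {a p : ℂ}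
    (hr : F (s+1) =ᶠ[𝓝[≠] a] (fun z => r z * F s z)) (hp : p ≠ 0)
    (hra : ∀ w, w ≠ a → r w = p / (w - a) + g w) (hg : AnalyticAt ℂ g a) :
    ∃ n : ℤ, meromorphicOrderAt (F s) a = n ∧ (n : ℂ) = p := by
  obtain ⟨n, hn⟩ := WithTop.ne_top_iff_exists.1 (h.fin (show s ≤ 10 by omega) a)
  refine ⟨n, hn.symm, ?_⟩
  have hden : p + (a - a) * g a ≠ 0 := by simpa using hp
  have han : AnalyticAt ℂ (fun w => p + (w - a) * g w) a :=
    analyticAt_const.fun_add ((analyticAt_id.fun_sub analyticAt_const).fun_mul hg)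
  have hv : AnalyticAt ℂ (fun w => (w - a) / (p + (w - a) * g w)) a :=
    (analyticAt_id.fun_sub analyticAt_const).fun_div han hden
  have key := ratio_deriv (v := fun w => (w - a) / (p + (w - a) * g w)) (h.mero s a) hn.symm hv
    (by simp) (by
      have hc := han.continuousAt.eventually_ne hden
      filter_upwards [hr, nhdsWithin_le_nhds hc, self_mem_nhdsWithin] with w h1 h2 h3
      have h4 : w - a ≠ 0 := sub_ne_zero.2 h3
      rw [← h.der s, h1, hra w h3]
      field_simp)
  have hd : deriv (fun w => (w - a) / (p + (w - a) * g w)) a = 1 / p := by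
    have h1 : HasDerivAt (fun w : ℂ => w - a) 1 a := (hasDerivAt_id a).sub_const a
    have := h1.fun_div (han.differentiableAt.hasDerivAt) hden
    rw [this.deriv]
    simp
    field_simp
  rw [hd] at key
  field_simp at key
  exact key

theorem conj_of_im {z : ℂ} (h : z.im = 0) : starRingEnd ℂ z = z := Complex.conj_eq_iff_im.2 h

theorem evne (a z : ℂ) : ∀ᶠ w in 𝓝[≠] z, w - a ≠ 0 :=
  entire_nz (a := fun w => w - a) (by fun_prop) (z0 := a + 1) (by simp) z

theorem hasDeriv_pole (p a : ℂ) (n : ℕ) {w : ℂ} (hw : w - a ≠ 0) :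
    HasDerivAt (fun w => p / (w - a) ^ (n+1)) (-((n+1) * p) / (w - a)^(n+2)) w := by
  have h1 : HasDerivAt (fun w : ℂ => w - a) 1 w := (hasDerivAt_id w).sub_const a
  refine ((hasDerivAt_const w p).fun_div (h1.fun_pow (n+1)) (pow_ne_zero _ hw)).congr_deriv ?_
  simp
  field_simp
  ring

/-- exp of quadratic -/
theorem Hyp.formE {F : ℕ → ℂ → ℂ} (h : Hyp F) {s : ℕ} (hs : s ≤ 6) {γ c : ℂ} (hγ : γ ≠ 0)
    (hr : MeroEq (F (s+1)) (fun z => (γ * z + c) * F s z))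
    (hn : ¬ ∃ c : ℂ, MeroEq (mtilde (F s)) (fun z => c * F s z)) : False := by
  have hβ : (-c/γ).im = 0 := h.R_zero (k := 1) (r := fun z => γ * z + c) (R := fun z => γ * z + c)
    (by omega) (by omega) (hr _) (hr _) (by fun_prop) (by fun_prop) (by field_simp; ring)
  have h2 := h.R2 (r1 := fun _ => γ) hr (fun z => by
    filter_upwards with w
    simpa using ((hasDerivAt_id w).const_mul γ).add_const c)
  obtain ⟨x, hx⟩ := IsAlgClosed.exists_pow_nat_eq (-1/γ) (n := 2) (by norm_num)
  have hz : (x + -c/γ).im = 0 := by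
    refine h.R_zero (k := 2) (r := fun z => γ * z + c) (R := fun z => (γ * z + c)^2 + γ)
      (by omega) (by omega) (hr _) (h2 _) (by fun_prop) (by fun_prop) ?_
    beta_reduce
    have : γ * (x + -c/γ) + c = γ * x := by field_simp; ring
    rw [this, mul_pow, hx]; field_simp; ring
  rw [Complex.add_im, hβ, add_zero] at hz
  have cx := conj_of_im hz
  have cγ : starRingEnd ℂ γ = γ := by
    have : γ = -1 / x^2 := by rw [hx]; field_simp
    rw [this]; simp [cx]
  have cc : starRingEnd ℂ c = c := by
    have h1 := conj_of_im hβ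
    rw [map_div₀, cγ, map_neg, div_left_inj' hγ] at h1
    exact neg_injective h1
  exact h.not_real (by omega) hr hn (fun z => by simp [cγ, cc])

theorem Hyp.formC {F : ℕ → ℂ → ℂ} (h : Hyp F) {s : ℕ} (hs : s ≤ 6) {c p a : ℂ} (hc : c ≠ 0) (hp : p ≠ 0)
    (hr : MeroEq (F (s+1)) (fun z => (c + p / (z - a)) * F s z))
    (hn : ¬ ∃ c : ℂ, MeroEq (mtilde (F s)) (fun z => c * F s z)) : False := by
  obtain ⟨n, ho, hnp⟩ := h.ord_at (r := fun z => c + p / (z - a)) (g := fun _ => c) (by omega) (hr a) hp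
    (fun w hw => by ring) analyticAt_const
  have hn0 : n ≠ 0 := by rintro rfl; apply hp; rw [← hnp]; simp
  have an1 : ∀ {z : ℂ}, z - a ≠ 0 → AnalyticAt ℂ (fun z => c + p / (z - a)) z := fun {z} hz =>
    analyticAt_const.fun_add (analyticAt_const.fun_div (analyticAt_id.fun_sub analyticAt_const) hz)
  have hd1 : ∀ z, ∀ᶠ w in 𝓝[≠] z, HasDerivAt (fun z => c + p / (z - a)) (-p / (w - a)^2) w := by
    intro z
    filter_upwards [evne a z] with w hw
    simpa using (hasDeriv_pole p a 0 hw).const_add c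
  have hd2 : ∀ z, ∀ᶠ w in 𝓝[≠] z, HasDerivAt (fun w => -p / (w - a)^2) (2 * p / (w - a)^3) w := by
    intro z
    filter_upwards [evne a z] with w hw
    refine (hasDeriv_pole (-p) a 1 hw).congr_deriv ?_
    push_cast; ring
  have h2 := h.R2 hr hd1
  have h3 := h.R3 hr hd1 hd2
  have hz1 : (a - p/c).im = 0 := by
    have : a - p/c - a ≠ 0 := by simp [hp, hc]
    refine h.R_zero (k := 1) (by omega) (by omega) (hr _) (hr _) (an1 this) (an1 this) ?_
    beta_reduce
    have : a - p/c - a = -p/c := by ring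
    rw [this]; field_simp; ring
  rcases lt_or_gt_of_ne hn0 with hneg | hpos
  · have hpR : p = ((n:ℝ):ℂ) := by rw [← hnp]; simp
    have hnR : (n:ℝ) < 0 := by exact_mod_cast hneg
    have hp1 : p - 1 ≠ 0 := by
      rw [hpR, ← Complex.ofReal_one, ← Complex.ofReal_sub, Complex.ofReal_ne_zero]; linarith
    have hp2 : p - 2 ≠ 0 := by
      rw [hpR, ← Complex.ofReal_ofNat, ← Complex.ofReal_sub, Complex.ofReal_ne_zero]; linarith
    obtain ⟨X, hX⟩ := IsAlgClosed.exists_pow_nat_eq p (n := 2) (by norm_num)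
    have e2 : (X / c + (a - p/c)).im = 0 := by
      have hw : X / c + (a - p/c) - a = (X - p)/c := by ring
      have hXp : X - p ≠ 0 := by
        intro h0
        have : X = p := by linear_combination h0
        rw [this] at hX
        have : p * (p - 1) = 0 := by linear_combination hX
        exact mul_ne_zero hp hp1 this
      have hne : X / c + (a - p/c) - a ≠ 0 := by rw [hw]; exact div_ne_zero hXp hc
      refine h.R_zero (k := 2) (by omega) (by omega) (hr _) (h2 _) (an1 hne)
        (((an1 hne).fun_pow 2).fun_add (analyticAt_const.fun_div
          ((analyticAt_id.fun_sub analyticAt_const).fun_pow 2) (pow_ne_zero 2 hne))) ?_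
      beta_reduce
      rw [hw]; field_simp
      linear_combination c^2 * hX
    rw [Complex.add_im, hz1, add_zero] at e2
    obtain ⟨x, hx⟩ : ∃ x : ℝ, X / c = x := ⟨(X/c).re, Complex.ext rfl (by simpa using e2)⟩
    have hx0 : x ≠ 0 := by
      rintro rfl
      rw [Complex.ofReal_zero, div_eq_zero_iff] at hx
      rcases hx with hx | hx
      · rw [hx] at hX; apply hp; rw [← hX]; ring
      · exact hc hx
    -- cubic
    obtain ⟨Y, hY⟩ : ∃ Y : ℂ, Y^3 - 3 * p * Y + 2 * p = 0 := by
      have hdeg : (Polynomial.X ^ 3 - Polynomial.C (3*p) * Polynomial.X + Polynomial.C (2*p) : Polynomial ℂ).degree ≠ 0 := by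
        have : (Polynomial.X ^ 3 - Polynomial.C (3*p) * Polynomial.X + Polynomial.C (2*p) : Polynomial ℂ).degree = 3 := by
          compute_degree!
        rw [this]; norm_num
      obtain ⟨Y, hY⟩ := IsAlgClosed.exists_root _ hdeg
      exact ⟨Y, by simpa [Polynomial.IsRoot] using hY⟩
    have e3 : (Y / c + (a - p/c)).im = 0 := by
      have hw : Y / c + (a - p/c) - a = (Y - p)/c := by ring
      have hXp : Y - p ≠ 0 := by
        intro h0
        have : Y = p := by linear_combination h0
        rw [this] at hY
        have : p * (p - 1) * (p - 2) = 0 := by linear_combination hY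
        exact mul_ne_zero (mul_ne_zero hp hp1) hp2 this
      have hne : Y / c + (a - p/c) - a ≠ 0 := by rw [hw]; exact div_ne_zero hXp hc
      refine h.R_zero (k := 3) (by omega) (by omega) (hr _) (h3 _) (an1 hne)
        ((((an1 hne).fun_pow 3).fun_add ((analyticAt_const.fun_mul (an1 hne)).fun_mul (analyticAt_const.fun_div
          ((analyticAt_id.fun_sub analyticAt_const).fun_pow 2) (pow_ne_zero 2 hne)))).fun_add
          (analyticAt_const.fun_div
          ((analyticAt_id.fun_sub analyticAt_const).fun_pow 3) (pow_ne_zero 3 hne))) ?_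
      beta_reduce
      rw [hw]; field_simp
      linear_combination c^3 * hY
    rw [Complex.add_im, hz1, add_zero] at e3
    obtain ⟨y, hy⟩ : ∃ y : ℝ, Y / c = y := ⟨(Y/c).re, Complex.ext rfl (by simpa using e3)⟩
    rw [div_eq_iff hc] at hx hy
    -- c^2 = p / x^2
    have hc2 : c^2 = ((n / x^2 : ℝ) : ℂ) := by
      have : (x:ℂ) ≠ 0 := by exact_mod_cast hx0
      push_cast
      rw [hx] at hX
      field_simp
      rw [hpR] at hX
      linear_combination hX
    have hcre : c.re = 0 := by
      have h1 := congrArg Complex.re hc2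
      have h2 := congrArg Complex.im hc2
      rw [Complex.ofReal_re] at h1
      rw [Complex.ofReal_im] at h2
      simp only [pow_two, Complex.mul_re, Complex.mul_im] at h1 h2
      have h3 : (n:ℝ) / (x*x) < 0 := div_neg_of_neg_of_pos hnR (mul_self_pos.2 hx0)
      have h4 : c.re * c.im = 0 := by linarith
      rcases mul_eq_zero.1 h4 with h5 | h5
      · exact h5
      · rw [h5] at h1; nlinarith
    have hci : c = c.im * I := by
      apply Complex.ext <;> simp [hcre]
    rw [hy, hpR, hci] at hY
    have h1 := congrArg Complex.re hY
    simp [pow_succ] at h1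
    linarith
  · have ha : a.im = 0 := by
      by_contra ha
      have := h.ord s (by omega) a ha
      rw [ho] at this
      have : n ≤ 0 := by exact_mod_cast this
      omega
    have cp : starRingEnd ℂ p = p := by rw [← hnp]; simp
    have ca := conj_of_im ha
    have cc : starRingEnd ℂ c = c := by
      have h1 := conj_of_im hz1
      rw [map_sub, map_div₀, cp, ca] at h1
      have h2 : p / starRingEnd ℂ c = p / c := by linear_combination -h1
      have hc' : starRingEnd ℂ c ≠ 0 := by simpa using hc
      field_simp at h2
      exact h2.symm
    exact h.not_real (by omega) hr hn (fun z => by simp [cc, cp, ca])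

/-- The conclusion of the theorem. -/
def Concl (f : ℂ → ℂ) : Prop :=
  ∃ (a b c d : ℂ) (μ : ℤ), MeroEq f (fun z => (a * z + b) ^ μ) ∨
    MeroEq f (fun z => (a * z + b) / (c * z + d)) ∨
    MeroEq f (fun z => Complex.exp (a * z + b) - c)

/-- no simple poles off the real axis for derivatives -/
theorem Hyp.ord_ne {F : ℕ → ℂ → ℂ} (h : Hyp F) {s : ℕ} (hs : s ≤ 9) {a : ℂ} (ha : a.im ≠ 0) :
    meromorphicOrderAt (F (s+1)) a ≠ ((-1 : ℤ) : WithTop ℤ) := by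
  intro ho
  rcases h.cases hs ha with ⟨n, hn, c1, c2⟩ | ⟨c1, c2⟩
  · rw [ho] at c2
    have := WithTop.coe_injective c2
    omega
  · rw [ho] at c2
    have := WithTop.coe_injective (c2 : ((-1 : ℤ) : WithTop ℤ) = ((0:ℤ) : WithTop ℤ))
    omega

theorem Hyp.formA_aux {F : ℕ → ℂ → ℂ} (h : Hyp F) {s : ℕ} (hs : s ≤ 6) {p q a b : ℂ} (hab : a ≠ b)
    (hp : p ≠ 0) (hq : q ≠ 0) (hb : b.im ≠ 0)
    (hr : MeroEq (F (s+1)) (fun z => (p / (z - a) + q / (z - b)) * F s z))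
    (hn : ¬ ∃ c : ℂ, MeroEq (mtilde (F s)) (fun z => c * F s z)) : Concl (F 0) := by
  have hab1 : a - b ≠ 0 := sub_ne_zero.2 hab
  have hba1 : b - a ≠ 0 := sub_ne_zero.2 hab.symm
  have anp : ∀ (p a : ℂ) (n : ℕ) {z : ℂ}, z - a ≠ 0 → AnalyticAt ℂ (fun z => p / (z - a)^n) z :=
    fun p a n z hz => analyticAt_const.fun_div ((analyticAt_id.fun_sub analyticAt_const).fun_pow n)
      (pow_ne_zero n hz)
  have anp1 : ∀ (p a : ℂ) {z : ℂ}, z - a ≠ 0 → AnalyticAt ℂ (fun z => p / (z - a)) z :=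
    fun p a z hz => analyticAt_const.fun_div (analyticAt_id.fun_sub analyticAt_const) hz
  obtain ⟨n, hon, hnp⟩ := h.ord_at (r := fun z => p / (z - a) + q / (z - b)) (g := fun z => q / (z - b))
    (by omega) (hr a) hp (fun w hw => rfl) (anp1 q b hab1)
  obtain ⟨m, hom, hmq⟩ := h.ord_at (r := fun z => p / (z - a) + q / (z - b)) (g := fun z => p / (z - a))
    (by omega) (hr b) hq (fun w hw => by ring) (anp1 p a hba1)
  have hn0 : n ≠ 0 := by rintro rfl; apply hp; rw [← hnp]; simp
  have hm0 : m ≠ 0 := by rintro rfl; apply hq; rw [← hmq]; simp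
  have hmneg : m < 0 := by
    have := h.ord s (by omega) b hb
    rw [hom] at this
    have : m ≤ 0 := by exact_mod_cast this
    omega
  have hd1 : ∀ z, ∀ᶠ w in 𝓝[≠] z, HasDerivAt (fun z => p / (z - a) + q / (z - b))
      (-p / (w - a)^2 + -q / (w - b)^2) w := by
    intro z
    filter_upwards [evne a z, evne b z] with w hw hw2
    simpa using (hasDeriv_pole p a 0 hw).fun_add (hasDeriv_pole q b 0 hw2)
  have hd2 : ∀ z, ∀ᶠ w in 𝓝[≠] z, HasDerivAt (fun w => -p / (w - a)^2 + -q / (w - b)^2)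
      (2 * p / (w - a)^3 + 2 * q / (w - b)^3) w := by
    intro z
    filter_upwards [evne a z, evne b z] with w hw hw2
    refine ((hasDeriv_pole (-p) a 1 hw).fun_add (hasDeriv_pole (-q) b 1 hw2)).congr_deriv ?_
    push_cast; ring
  have h2 := h.R2 hr hd1
  have h3 := h.R3 hr hd1 hd2
  have an1 : ∀ {z : ℂ}, z - a ≠ 0 → z - b ≠ 0 → AnalyticAt ℂ (fun z => p / (z - a) + q / (z - b)) z :=
    fun h1 h2 => (anp1 _ _ h1).fun_add (anp1 _ _ h2)
  have an2 : ∀ {z : ℂ}, z - a ≠ 0 → z - b ≠ 0 → AnalyticAt ℂ (fun w => -p / (w - a)^2 + -q / (w - b)^2) z :=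
    fun h1 h2 => (anp _ _ _ h1).fun_add (anp _ _ _ h2)
  have an3 : ∀ {z : ℂ}, z - a ≠ 0 → z - b ≠ 0 → AnalyticAt ℂ (fun w => 2*p / (w - a)^3 + 2*q / (w - b)^3) z :=
    fun h1 h2 => (anp _ _ _ h1).fun_add (anp _ _ _ h2)
  have Z1 : ∀ z, z - a ≠ 0 → z - b ≠ 0 → p * (z - b) + q * (z - a) = 0 → z.im = 0 := by
    intro z h1 h2 h0
    refine h.R_zero (k := 1) (by omega) (by omega) (hr _) (hr _) (an1 h1 h2) (an1 h1 h2) ?_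
    beta_reduce
    field_simp
    linear_combination h0
  have Z2 : ∀ z, z - a ≠ 0 → z - b ≠ 0 →
      (p*(p-1)) * (z - b)^2 + (q*(q-1)) * (z - a)^2 + 2*p*q*(z-a)*(z-b) = 0 → z.im = 0 := by
    intro z h1 h2' h0
    refine h.R_zero (k := 2) (by omega) (by omega) (hr _) (h2 _) (an1 h1 h2')
      (((an1 h1 h2').fun_pow 2).fun_add (an2 h1 h2')) ?_
    beta_reduce
    field_simp
    linear_combination h0
  have Z3 : ∀ z, z - a ≠ 0 → z - b ≠ 0 →
      (p*(p-1)*(p-2)) * (z - b)^3 + (q*(q-1)*(q-2)) * (z - a)^3 + 3*p*(p-1)*q*(z-a)*(z-b)^2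
        + 3*p*q*(q-1)*(z-a)^2*(z-b) = 0 → z.im = 0 := by
    intro z h1 h2' h0
    refine h.R_zero (k := 3) (by omega) (by omega) (hr _) (h3 _) (an1 h1 h2')
      ((((an1 h1 h2').fun_pow 3).fun_add ((analyticAt_const.fun_mul (an1 h1 h2')).fun_mul
        (an2 h1 h2'))).fun_add (an3 h1 h2')) ?_
    beta_reduce
    field_simp
    linear_combination h0
  have hpR : p = ((n:ℝ):ℂ) := by rw [← hnp]; simp
  have hqR : q = ((m:ℝ):ℂ) := by rw [← hmq]; simp
  by_cases hσ : n + m = 0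
  · have hpos : 0 < n := by omega
    have ha : a.im = 0 := by
      by_contra ha
      have := h.ord s (by omega) a ha
      rw [hon] at this
      have : n ≤ 0 := by exact_mod_cast this
      omega
    have hqp : q = -p := by
      rw [← hmq, ← hnp, show m = -n by omega]; simp
    by_cases hn1 : n = 1
    · have hp1 : p = 1 := by rw [← hnp, hn1]; simp
      have hs0 : s = 0 := by
        by_contra hs0
        obtain ⟨t, rfl⟩ : ∃ t, s = t + 1 := ⟨s - 1, by omega⟩
        apply h.ord_ne (s := t) (by omega) hb
        rw [hom, show m = -1 by omega]
      subst hs0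
      subst hqp
      subst hp1
      obtain ⟨C, hC⟩ := mero_prop (a := F 0) (b := fun z => (z - a) / (z - b)) (h.mero 0)
        (fun z => ((MeromorphicAt.id z).fun_sub (MeromorphicAt.const a z)).fun_div
          ((MeromorphicAt.id z).fun_sub (MeromorphicAt.const b z)))
        (fun z => by
          filter_upwards [evne a z, evne b z] with w h1 h2
          exact div_ne_zero h1 h2)
        (fun z => by
          filter_upwards [evne a z, evne b z, hr z] with w h1 h2 h3
          rw [← h.der 0, h3]
          have hd := (((hasDerivAt_id w).sub_const a).fun_div ((hasDerivAt_id w).sub_const b) h2).deriv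
          simp only [id] at hd
          rw [hd]
          field_simp
          ring)
      refine ⟨C, -C*a, 1, -b, 0, Or.inr (Or.inl (hC.trans fun z => ?_))⟩
      filter_upwards with w
      rw [show (1:ℂ) * w + -b = w - b by ring]
      ring
    · exfalso
      have hn2 : 2 ≤ n := by omega
      have hnR : (2:ℝ) ≤ n := by exact_mod_cast hn2
      have hpm : p - 1 ≠ 0 := by
        rw [hpR, ← Complex.ofReal_one, ← Complex.ofReal_sub, Complex.ofReal_ne_zero]; linarith
      have hpp : p + 1 ≠ 0 := by
        rw [hpR, ← Complex.ofReal_one, ← Complex.ofReal_add, Complex.ofReal_ne_zero]; linarith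
      have hz := Z2 (a + (p - 1) * (a - b) / 2) (by
          rw [add_sub_cancel_left]; exact div_ne_zero (mul_ne_zero hpm hab1) (by norm_num)) (by
          rw [show a + (p - 1) * (a - b) / 2 - b = (p+1) * (a - b)/2 by ring]
          exact div_ne_zero (mul_ne_zero hpp hab1) (by norm_num)) (by rw [hqp]; ring)
      rw [hpR, show a + (((n:ℝ):ℂ) - 1) * (a - b) / 2 = a + (((n - 1)/2 : ℝ) : ℂ) * (a - b) by push_cast; ring] at hz
      rw [Complex.add_im, Complex.im_ofReal_mul, Complex.sub_im, ha] at hz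
      have : ((n:ℝ) - 1)/2 * b.im = 0 := by linarith
      rcases mul_eq_zero.1 this with h1 | h1
      · linarith
      · exact hb h1
  exfalso
  have hσR : ((n:ℝ) + m) ≠ 0 := by exact_mod_cast hσ
  have hσC : p + q ≠ 0 := by
    rw [hpR, hqR, ← Complex.ofReal_add, Complex.ofReal_ne_zero]; exact hσR
  set β := (p * b + q * a) / (p + q) with hβ
  set t := (a - b) / (p + q) with ht
  have ht0 : t ≠ 0 := div_ne_zero hab1 hσC
  have eab : a = β + p * t := by rw [hβ, ht]; field_simp; ring
  have ebb : b = β - q * t := by rw [hβ, ht]; field_simp; ring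
  have hβr : β.im = 0 := by
    apply Z1
    · rw [eab, show β - (β + p*t) = -(p * t) by ring]; exact neg_ne_zero.2 (mul_ne_zero hp ht0)
    · rw [ebb, show β - (β - q*t) = (q * t) by ring]; exact mul_ne_zero hq ht0
    · rw [eab, ebb]; ring
  have htim : t.im ≠ 0 := by
    intro h0
    apply hb
    rw [ebb, hqR, Complex.sub_im, Complex.im_ofReal_mul, hβr, h0]; simp
  have ha : a.im ≠ 0 := by
    rw [eab, hpR, Complex.add_im, Complex.im_ofReal_mul, hβr, zero_add]
    exact mul_ne_zero (by exact_mod_cast hn0) htim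
  have hnneg : n < 0 := by
    have := h.ord s (by omega) a ha
    rw [hon] at this
    have : n ≤ 0 := by exact_mod_cast this
    omega
  have hnR : (n:ℝ) < 0 := by exact_mod_cast hnneg
  have hmR : (m:ℝ) < 0 := by exact_mod_cast hmneg
  have nzr : ∀ x : ℝ, x < 0 → (x:ℂ) ≠ 0 := fun x hx => by exact_mod_cast hx.ne
  have p1 : p - 1 ≠ 0 := by
    rw [hpR]; have := nzr (n - 1) (by linarith); push_cast at this ⊢; exact this
  have q1 : q - 1 ≠ 0 := by
    rw [hqR]; have := nzr (m - 1) (by linarith); push_cast at this ⊢; exact this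
  have p2 : p - 2 ≠ 0 := by
    rw [hpR]; have := nzr (n - 2) (by linarith); push_cast at this ⊢; exact this
  have q2 : q - 2 ≠ 0 := by
    rw [hqR]; have := nzr (m - 2) (by linarith); push_cast at this ⊢; exact this
  have σ1 : p + q - 1 ≠ 0 := by
    rw [hpR, hqR]; have := nzr (n + m - 1) (by linarith); push_cast at this ⊢; exact this
  have σ2 : p + q - 2 ≠ 0 := by
    rw [hpR, hqR]; have := nzr (n + m - 2) (by linarith); push_cast at this ⊢; exact this
  -- second derivative
  obtain ⟨x, hx⟩ := IsAlgClosed.exists_pow_nat_eq (p * q * t^2 / (p + q - 1)) (n := 2) (by norm_num)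
  have hx' : (p + q - 1) * x^2 = p * q * t^2 := by rw [hx]; field_simp
  have hxr : (β + x).im = 0 := by
    apply Z2
    · rw [eab, show β + x - (β + p*t) = x - p * t by ring]
      intro h0
      have : x = p * t := by linear_combination h0
      rw [this] at hx'
      have : p * (p - 1) * (p + q) * t^2 = 0 := by linear_combination hx'
      exact mul_ne_zero (mul_ne_zero (mul_ne_zero hp p1) hσC) (pow_ne_zero 2 ht0) this
    · rw [ebb, show β + x - (β - q*t) = x + q * t by ring]
      intro h0
      have : x = -(q * t) := by linear_combination h0
      rw [this] at hx'
      have : q * (q - 1) * (p + q) * t^2 = 0 := by linear_combination hx'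
      exact mul_ne_zero (mul_ne_zero (mul_ne_zero hq q1) hσC) (pow_ne_zero 2 ht0) this
    · rw [eab, ebb]; linear_combination (p + q) * hx'
  rw [Complex.add_im, hβr, zero_add] at hxr
  have htre : t.re = 0 := by
    obtain ⟨y, rfl⟩ : ∃ y : ℝ, x = y := ⟨x.re, Complex.ext rfl (by simpa using hxr)⟩
    rw [hpR, hqR] at hx'
    have h1 := congrArg Complex.im hx'
    have e1 : (((n:ℝ):ℂ) + ((m:ℝ):ℂ) - 1) * (y:ℂ)^2 = (((n + m - 1) * y^2 : ℝ) : ℂ) := by push_cast; ring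
    rw [e1, Complex.ofReal_im, ← Complex.ofReal_mul, Complex.im_ofReal_mul, pow_two, Complex.mul_im] at h1
    have h2 : (n:ℝ) * m ≠ 0 := mul_ne_zero hnR.ne hmR.ne
    have h3 : t.re * t.im + t.im * t.re = 0 := by
      rcases mul_eq_zero.1 h1.symm with h3 | h3
      · exact absurd h3 h2
      · exact h3
    have h4 : t.re * t.im = 0 := by linarith
    rcases mul_eq_zero.1 h4 with h5 | h5
    · exact h5
    · exact absurd h5 htim
  have hti : t = t.im * I := by apply Complex.ext <;> simp [htre]
  -- third derivative
  obtain ⟨Y, hY⟩ : ∃ Y : ℂ, (p+q-1)*(p+q-2) * Y^3 + (-3 * p * q * (p+q-2) * t^2) * Y + 2 * p * q * (q - p) * t^3 = 0 := by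
    have hl : (p+q-1)*(p+q-2) ≠ 0 := mul_ne_zero σ1 σ2
    generalize (p+q-1)*(p+q-2) = A at hl
    generalize (-3 * p * q * (p+q-2) * t^2) = B
    generalize 2 * p * q * (q - p) * t^3 = D
    have hdeg : (Polynomial.C A * Polynomial.X ^ 3 + Polynomial.C B * Polynomial.X + Polynomial.C D : Polynomial ℂ).degree ≠ 0 := by
      have : (Polynomial.C A * Polynomial.X ^ 3 + Polynomial.C B * Polynomial.X + Polynomial.C D : Polynomial ℂ).degree = 3 := by
        compute_degree!
      rw [this]; norm_num
    obtain ⟨Y, hY⟩ := IsAlgClosed.exists_root _ hdeg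
    exact ⟨Y, by simpa [Polynomial.IsRoot] using hY⟩
  have hYr : (β + Y).im = 0 := by
    apply Z3
    · rw [eab, show β + Y - (β + p*t) = Y - p * t by ring]
      intro h0
      have : Y = p * t := by linear_combination h0
      rw [this] at hY
      have : p * (p - 1) * (p-2) * (p + q)^2 * t^3 = 0 := by linear_combination hY
      exact mul_ne_zero (mul_ne_zero (mul_ne_zero (mul_ne_zero hp p1) p2) (pow_ne_zero 2 hσC)) (pow_ne_zero 3 ht0) this
    · rw [ebb, show β + Y - (β - q*t) = Y + q * t by ring]
      intro h0
      have : Y = -(q * t) := by linear_combination h0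
      rw [this] at hY
      have : q * (q - 1) * (q-2) * (p + q)^2 * t^3 = 0 := by linear_combination -hY
      exact mul_ne_zero (mul_ne_zero (mul_ne_zero (mul_ne_zero hq q1) q2) (pow_ne_zero 2 hσC)) (pow_ne_zero 3 ht0) this
    · rw [eab, ebb]; linear_combination (p + q) * hY
  rw [Complex.add_im, hβr, zero_add] at hYr
  have hpq : p = q := by
    obtain ⟨y, rfl⟩ : ∃ y : ℝ, Y = y := ⟨Y.re, Complex.ext rfl (by simpa using hYr)⟩
    have e1 : (((n + m - 1)*(n+m-2) * y^3 + 3 * n * m * (n+m-2) * t.im^2 * y : ℝ) : ℂ)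
        + ((-2 * n * m * (m - n) * t.im^3 : ℝ) : ℂ) * I = 0 := by
      rw [← hY]
      rw [hpR, hqR]
      conv_rhs => rw [hti]
      have hI3 : Complex.I ^ 3 = -Complex.I := by rw [pow_succ, I_sq]; ring
      push_cast
      simp only [mul_pow, I_sq, hI3]
      ring
    have h1 := congrArg Complex.im e1
    simp only [Complex.add_im, Complex.ofReal_im, Complex.im_ofReal_mul, Complex.I_im, Complex.zero_im] at h1
    have h2 : (n:ℝ) * m * t.im^3 ≠ 0 := mul_ne_zero (mul_ne_zero hnR.ne hmR.ne) (pow_ne_zero 3 htim)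
    have h3 : ((n:ℝ) * m * t.im^3) * (m - n) = 0 := by linarith
    have h4 : (m:ℝ) - n = 0 := (mul_eq_zero.1 h3).resolve_left h2
    rw [hpR, hqR]; congr 1; linarith
  have cp : starRingEnd ℂ p = p := by rw [hpR]; simp
  have ct : starRingEnd ℂ t = -t := by
    rw [hti]; simp
  have cb : starRingEnd ℂ b = a := by
    rw [ebb, eab, map_sub, map_mul, conj_of_im hβr, ct, ← hpq, cp]; ring
  have ca : starRingEnd ℂ a = b := by rw [← cb, Complex.conj_conj]
  refine h.not_real (by omega) hr hn (fun z => ?_)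
  rw [← hpq]
  simp only [map_add, map_div₀, map_sub, Complex.conj_conj, cp, ca, cb]
  ring

theorem Hyp.formA {F : ℕ → ℂ → ℂ} (h : Hyp F) {s : ℕ} (hs : s ≤ 6) {p q a b : ℂ} (hab : a ≠ b)
    (hp : p ≠ 0) (hq : q ≠ 0)
    (hr : MeroEq (F (s+1)) (fun z => (p / (z - a) + q / (z - b)) * F s z))
    (hn : ¬ ∃ c : ℂ, MeroEq (mtilde (F s)) (fun z => c * F s z)) : Concl (F 0) := by
  by_cases hb : b.im ≠ 0
  · exact h.formA_aux hs hab hp hq hb hr hn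
  by_cases ha : a.im ≠ 0
  · refine h.formA_aux hs hab.symm hq hp ha (hr.trans fun z => ?_) hn
    filter_upwards with w
    ring
  exfalso
  push Not at ha hb
  have anp1 : ∀ (p a : ℂ) {z : ℂ}, z - a ≠ 0 → AnalyticAt ℂ (fun z => p / (z - a)) z :=
    fun p a z hz => analyticAt_const.fun_div (analyticAt_id.fun_sub analyticAt_const) hz
  obtain ⟨n, hon, hnp⟩ := h.ord_at (r := fun z => p / (z - a) + q / (z - b)) (g := fun z => q / (z - b))
    (by omega) (hr a) hp (fun w hw => rfl) (anp1 q b (sub_ne_zero.2 hab))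
  obtain ⟨m, hom, hmq⟩ := h.ord_at (r := fun z => p / (z - a) + q / (z - b)) (g := fun z => p / (z - a))
    (by omega) (hr b) hq (fun w hw => by ring) (anp1 p a (sub_ne_zero.2 hab.symm))
  refine h.not_real (by omega) hr hn (fun z => ?_)
  simp [← hnp, ← hmq, conj_of_im ha, conj_of_im hb]

theorem root_avg {k : ℕ} (hk : 2 ≤ k) {w a : ℂ} (hw : w ≠ 0)
    (hroot : ∀ x : ℂ, x ^ k = w → (a + x).im = 0) : a.im = 0 := by
  obtain ⟨x, hx⟩ := IsAlgClosed.exists_pow_nat_eq w (n := k) (by omega)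
  have hprim := Complex.isPrimitiveRoot_exp k (by omega)
  set ω := cexp (2 * Real.pi * I / k) with hω
  have hs : ∑ i ∈ Finset.range k, ω ^ i = 0 := hprim.geom_sum_eq_zero (by omega)
  have h1 : ∀ i ∈ Finset.range k, (a + x * ω^i).im = 0 := by
    intro i _
    apply hroot
    rw [mul_pow, hx, ← pow_mul, mul_comm i k, pow_mul, hprim.pow_eq_one, one_pow, mul_one]
  have h2 : (∑ i ∈ Finset.range k, (a + x * ω^i)).im = 0 := by
    rw [Complex.im_sum]; exact Finset.sum_eq_zero h1
  rw [Finset.sum_add_distrib, ← Finset.mul_sum, hs, mul_zero, add_zero, Finset.sum_const,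
    Finset.card_range, nsmul_eq_mul] at h2
  have h3 : (k:ℝ) * a.im = 0 := by
    have : ((k:ℂ) * a).im = (k:ℝ) * a.im := by
      rw [← Complex.ofReal_natCast, Complex.im_ofReal_mul]
    rw [← this, h2]
  rcases mul_eq_zero.1 h3 with h4 | h4
  · have : k = 0 := by exact_mod_cast h4
    omega
  · exact h4

theorem Hyp.B_form {F : ℕ → ℂ → ℂ} (h : Hyp F) {s : ℕ} (hs : s ≤ 6) {p a : ℂ}
    (hr : MeroEq (F (s+1)) (fun z => (p / (z - a)) * F s z)) :
    ∃ (n : ℤ) (C : ℂ), n ≠ 0 ∧ C ≠ 0 ∧ (n:ℂ) = p ∧ meromorphicOrderAt (F s) a = n ∧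
      MeroEq (F s) (fun z => C * (z - a)^n) := by
  have hp : p ≠ 0 := by
    rintro rfl
    obtain ⟨w, h1, h2⟩ := ((h.nz (m := s+1) (by omega) 0).and (hr 0)).exists
    apply h1; rw [h2]; simp
  obtain ⟨n, ho, hnp⟩ := h.ord_at (r := fun z => p / (z - a)) (g := fun _ => 0) (by omega) (hr a) hp
    (fun w hw => by simp) analyticAt_const
  have hn0 : n ≠ 0 := by rintro rfl; apply hp; rw [← hnp]; simp
  obtain ⟨C, hC⟩ := mero_prop (a := F s) (b := fun z => (z - a)^n) (h.mero s)
    (fun z => ((MeromorphicAt.id z).fun_sub (MeromorphicAt.const a z)).fun_zpow n)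
    (fun z => by
      filter_upwards [evne a z] with w h1
      exact zpow_ne_zero n h1)
    (fun z => by
      filter_upwards [evne a z, hr z] with w h1 h3
      rw [← h.der s, h3]
      have hd : HasDerivAt (fun z => (z - a)^n) (n * (w - a)^(n-1)) w := by
        have := (hasDerivAt_zpow n (w - a) (Or.inl h1)).comp w ((hasDerivAt_id w).sub_const a)
        rw [mul_one] at this
        exact this
      rw [hd.deriv, zpow_sub_one₀ h1, hnp]
      field_simp)
  refine ⟨n, C, hn0, ?_, hnp, ho, hC⟩
  rintro rfl
  obtain ⟨w, h1, h2⟩ := ((h.nz (m := s) (by omega) 0).and (hC 0)).exists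
  apply h1; rw [h2]; simp

theorem zpow_root {C : ℂ} (hC : C ≠ 0) {n : ℤ} (hn : n ≠ 0) : ∃ x : ℂ, x ^ n = C := by
  rcases Int.eq_nat_or_neg n with ⟨k, rfl | rfl⟩
  · obtain ⟨x, hx⟩ := IsAlgClosed.exists_pow_nat_eq C (n := k) (by omega)
    exact ⟨x, by rw [zpow_natCast, hx]⟩
  · obtain ⟨x, hx⟩ := IsAlgClosed.exists_pow_nat_eq C⁻¹ (n := k) (by omega)
    exact ⟨x, by rw [zpow_neg, zpow_natCast, hx, inv_inv]⟩

theorem Hyp.formB {F : ℕ → ℂ → ℂ} (h : Hyp F)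
    (hn : ∀ t ≤ 8, ¬ ∃ c : ℂ, MeroEq (mtilde (F t)) (fun z => c * F t z)) (s : ℕ) :
    ∀ (hs : s ≤ 6) {p a : ℂ},
    MeroEq (F (s+1)) (fun z => (p / (z - a)) * F s z) → Concl (F 0) := by
  induction s with
  | zero =>
    intro hs p a hr
    obtain ⟨n, C, hn0, hC0, hnp, ho, hC⟩ := h.B_form hs hr
    obtain ⟨x, hx⟩ := zpow_root hC0 hn0
    refine ⟨x, -x*a, 0, 0, n, Or.inl (hC.trans fun z => ?_)⟩
    filter_upwards with w
    rw [show x * w + -x*a = x * (w - a) by ring, mul_zpow, hx]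
  | succ t ih =>
    intro hs p a hr
    obtain ⟨n, C, hn0, hC0, hnp, ho, hC⟩ := h.B_form hs hr
    have cp : starRingEnd ℂ p = p := by rw [← hnp]; simp
    have ha : a.im ≠ 0 := fun ha => h.not_real (by omega) hr (hn _ (by omega))
      (fun z => by simp [cp, conj_of_im ha])
    obtain ⟨m, hm, c1, c2⟩ : ∃ m : ℤ, m < 0 ∧ meromorphicOrderAt (F t) a = m ∧ n = m - 1 := by
      rcases h.cases (m := t) (by omega) ha with ⟨m, hm, c1, c2⟩ | ⟨c1, c2⟩
      · rw [ho] at c2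
        exact ⟨m, hm, c1, WithTop.coe_injective c2⟩
      · rw [ho] at c2
        exact absurd (WithTop.coe_injective (c2 : (n : WithTop ℤ) = ((0:ℤ) : WithTop ℤ))) hn0
    have hmc : (m:ℂ) ≠ 0 := by exact_mod_cast hm.ne
    have hpm : p = m - 1 := by rw [← hnp, c2]; push_cast; ring
    obtain ⟨d, hd⟩ := mero_const (h := fun z => F t z - (z - a) * F (t+1) z / m)
      (fun z => (h.mero t z).fun_sub ((((MeromorphicAt.id z).fun_sub (MeromorphicAt.const a z)).fun_mul
        (h.mero (t+1) z)).fun_div (MeromorphicAt.const _ z))) (by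
        intro z
        filter_upwards [hr z, evne a z, (h.mero t z).eventually_analyticAt,
          (h.mero (t+1) z).eventually_analyticAt] with w e1 e2 e3 e4
        have d3 := e3.differentiableAt.hasDerivAt
        have d4 := e4.differentiableAt.hasDerivAt
        rw [← h.der t] at d3
        rw [← h.der (t+1), e1] at d4
        have := d3.fun_sub (((((hasDerivAt_id w).sub_const a).fun_mul d4)).div_const (m:ℂ))
        refine this.deriv.trans ?_
        simp only [id, hpm]
        field_simp
        ring)
    by_cases hd0 : d = 0
    · refine ih (by omega) (p := m) (a := a) fun z => ?_
      filter_upwards [hd z, evne a z] with w h1 h2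
      rw [hd0] at h1
      field_simp at h1 ⊢
      linear_combination -h1
    · have hF : MeroEq (F t) (fun z => d + (C/m) * (z - a)^m) := by
        intro z
        filter_upwards [hd z, evne a z, hC z] with w h1 h2 h3
        rw [h3, c2, zpow_sub_one₀ h2] at h1
        field_simp at h1 ⊢
        linear_combination h1
      obtain ⟨k, hk⟩ : ∃ k : ℕ, m = -(k:ℤ) := ⟨m.natAbs, by omega⟩
      by_cases hk1 : k = 1
      · rcases t with _ | u
        · refine ⟨d, C/m - d*a, 1, -a, 0, Or.inr (Or.inl (hF.trans fun z => ?_))⟩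
          filter_upwards [evne a z] with w hw
          rw [show (1:ℂ) * w + -a = w - a by ring]
          have : (w - a)^m = (w-a)⁻¹ := by rw [hk, hk1]; simp
          rw [this]
          field_simp
          ring
        · exfalso
          apply h.ord_ne (s := u) (by omega) ha
          rw [c1, hk, hk1]; rfl
      · exfalso
        apply ha
        refine root_avg (k := k) (w := -(C/m)/d) (by omega) (by
          exact div_ne_zero (neg_ne_zero.2 (div_ne_zero hC0 hmc)) hd0) fun x hx => ?_
        have hx0 : x ≠ 0 := by
          rintro rfl
          rw [zero_pow (by omega)] at hx
          exact (div_ne_zero (neg_ne_zero.2 (div_ne_zero hC0 hmc)) hd0) hx.symm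
        have hxa : a + x - a ≠ 0 := by simpa using hx0
        refine h.real_zero (m := t) (by omega) (hF (a + x)) ?_ ?_
        · exact analyticAt_const.fun_add (analyticAt_const.fun_mul
            ((analyticAt_id.fun_sub analyticAt_const).fun_zpow hxa))
        · rw [add_sub_cancel_left]
          have hzp : x ^ m = (x ^ k)⁻¹ := by rw [hk, zpow_neg, zpow_natCast]
          rw [hzp, hx]
          field_simp
          ring

theorem Hyp.D_form {F : ℕ → ℂ → ℂ} (h : Hyp F) {s : ℕ} (hs : s ≤ 6) {c : ℂ}
    (hr : MeroEq (F (s+1)) (fun z => c * F s z)) :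
    ∃ (C : ℂ), C ≠ 0 ∧ MeroEq (F s) (fun z => C * cexp (c * z)) := by
  have hde : ∀ w, HasDerivAt (fun z => cexp (c * z)) (c * cexp (c * w)) w := fun w =>
    (((hasDerivAt_id w).const_mul c).cexp).congr_deriv (by simp; ring)
  obtain ⟨C, hC⟩ := mero_prop (a := F s) (b := fun z => cexp (c * z)) (h.mero s)
    (fun z => (show AnalyticAt ℂ (fun z => cexp (c * z)) z by fun_prop).meromorphicAt)
    (fun z => by
      filter_upwards with w
      exact Complex.exp_ne_zero _)
    (fun z => by
      filter_upwards [hr z] with w h3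
      rw [← h.der s, h3, (hde w).deriv]
      ring)
  refine ⟨C, ?_, hC⟩
  rintro rfl
  obtain ⟨w, h1, h2⟩ := ((h.nz (m := s) (by omega) 0).and (hC 0)).exists
  apply h1; rw [h2]; simp

theorem D_contra {F : ℕ → ℂ → ℂ} (h : Hyp F) {t : ℕ} (ht : t ≤ 6) {c C d e : ℂ} (hc : c ≠ 0)
    (hC : C ≠ 0) (hd : d ≠ 0)
    (h0 : MeroEq (F t) (fun z => C * cexp (c * z) + d * z + e))
    (h1 : MeroEq (F (t+1)) (fun z => c * C * cexp (c * z) + d))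
    (h2 : MeroEq (F (t+2)) (fun z => c^2 * C * cexp (c * z))) : False := by
  have hde : ∀ w, HasDerivAt (fun z => cexp (c * z)) (c * cexp (c * w)) w := fun w =>
    (((hasDerivAt_id w).const_mul c).cexp).congr_deriv (by simp; ring)
  -- c is purely imaginary
  have hzr : ∀ x : ℂ, cexp x = -d / (c * C) → (x / c).im = 0 := by
    intro x hx
    refine h.real_zero (m := t+1) (by omega) (h1 _) (by fun_prop) ?_
    rw [mul_div_cancel₀ _ hc, hx]
    field_simp
    ring
  have hne : -d / (c * C) ≠ 0 := div_ne_zero (neg_ne_zero.2 hd) (mul_ne_zero hc hC)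
  have e1 := hzr (Complex.log (-d / (c * C))) (Complex.exp_log hne)
  have e2 := hzr (Complex.log (-d / (c * C)) + 2 * Real.pi * I) (by
    rw [Complex.exp_periodic, Complex.exp_log hne])
  have e3 : ((2 * Real.pi : ℝ) * (I * c⁻¹)).im = 0 := by
    have : ((2 * Real.pi : ℝ) * (I * c⁻¹)) = (Complex.log (-d / (c * C)) + 2 * Real.pi * I)/c
       - Complex.log (-d / (c * C)) / c := by push_cast; field_simp; ring
    rw [this, Complex.sub_im, e1, e2, sub_zero]
  rw [Complex.im_ofReal_mul] at e3
  have e4 : (c⁻¹).re = 0 := by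
    rcases mul_eq_zero.1 e3 with h5 | h5
    · exact absurd h5 (by positivity)
    · simpa using h5
  have cc : starRingEnd ℂ c = -c := by
    rw [Complex.inv_re] at e4
    have : c.re = 0 := by
      rcases div_eq_zero_iff.1 e4 with h5 | h5
      · exact h5
      · exact absurd (Complex.normSq_eq_zero.1 h5) hc
    apply Complex.ext <;> simp [this]
  -- K
  obtain ⟨k, hk1, hk2⟩ := h.KK_exp (m := t) (by omega)
  set p := k.derivative with hp
  have hKd : ∀ z, HasDerivAt (KK F t) (p.eval z * KK F t z) z := by
    intro z
    have h1 := (h.KK_an (m := t) (by omega) z).differentiableAt.hasDerivAt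
    refine h1.congr_deriv ?_
    rw [← hk2, kd, div_mul_cancel₀ _ (h.KK_ne (by omega) z)]
  have hKdiff : Differentiable ℂ (KK F t) := fun z => (hKd z).differentiableAt
  set C' := starRingEnd ℂ C with hC'
  set d' := starRingEnd ℂ d with hd'
  set e' := starRingEnd ℂ e with he'
  have hC'0 : C' ≠ 0 := by simpa [hC'] using hC
  have hd'0 : d' ≠ 0 := by simpa [hd'] using hd
  have texp : ∀ w, starRingEnd ℂ (cexp (c * starRingEnd ℂ w)) = (cexp (c * w))⁻¹ := by
    intro w
    rw [← Complex.exp_conj, map_mul, Complex.conj_conj, cc, neg_mul, Complex.exp_neg]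
  have g0 : MeroEq (mtilde (F t)) (fun z => C' * (cexp (c * z))⁻¹ + d' * z + e') := by
    refine h0.mtilde.trans fun z => ?_
    filter_upwards with w
    simp only [mtilde, map_add, map_mul, texp, Complex.conj_conj]
    rfl
  have g1 : MeroEq (mtilde (F (t+1))) (fun z => -c * C' * (cexp (c * z))⁻¹ + d') := by
    refine h1.mtilde.trans fun z => ?_
    filter_upwards with w
    simp only [mtilde, map_add, map_mul, texp, cc]
    rfl
  have g2 : MeroEq (mtilde (F (t+2))) (fun z => c^2 * C' * (cexp (c * z))⁻¹) := by
    refine h2.mtilde.trans fun z => ?_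
    filter_upwards with w
    simp only [mtilde, map_mul, map_pow, texp, cc]
    rw [neg_pow, ← hC']
    ring
  have key : ∀ z, KK F t z * (C' * ((C' + cexp (c*z) * (d'*z+e')) * (c * C * cexp (c*z) + d)^2))
      = C * (cexp (c*z) * ((C * cexp (c*z) + d*z+e) * (-c*C' + d' * cexp (c*z))^2)) := by
    have hM : MeroEq (fun z => KK F t z * (C' * ((C' + cexp (c*z) * (d'*z+e')) * (c * C * cexp (c*z) + d)^2)))
       (fun z => C * (cexp (c*z) * ((C * cexp (c*z) + d*z+e) * (-c*C' + d' * cexp (c*z))^2))) := by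
      intro z
      filter_upwards [h0 z, h1 z, h2 z, g0 z, g1 z, g2 z, h.KK_eq t z, h.nz (m := t) (by omega) z,
        h.nz (m := t+1) (by omega) z, h.tl.nz (m := t) (by omega) z, h.tl.nz (m := t+1) (by omega) z]
        with w a0 a1 a2 b0 b1 b2 a3 n0 n1 m0 m1
      have hE : cexp (c * w) ≠ 0 := Complex.exp_ne_zero _
      have m0' : mtilde (F t) w ≠ 0 := m0
      have m1' : mtilde (F (t+1)) w ≠ 0 := m1
      rw [a3]
      simp only [uu, Pi.div_apply, Pi.mul_apply, cj]
      have k0 : C' + cexp (c * w) * (d' * w + e') = cexp (c*w) * mtilde (F t) w := by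
        rw [b0]; field_simp; ring
      have k1 : -c*C' + d' * cexp (c*w) = cexp (c*w) * mtilde (F (t+1)) w := by
        rw [b1]; field_simp
      rw [k0, k1, ← a0, ← a1, a2, b2]
      field_simp
    intro z
    refine hM.eq_of_cont ?_ ?_
    · have := hKdiff z |>.continuousAt
      refine this.mul ?_
      fun_prop
    · fun_prop
  -- differentiate
  have rel : ∀ z, p.eval z * (((C * cexp (c*z) + d*z+e) * (-c*C' + d' * cexp (c*z))^2)
        * ((C' + cexp (c*z) * (d'*z+e')) * (c * C * cexp (c*z) + d)^2))
      + ((C * cexp (c*z) + d*z+e) * (-c*C' + d' * cexp (c*z))^2) *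
        ((c * cexp (c*z) * (d'*z+e') + cexp (c*z) * d') * (c * C * cexp (c*z) + d)^2
          + (C' + cexp (c*z) * (d'*z+e')) * (2 * (c * C * cexp (c*z) + d) * (c * C * (c * cexp (c*z)))))
      = ((C' + cexp (c*z) * (d'*z+e')) * (c * C * cexp (c*z) + d)^2) *
        (c * ((C * cexp (c*z) + d*z+e) * (-c*C' + d' * cexp (c*z))^2)
          + ((C * (c * cexp (c*z)) + d) * (-c*C' + d' * cexp (c*z))^2
            + (C * cexp (c*z) + d*z+e) * (2 * (-c*C' + d' * cexp (c*z)) * (d' * (c * cexp (c*z)))))) := by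
    intro z
    have hid := hasDerivAt_id z
    have dA := (hKd z).fun_mul ((((hde z).fun_mul ((hid.const_mul d').add_const e')).const_add C').fun_mul
      ((((hde z).const_mul (c*C)).add_const d).fun_pow 2) |>.const_mul C')
    have dB := ((hde z).fun_mul (((((hde z).const_mul C).fun_add (hid.const_mul d)).add_const e).fun_mul
      ((((hde z).const_mul d').const_add (-c*C')).fun_pow 2))).const_mul C
    simp only [id] at dA dB
    have dA' := dA.congr_of_eventuallyEq (f₁ := fun z => C * (cexp (c*z) * ((C * cexp (c*z) + d*z+e) * (-c*C' + d' * cexp (c*z))^2)))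
      (Filter.Eventually.of_forall fun z => (key z).symm)
    have hu := dA'.unique dB
    have kz := key z
    have hE : cexp (c * z) ≠ 0 := Complex.exp_ne_zero _
    generalize cexp (c * z) = E at *
    generalize KK F t z = K at *
    generalize p.eval z = P at *
    simp only [Nat.cast_ofNat, Nat.reduceSub, pow_one, mul_one] at hu
    have hCE : C * E ≠ 0 := mul_ne_zero hC hE
    apply mul_left_cancel₀ hCE
    linear_combination ((C' + E * (d'*z+e')) * (c * C * E + d)^2) * hu - (P * ((C' + E * (d'*z+e')) * (c * C * E + d)^2) + ((c * E * (d'*z+e') + E * d') * (c * C * E + d)^2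
          + (C' + E * (d'*z+e')) * (2 * (c * C * E + d) * (c * C * (c * E))))) * kz
  -- separate variables
  set x0 := -e/d with hx0
  have hx0' : d * x0 + e = 0 := by rw [hx0]; field_simp; ring
  have sep : ∀ E : ℂ, E ≠ 0 → p.eval x0 * (((C * E + d*x0+e) * (-c*C' + d' * E)^2)
        * ((C' + E * (d'*x0+e')) * (c * C * E + d)^2))
      + ((C * E + d*x0+e) * (-c*C' + d' * E)^2) *
        ((c * E * (d'*x0+e') + E * d') * (c * C * E + d)^2
          + (C' + E * (d'*x0+e')) * (2 * (c * C * E + d) * (c * C * (c * E))))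
      - ((C' + E * (d'*x0+e')) * (c * C * E + d)^2) *
        (c * ((C * E + d*x0+e) * (-c*C' + d' * E)^2)
          + ((C * (c * E) + d) * (-c*C' + d' * E)^2
            + (C * E + d*x0+e) * (2 * (-c*C' + d' * E) * (d' * (c * E))))) = 0 := by
    intro E hE
    set W : Polynomial ℂ :=
      p * (((Polynomial.C (C * E) + Polynomial.C d*Polynomial.X+Polynomial.C e) * Polynomial.C ((-c*C' + d' * E)^2))
        * ((Polynomial.C C' + Polynomial.C E * (Polynomial.C d'*Polynomial.X+Polynomial.C e')) * Polynomial.C ((c * C * E + d)^2)))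
      + ((Polynomial.C (C * E) + Polynomial.C d*Polynomial.X+Polynomial.C e) * Polynomial.C ((-c*C' + d' * E)^2)) *
        ((Polynomial.C (c * E) * (Polynomial.C d'*Polynomial.X+Polynomial.C e') + Polynomial.C (E * d')) * Polynomial.C ((c * C * E + d)^2)
          + (Polynomial.C C' + Polynomial.C E * (Polynomial.C d'*Polynomial.X+Polynomial.C e')) * Polynomial.C (2 * (c * C * E + d) * (c * C * (c * E))))
      - ((Polynomial.C C' + Polynomial.C E * (Polynomial.C d'*Polynomial.X+Polynomial.C e')) * Polynomial.C ((c * C * E + d)^2)) *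
        (Polynomial.C c * ((Polynomial.C (C * E) + Polynomial.C d*Polynomial.X+Polynomial.C e) * Polynomial.C ((-c*C' + d' * E)^2))
          + (Polynomial.C ((C * (c * E) + d) * (-c*C' + d' * E)^2)
            + (Polynomial.C (C * E) + Polynomial.C d*Polynomial.X+Polynomial.C e) * Polynomial.C (2 * (-c*C' + d' * E) * (d' * (c * E))))) with hW
    have hWe : ∀ x, W.eval x = p.eval x * (((C * E + d*x+e) * (-c*C' + d' * E)^2)
        * ((C' + E * (d'*x+e')) * (c * C * E + d)^2))
      + ((C * E + d*x+e) * (-c*C' + d' * E)^2) *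
        ((c * E * (d'*x+e') + E * d') * (c * C * E + d)^2
          + (C' + E * (d'*x+e')) * (2 * (c * C * E + d) * (c * C * (c * E))))
      - ((C' + E * (d'*x+e')) * (c * C * E + d)^2) *
        (c * ((C * E + d*x+e) * (-c*C' + d' * E)^2)
          + ((C * (c * E) + d) * (-c*C' + d' * E)^2
            + (C * E + d*x+e) * (2 * (-c*C' + d' * E) * (d' * (c * E))))) := by
      intro x
      simp only [hW, Polynomial.eval_add, Polynomial.eval_sub, Polynomial.eval_mul, Polynomial.eval_C,
        Polynomial.eval_X]
    have hroots : ∀ j : ℕ, W.IsRoot ((Complex.log E + j * (2 * Real.pi * I)) / c) := by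
      intro j
      have hEj : cexp (c * ((Complex.log E + j * (2 * Real.pi * I)) / c)) = E := by
        rw [mul_div_cancel₀ _ hc, Complex.exp_add, Complex.exp_log hE, Complex.exp_nat_mul_two_pi_mul_I,
          mul_one]
      have := rel ((Complex.log E + j * (2 * Real.pi * I)) / c)
      rw [hEj] at this
      rw [Polynomial.IsRoot, hWe]
      linear_combination this
    have hW0 : W = 0 := by
      refine Polynomial.eq_zero_of_infinite_isRoot W ?_
      refine Set.infinite_of_injective_forall_mem (f := fun j : ℕ => (Complex.log E + j * (2 * Real.pi * I)) / c) ?_ hroots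
      intro i j hij
      have h3 : (i:ℂ) * (2 * Real.pi * I) = j * (2 * Real.pi * I) := by
        have := (div_left_inj' hc).1 hij
        exact add_left_cancel this
      have h4 := mul_right_cancel₀ Complex.two_pi_I_ne_zero h3
      exact_mod_cast h4
    rw [← hWe, hW0, Polynomial.eval_zero]
  -- let E tend to zero
  have hcont : Continuous (fun E : ℂ => p.eval x0 * (((C * E + d*x0+e) * (-c*C' + d' * E)^2)
        * ((C' + E * (d'*x0+e')) * (c * C * E + d)^2))
      + ((C * E + d*x0+e) * (-c*C' + d' * E)^2) *
        ((c * E * (d'*x0+e') + E * d') * (c * C * E + d)^2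
          + (C' + E * (d'*x0+e')) * (2 * (c * C * E + d) * (c * C * (c * E))))
      - ((C' + E * (d'*x0+e')) * (c * C * E + d)^2) *
        (c * ((C * E + d*x0+e) * (-c*C' + d' * E)^2)
          + ((C * (c * E) + d) * (-c*C' + d' * E)^2
            + (C * E + d*x0+e) * (2 * (-c*C' + d' * E) * (d' * (c * E)))))) := by fun_prop
  have hz := (eq_of_nhdsNE (z := 0) (b := fun _ => 0) (by
    filter_upwards [self_mem_nhdsWithin] with E hE
    exact sep E hE) hcont.continuousAt continuousAt_const).self_of_nhds
  beta_reduce at hz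
  simp only [mul_zero, zero_add, hx0', zero_mul, add_zero, zero_sub] at hz
  have : C' * d^2 * (d * (-c * C')^2) = 0 := by linear_combination -hz
  have h5 : C' * d^2 * (d * (-c * C')^2) ≠ 0 := by
    refine mul_ne_zero (mul_ne_zero hC'0 (pow_ne_zero 2 hd)) (mul_ne_zero hd (pow_ne_zero 2 (mul_ne_zero (neg_ne_zero.2 hc) hC'0)))
  exact h5 this

theorem Hyp.formD {F : ℕ → ℂ → ℂ} (h : Hyp F) {c : ℂ} (hc : c ≠ 0) (s : ℕ) :
    ∀ (hs : s ≤ 6), MeroEq (F (s+1)) (fun z => c * F s z) → Concl (F 0) := by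
  have hde : ∀ w, HasDerivAt (fun z => cexp (c * z)) (c * cexp (c * w)) w := fun w =>
    (((hasDerivAt_id w).const_mul c).cexp).congr_deriv (by simp; ring)
  have hme : ∀ z, MeromorphicAt (fun z => cexp (c * z)) z := fun z =>
    (show AnalyticAt ℂ (fun z => cexp (c * z)) z by fun_prop).meromorphicAt
  induction s with
  | zero =>
    intro hs hr
    obtain ⟨C, hC0, hC⟩ := h.D_form hs hr
    refine ⟨c, Complex.log C, 0, 0, 0, Or.inr (Or.inr (hC.trans fun z => ?_))⟩
    filter_upwards with w
    rw [Complex.exp_add, Complex.exp_log hC0]; ring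
  | succ t ih =>
    intro hs hr
    obtain ⟨C, hC0, hC⟩ := h.D_form hs hr
    obtain ⟨d, hd⟩ := mero_const (h := fun z => F t z - C / c * cexp (c * z))
      (fun z => (h.mero t z).fun_sub ((MeromorphicAt.const _ z).fun_mul (hme z))) (by
        intro z
        filter_upwards [hC z, (h.mero t z).eventually_analyticAt] with w e1 e3
        have d3 := e3.differentiableAt.hasDerivAt
        rw [← h.der t] at d3
        refine (d3.fun_sub ((hde w).const_mul (C/c))).deriv.trans ?_
        rw [e1]
        field_simp
        ring)
    have hF : MeroEq (F t) (fun z => C / c * cexp (c * z) + d) := by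
      intro z
      filter_upwards [hd z] with w hw
      linear_combination hw
    by_cases hd0 : d = 0
    · refine ih (by omega) fun z => ?_
      filter_upwards [hF z, hC z] with w h1 h2
      rw [h1, h2, hd0]
      field_simp
      ring
    rcases t with _ | u
    · refine ⟨c, Complex.log (C/c), -d, 0, 0, Or.inr (Or.inr (hF.trans fun z => ?_))⟩
      filter_upwards with w
      rw [Complex.exp_add, Complex.exp_log (div_ne_zero hC0 hc)]; ring
    exfalso
    obtain ⟨e, he⟩ := mero_const (h := fun z => F u z - (C / c^2 * cexp (c * z) + d * z))
      (fun z => (h.mero u z).fun_sub (((MeromorphicAt.const _ z).fun_mul (hme z)).fun_add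
        ((MeromorphicAt.const _ z).fun_mul (MeromorphicAt.id z)))) (by
        intro z
        filter_upwards [hF z, (h.mero u z).eventually_analyticAt] with w e1 e3
        have d3 := e3.differentiableAt.hasDerivAt
        rw [← h.der u] at d3
        refine (d3.fun_sub (((hde w).const_mul (C/c^2)).fun_add ((hasDerivAt_id w).const_mul d))).deriv.trans ?_
        rw [e1]
        field_simp
        ring)
    refine D_contra h (t := u) (by omega) (C := C / c^2) (d := d) (e := e) hc (div_ne_zero hC0 (pow_ne_zero 2 hc)) hd0 ?_ ?_ ?_
    · intro z
      filter_upwards [he z] with w hw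
      linear_combination hw
    · refine hF.trans fun z => ?_
      filter_upwards with w
      field_simp
    · refine hC.trans fun z => ?_
      filter_upwards with w
      field_simp

theorem Hyp.main {F : ℕ → ℂ → ℂ} (h : Hyp F)
    (hn0 : ¬ ∃ c : ℂ, MeroEq (mtilde (F 0)) (fun z => c * F 0 z)) : Concl (F 0) := by
  have hn := real_case h hn0
  obtain ⟨s, hs, ⟨c, hc⟩ | ⟨n1, n0, q2, q1, q0, hN, hode⟩⟩ := h.ode
  · exact absurd ⟨c, hc⟩ (hn (s+1) (by omega))
  have hNz : ∀ z, ∀ᶠ w in 𝓝[≠] z, n1 * w + n0 ≠ 0 := by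
    intro z
    rcases hN with h1 | ⟨h1, h2⟩
    · rw [h1]
      exact entire_nz (a := fun w => 1 * w + n0) (by fun_prop) (z0 := -n0 + 1) (by ring_nf; simp) z
    · rw [h1, h2]; filter_upwards with w; simp
  have hns := hn s (by omega)
  by_cases h2 : q2 = 0
  · by_cases h1 : q1 = 0
    · have h0 : q0 ≠ 0 := by
        rintro rfl
        obtain ⟨w, e1, e2, e3⟩ := ((hode 0).and ((hNz 0).and (h.nz (m := s) (by omega) 0))).exists
        beta_reduce at e1
        rw [h2, h1] at e1
        exact mul_ne_zero e2 e3 (by rw [e1]; ring)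
      have hr : MeroEq (F (s+1)) (fun z => (n1/q0 * z + n0/q0) * F s z) := by
        intro z
        filter_upwards [hode z] with w hw
        rw [h2, h1] at hw
        field_simp
        linear_combination -hw
      rcases hN with h3 | ⟨h3, h4⟩
      · exact (h.formE hs (γ := n1/q0) (by rw [h3]; exact div_ne_zero one_ne_zero h0) hr hns).elim
      · refine h.formD (c := n0/q0) (by rw [h4]; exact div_ne_zero one_ne_zero h0) s hs (hr.trans fun z => ?_)
        filter_upwards with w
        rw [h3]; ring
    · set a := -q0/q1 with ha
      have hr : MeroEq (F (s+1)) (fun z => (n1/q1 + ((n1 * a + n0)/q1) / (z - a)) * F s z) := by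
        intro z
        filter_upwards [hode z, evne a z] with w hw hw2
        have e1 : q2 * w^2 + q1 * w + q0 = q1 * (w - a) := by rw [h2, ha]; field_simp; ring
        rw [e1] at hw
        have e2 : F (s+1) w = (n1 * w + n0) * F s w / (q1 * (w - a)) := by
          rw [eq_div_iff (mul_ne_zero h1 hw2)]; linear_combination -hw
        rw [e2]; field_simp; ring
      by_cases h3 : n1 = 0
      · refine h.formB hn s hs (p := (n1 * a + n0)/q1) (a := a) (hr.trans fun z => ?_)
        filter_upwards with w
        rw [h3]; ring
      · by_cases h4 : (n1 * a + n0)/q1 = 0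
        · refine h.formD (c := n1/q1) (div_ne_zero h3 h1) s hs (hr.trans fun z => ?_)
          filter_upwards with w
          rw [h4]; ring
        · exact (h.formC hs (div_ne_zero h3 h1) h4 hr hns).elim
  · obtain ⟨a, ha⟩ : ∃ a : ℂ, q2 * a^2 + q1 * a + q0 = 0 := by
      have hdeg : (Polynomial.C q2 * Polynomial.X ^ 2 + Polynomial.C q1 * Polynomial.X + Polynomial.C q0 : Polynomial ℂ).degree ≠ 0 := by
        have : (Polynomial.C q2 * Polynomial.X ^ 2 + Polynomial.C q1 * Polynomial.X + Polynomial.C q0 : Polynomial ℂ).degree = 2 := by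
          compute_degree!
        rw [this]; norm_num
      obtain ⟨Y, hY⟩ := IsAlgClosed.exists_root _ hdeg
      exact ⟨Y, by simpa [Polynomial.IsRoot] using hY⟩
    set b := -q1/q2 - a with hb
    have hQ : ∀ w, q2 * w^2 + q1 * w + q0 = q2 * (w - a) * (w - b) := by
      intro w
      have : q1 = -q2 * (a + b) := by rw [hb]; field_simp; ring
      rw [this] at ha ⊢
      linear_combination ha
    have hr : MeroEq (F (s+1)) (fun z => (n1 * z + n0) / (q2 * (z - a) * (z - b)) * F s z) := by
      intro z
      filter_upwards [hode z, evne a z, evne b z] with w hw hw2 hw3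
      rw [hQ] at hw
      field_simp
      linear_combination -hw
    by_cases hab : a = b
    · have hNa : n1 * a + n0 = 0 := by
        by_contra hNa
        obtain ⟨n, hn⟩ := WithTop.ne_top_iff_exists.1 (h.fin (show s ≤ 10 by omega) a)
        have hd : HasDerivAt (fun w => q2 * (w - a)^2 / (n1 * w + n0)) 0 a := by
          refine ((((hasDerivAt_id a).sub_const a).fun_pow 2).const_mul q2 |>.fun_div
            (((hasDerivAt_id a).const_mul n1).add_const n0) hNa).congr_deriv ?_
          simp
        have := ratio_deriv (v := fun w => q2 * (w - a)^2 / (n1 * w + n0)) (h.mero s a) hn.symm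
          (AnalyticAt.fun_div (by fun_prop) (by fun_prop) hNa) (by simp) (by
            filter_upwards [hode a, hNz a] with w hw hw2
            rw [hQ, ← hab] at hw
            rw [← h.der s]
            beta_reduce
            rw [div_mul_eq_mul_div, eq_div_iff hw2]
            linear_combination hw)
        rw [hd.deriv] at this
        simp at this
      refine h.formB hn s hs (p := n1/q2) (a := a) (hr.trans fun z => ?_)
      filter_upwards [evne a z] with w hw
      rw [← hab, show n1 * w + n0 = n1 * (w - a) by linear_combination hNa]
      field_simp
    · have hab1 : a - b ≠ 0 := sub_ne_zero.2 hab
      set p := (n1 * a + n0)/(q2 * (a - b)) with hp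
      set q := -(n1 * b + n0)/(q2 * (a - b)) with hq
      have hr2 : MeroEq (F (s+1)) (fun z => (p / (z - a) + q / (z - b)) * F s z) := by
        refine hr.trans fun z => ?_
        filter_upwards [evne a z, evne b z] with w hw hw2
        rw [hp, hq]
        field_simp
        ring
      by_cases hp0 : p = 0
      · refine h.formB hn s hs (p := q) (a := b) (hr2.trans fun z => ?_)
        filter_upwards with w
        rw [hp0]; ring
      by_cases hq0 : q = 0
      · refine h.formB hn s hs (p := p) (a := a) (hr2.trans fun z => ?_)
        filter_upwards with w
        rw [hq0]; ring
      exact h.formA hs hab hp0 hq0 hr2 hns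

theorem hyp_of (f : ℂ → ℂ) (hmero : ∀ z, MeromorphicAt f z)
    (hreal : ∀ m, m ≤ 10 → ∀ z : ℂ, 0 < meroOrder (iteratedDeriv m f) z → z.im = 0) :
    Hyp (fun m => iteratedDeriv m f) := by
  have hm : ∀ m z, MeromorphicAt (iteratedDeriv m f) z := by
    intro m
    induction m with
    | zero => intro z; rw [iteratedDeriv_zero]; exact hmero z
    | succ m ih => intro z; rw [iteratedDeriv_succ]; exact (ih z).deriv
  refine ⟨hm, fun m => iteratedDeriv_succ, fun m hm10 z hz => ?_⟩
  by_contra hcon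
  push Not at hcon
  apply hz
  apply hreal m hm10 z
  unfold meroOrder
  rw [dif_pos (hm m z)]
  exact hcon

/-- Let `f` be a strictly non-real meromorphic function in the plane such that,
for every `m = 0, ..., 10`, all zeros of `f^(m)` are real.  Then `f` is of one of the forms
`(az+b)^mu`, `(az+b)/(cz+d)`, `exp(az+b) - c`. -/
theorem statement_2 (f : ℂ → ℂ) (hmero : ∀ z, MeromorphicAt f z)
    (hsnr : StrictlyNonReal f)
    (hreal : ∀ m, m ≤ 10 → ∀ z : ℂ, 0 < meroOrder (iteratedDeriv m f) z → z.im = 0) :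
    ∃ (a b c d : ℂ) (μ : ℤ),
      MeroEq f (fun z => (a * z + b) ^ μ) ∨
      MeroEq f (fun z => (a * z + b) / (c * z + d)) ∨
      MeroEq f (fun z => Complex.exp (a * z + b) - c) := by
  have h := (hyp_of f hmero hreal).main (by rw [iteratedDeriv_zero]; exact hsnr)
  rw [iteratedDeriv_zero] at h
  exact h
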